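/- Fix l ∈ {1,…,N}. Suppose y ∈ D satisfies y(a) = y^a, y_i(b) = y_i^b for all i ≠ l, and the terminal inequality constraint y_l(b) ≤ y_l^b, and y is a local minimizer (with respect to ‖·‖_{1,∞}) of J over all trajectories in D satisfying these conditions. Assume in addition that for each i = 1, …, N the function x ↦ ∂L/∂v_i(x, y(x), C D_γ^{α,β} y(x)) is absolutely continuous on [a,b] and its combined Riemann–Liouville derivative D_{1−γ}^{β,α} exists and is continuous on [a,b]. Let T := [ γ·(xI_b^{1−α}(∂L/∂v_l(·, y(·), C D_γ^{α,β} y(·))))(x) − (1−γ)·(aI_x^{1−β}(∂L/∂v_l(·, y(·), C D_γ^{α,β} y(·))))(x) ] evaluated at x = b. Then y satisfies the Euler–Lagrange equations ∂L/∂y_i + D_{1−γ}^{β,α}(∂L/∂v_i) = 0 along y for i = 1,…,N on [a,b], together with the complementarity conditions: T ≤ 0, y_l(b) ≤ y_l^b, and (y_l(b) − y_l^b)·T = 0. -/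

import Mathlib

open MeasureTheory Set Real

noncomputable section

/-- Left Riemann–Liouville fractional integral `(ₐIₓ^α f)(x)`. -/
def leftRLI (a α : ℝ) (f : ℝ → ℝ) (x : ℝ) : ℝ :=
  (1 / Real.Gamma α) * ∫ t in a..x, (x - t) ^ (α - 1) * f t

/-- Right Riemann–Liouville fractional integral `(ₓI_b^α f)(x)`. -/
def rightRLI (b α : ℝ) (f : ℝ → ℝ) (x : ℝ) : ℝ :=
  (1 / Real.Gamma α) * ∫ t in x..b, (t - x) ^ (α - 1) * f t

/-- A function is absolutely continuous on `[a, b]` iff it is the integral of its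
(almost everywhere defined) derivative. -/
def AbsolutelyContinuousOn (f : ℝ → ℝ) (a b : ℝ) : Prop :=
  IntervalIntegrable (deriv f) volume a b ∧
    ∀ x ∈ Icc a b, f x = f a + ∫ t in a..x, deriv f t

/-- Left Caputo fractional derivative `(ᶜₐDₓ^α f)(x)`. -/
def caputoLeft (a α : ℝ) (f : ℝ → ℝ) (x : ℝ) : ℝ :=
  (1 / Real.Gamma (1 - α)) * ∫ t in a..x, (x - t) ^ (-α) * deriv f t

/-- Right Caputo fractional derivative `(ᶜₓD_b^α f)(x)`. -/
def caputoRight (b α : ℝ) (f : ℝ → ℝ) (x : ℝ) : ℝ :=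
  -(1 / Real.Gamma (1 - α)) * ∫ t in x..b, (t - x) ^ (-α) * deriv f t

/-- Left Riemann–Liouville fractional derivative `(ₐDₓ^α g)(x) = d/dx (ₐIₓ^{1-α} g)(x)`. -/
def rlLeftD (a α : ℝ) (g : ℝ → ℝ) (x : ℝ) : ℝ :=
  deriv (leftRLI a (1 - α) g) x

/-- Right Riemann–Liouville fractional derivative `(ₓD_b^α g)(x) = -d/dx (ₓI_b^{1-α} g)(x)`. -/
def rlRightD (b α : ℝ) (g : ℝ → ℝ) (x : ℝ) : ℝ :=
  -deriv (rightRLI b (1 - α) g) x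

/-- Combined Caputo fractional derivative `ᶜD_γ^{α,β} f = γ ᶜₐDₓ^α f + (1-γ) ᶜₓD_b^β f`. -/
def combCaputo (a b α β γ : ℝ) (f : ℝ → ℝ) (x : ℝ) : ℝ :=
  γ * caputoLeft a α f x + (1 - γ) * caputoRight b β f x

/-- Combined Riemann–Liouville derivative `D_{1-γ}^{β,α} g = (1-γ) ₐDₓ^β g + γ ₓD_b^α g`. -/
def combRL (a b α β γ : ℝ) (g : ℝ → ℝ) (x : ℝ) : ℝ :=
  (1 - γ) * rlLeftD a β g x + γ * rlRightD b α g x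

/-- Componentwise combined Caputo derivative of a vector-valued function. -/
def combCaputoVec (a b α β γ : ℝ) {N : ℕ} (y : ℝ → Fin N → ℝ) (x : ℝ) : Fin N → ℝ :=
  fun i => combCaputo a b α β γ (fun t => y t i) x

/-- The class `𝐃` of trajectories: each component absolutely continuous on `[a,b]` and the
combined Caputo derivative exists and is continuous on `[a,b]`. -/
def memD (a b α β γ : ℝ) {N : ℕ} (y : ℝ → Fin N → ℝ) : Prop :=
  (∀ i, AbsolutelyContinuousOn (fun t => y t i) a b) ∧
    ∀ i, ContinuousOn (fun x => combCaputo a b α β γ (fun t => y t i) x) (Icc a b)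

/-- The norm `‖y‖_{1,∞} = max_{[a,b]} ‖y(x)‖ + max_{[a,b]} ‖ᶜD_γ^{α,β} y(x)‖`. -/
def norm1inf (a b α β γ : ℝ) {N : ℕ} (y : ℝ → Fin N → ℝ) : ℝ :=
  sSup ((fun x => ‖y x‖) '' Icc a b) +
    sSup ((fun x => ‖combCaputoVec a b α β γ y x‖) '' Icc a b)

/-- Partial derivative of a Lagrangian `L(x, y, v)` w.r.t. the `i`-th component of `y`. -/
def pdY {N : ℕ} (L : ℝ → (Fin N → ℝ) → (Fin N → ℝ) → ℝ) (i : Fin N) (x : ℝ)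
    (u v : Fin N → ℝ) : ℝ :=
  deriv (fun s => L x (Function.update u i s) v) (u i)

/-- Partial derivative of a Lagrangian `L(x, y, v)` w.r.t. the `i`-th component of `v`. -/
def pdV {N : ℕ} (L : ℝ → (Fin N → ℝ) → (Fin N → ℝ) → ℝ) (i : Fin N) (x : ℝ)
    (u v : Fin N → ℝ) : ℝ :=
  deriv (fun s => L x u (Function.update v i s)) (v i)

open Filter Topology

/-- The potential `∫ k (x - t) w t dt`. -/
def pot (k w : ℝ → ℝ) (x : ℝ) : ℝ := ∫ t, k (x - t) * w t

/-- The potential of `w` converges absolutely at `x`. -/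
def PotConv (k w : ℝ → ℝ) (x : ℝ) : Prop := Integrable (fun t => k (x - t) * w t)

/-- Integrable kernels, singular at most like `1 / |s|` at the origin and continuous off
`{0, R, -R}`. -/
structure IsKer (k : ℝ → ℝ) (R : ℝ) : Prop where
  meas : Measurable k
  int : Integrable k
  bound : ∃ C, 0 ≤ C ∧ ∀ s, |k s| * |s| ≤ C
  cont : ∀ s, s ≠ 0 → |s| ≠ R → ContinuousAt k s

/-- Integrable densities vanishing outside `[a, b]`. -/
structure IsDens (a b : ℝ) (w : ℝ → ℝ) : Prop where
  int : Integrable w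
  supp : ∀ t, t ∉ Icc a b → w t = 0

/-- Bounded densities vanishing outside `[a, b]`. -/
structure IsBddDens (a b : ℝ) (w : ℝ → ℝ) : Prop extends IsDens a b w where
  bdd : ∃ M, 0 ≤ M ∧ ∀ t, |w t| ≤ M

lemma IsDens.add {a b : ℝ} {u v : ℝ → ℝ} (hu : IsDens a b u) (hv : IsDens a b v) :
    IsDens a b (fun t => u t + v t) :=
  ⟨hu.int.add hv.int, fun t ht => by simp [hu.supp t ht, hv.supp t ht]⟩

lemma IsDens.sub {a b : ℝ} {u v : ℝ → ℝ} (hu : IsDens a b u) (hv : IsDens a b v) :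
    IsDens a b (fun t => u t - v t) :=
  ⟨hu.int.sub hv.int, fun t ht => by simp [hu.supp t ht, hv.supp t ht]⟩

lemma IsDens.const_mul {a b : ℝ} {u : ℝ → ℝ} (hu : IsDens a b u) (c : ℝ) :
    IsDens a b (fun t => c * u t) :=
  ⟨hu.int.const_mul c, fun t ht => by simp [hu.supp t ht]⟩

lemma IsBddDens.add {a b : ℝ} {u v : ℝ → ℝ} (hu : IsBddDens a b u) (hv : IsBddDens a b v) :
    IsBddDens a b (fun t => u t + v t) := by
  obtain ⟨M, hM0, hM⟩ := hu.bdd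
  obtain ⟨M', hM0', hM'⟩ := hv.bdd
  exact ⟨hu.toIsDens.add hv.toIsDens, M + M', by positivity,
    fun t => (abs_add_le _ _).trans (add_le_add (hM t) (hM' t))⟩

lemma IsBddDens.const_mul {a b : ℝ} {u : ℝ → ℝ} (hu : IsBddDens a b u) (c : ℝ) :
    IsBddDens a b (fun t => c * u t) := by
  obtain ⟨M, hM0, hM⟩ := hu.bdd
  exact ⟨hu.toIsDens.const_mul c, |c| * M, by positivity,
    fun t => by rw [abs_mul]; exact mul_le_mul_of_nonneg_left (hM t) (abs_nonneg c)⟩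

lemma isBddDens_zero (a b : ℝ) : IsBddDens a b (fun _ => 0) :=
  ⟨⟨integrable_zero _ _ _, fun _ _ => rfl⟩, 0, le_rfl, by simp⟩

lemma isBddDens_sum {a b : ℝ} {ι : Type*} (s : Finset ι) {u : ι → ℝ → ℝ}
    (hu : ∀ i, IsBddDens a b (u i)) : IsBddDens a b (fun t => ∑ i ∈ s, u i t) := by
  classical
  induction s using Finset.induction_on with
  | empty => simpa using isBddDens_zero a b
  | insert i s hi ih => simpa [Finset.sum_insert hi] using (hu i).add ih

lemma IsKer.linComb {k k' : ℝ → ℝ} {R : ℝ} (hk : IsKer k R) (hk' : IsKer k' R) (c c' : ℝ) :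
    IsKer (fun s => c * k s + c' * k' s) R := by
  obtain ⟨C, hC0, hC⟩ := hk.bound
  obtain ⟨C', hC0', hC'⟩ := hk'.bound
  refine ⟨(hk.meas.const_mul c).add (hk'.meas.const_mul c'),
    (hk.int.const_mul c).add (hk'.int.const_mul c'), ⟨|c| * C + |c'| * C', by positivity, ?_⟩, ?_⟩
  · intro s
    calc |c * k s + c' * k' s| * |s| ≤ (|c * k s| + |c' * k' s|) * |s| := by
          gcongr; exact abs_add_le _ _
      _ = |c| * (|k s| * |s|) + |c'| * (|k' s| * |s|) := by rw [abs_mul, abs_mul]; ring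
      _ ≤ _ := by gcongr <;> simp_all
  · intro s hs hsR
    exact ((hk.cont s hs hsR).const_mul c).add ((hk'.cont s hs hsR).const_mul c')

lemma tendsto_integral_abs_translate_sub {w : ℝ → ℝ} (hw : Integrable w) :
    Tendsto (fun h => ∫ t, |w (t + h) - w t|) (𝓝 0) (𝓝 0) := by
  let g : C(ℝ, C(ℝ, ℝ)) := (ContinuousMap.mk (fun p : ℝ × ℝ => p.2 + p.1) (by fun_prop)).curry
  have hg : ∀ h, MeasurePreserving (g h) volume volume := fun h =>
    measurePreserving_add_right volume h
  have hmem : MemLp w 1 volume := memLp_one_iff_integrable.2 hw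
  have hc : Continuous fun h => Lp.compMeasurePreserving (g h) (hg h) (hmem.toLp w) :=
    continuous_const.compMeasurePreservingLp g.continuous hg (by simp)
  have h1 := (hc.sub (continuous_const (y := hmem.toLp w))).norm.tendsto 0
  have key : ∀ h, ‖Lp.compMeasurePreserving (g h) (hg h) (hmem.toLp w) - hmem.toLp w‖
      = ∫ t, |w (t + h) - w t| := by
    intro h
    rw [L1.norm_eq_integral_norm]
    apply integral_congr_ae
    have e1 := Lp.coeFn_compMeasurePreserving (hmem.toLp w) (hg h)
    have e2 := hmem.coeFn_toLp
    have e3 := (hg h).quasiMeasurePreserving.ae_eq_comp e2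
    filter_upwards [e1, e2, e3, Lp.coeFn_sub
      (Lp.compMeasurePreserving (g h) (hg h) (hmem.toLp w)) (hmem.toLp w)] with t h1 h2 h3 h4
    rw [h4, Pi.sub_apply, h1, h2, h3, Real.norm_eq_abs]
    rfl
  simp only [Pi.sub_apply] at h1
  rw [key 0] at h1
  simpa only [key, add_zero, sub_self, abs_zero, integral_zero] using h1

lemma aestronglyMeasurable_pot_integrand {k w : ℝ → ℝ} (hk : Measurable k)
    (hw : AEStronglyMeasurable w volume) (x : ℝ) :
    AEStronglyMeasurable (fun t => k (x - t) * w t) volume :=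
  ((hk.comp (measurable_const.sub measurable_id)).aestronglyMeasurable).mul hw

lemma PotConv.of_bdd {k w : ℝ → ℝ} (hk : Measurable k) (hki : Integrable k)
    (hw : AEStronglyMeasurable w volume) {M : ℝ} (hM : ∀ t, |w t| ≤ M) (x : ℝ) :
    PotConv k w x := by
  refine Integrable.mono' (((hki.comp_sub_left x).norm).mul_const M)
    (aestronglyMeasurable_pot_integrand hk hw x) (.of_forall fun t => ?_)
  rw [norm_mul]
  exact mul_le_mul_of_nonneg_left (hM t) (norm_nonneg _)

lemma abs_pot_le_of_bdd {k w : ℝ → ℝ} (hki : Integrable k) {M : ℝ} (hM : ∀ t, |w t| ≤ M) (x : ℝ) :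
    |pot k w x| ≤ M * ∫ s, |k s| := by
  have h1 : ∫ t, |k (x - t)| = ∫ s, |k s| := integral_sub_left_eq_self (fun s => |k s|) volume x
  calc |pot k w x| ≤ ∫ t, |k (x - t)| * M := by
        refine norm_integral_le_of_norm_le (f := fun t => k (x - t) * w t) (((hki.comp_sub_left x).norm).mul_const M)
          (.of_forall fun t => ?_)
        rw [norm_mul]
        exact mul_le_mul_of_nonneg_left (hM t) (norm_nonneg _)
    _ = M * ∫ s, |k s| := by rw [integral_mul_const, h1, mul_comm]

lemma continuous_pot_of_bdd {k w : ℝ → ℝ} (hk : Measurable k) (hki : Integrable k)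
    (hw : AEStronglyMeasurable w volume) {M : ℝ} (hM : ∀ t, |w t| ≤ M) :
    Continuous (pot k w) := by
  rw [continuous_iff_continuousAt]
  intro x
  rw [ContinuousAt, tendsto_iff_norm_sub_tendsto_zero]
  have hT := ((tendsto_integral_abs_translate_sub hki).comp
    (show Tendsto (fun y => y - x) (𝓝 x) (𝓝 0) by
      have : Continuous fun y : ℝ => y - x := by fun_prop
      simpa using this.tendsto x)).mul_const M
  rw [zero_mul] at hT
  refine squeeze_zero (fun _ => norm_nonneg _) (fun y => ?_) hT
  have h0 : ∫ t, |k (y - t) - k (x - t)| = ∫ t, |k (t + (y - x)) - k t| := by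
    rw [← integral_sub_left_eq_self (fun t => |k (t + (y - x)) - k t|) volume x]
    congr 1; ext t; congr 3; ring
  have hintg : Integrable fun t => |k (y - t) - k (x - t)| :=
    ((hki.comp_sub_left y).sub (hki.comp_sub_left x)).norm
  simp only [Function.comp_apply]
  rw [pot, pot, ← integral_sub (PotConv.of_bdd hk hki hw hM y) (PotConv.of_bdd hk hki hw hM x),
    ← h0, ← integral_mul_const]
  refine norm_integral_le_of_norm_le (hintg.mul_const M) (.of_forall fun t => ?_)
  rw [← sub_mul, norm_mul]
  exact mul_le_mul_of_nonneg_left (hM t) (norm_nonneg _)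

lemma PotConv.ae {k w : ℝ → ℝ} (hki : Integrable k) (hw : Integrable w) :
    ∀ᵐ x, PotConv k w x := by
  have h := hw.ae_convolution_exists (L := ContinuousLinearMap.mul ℝ ℝ) (ν := volume)
    (μ := volume) hki
  filter_upwards [h] with x hx
  refine hx.congr (.of_forall fun t => ?_)
  simp [mul_comm]

lemma PotConv.add {k u v : ℝ → ℝ} {x : ℝ} (hu : PotConv k u x) (hv : PotConv k v x) :
    PotConv k (fun t => u t + v t) x := by
  simp only [PotConv, mul_add]; exact Integrable.add hu hv

lemma PotConv.sub {k u v : ℝ → ℝ} {x : ℝ} (hu : PotConv k u x) (hv : PotConv k v x) :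
    PotConv k (fun t => u t - v t) x := by
  simp only [PotConv, mul_sub]; exact Integrable.sub hu hv

lemma PotConv.const_mul {k u : ℝ → ℝ} {x : ℝ} (hu : PotConv k u x) (c : ℝ) :
    PotConv k (fun t => c * u t) x := by
  simpa only [PotConv, mul_left_comm] using Integrable.const_mul hu c

lemma pot_add {k u v : ℝ → ℝ} {x : ℝ} (hu : PotConv k u x) (hv : PotConv k v x) :
    pot k (fun t => u t + v t) x = pot k u x + pot k v x := by
  simp only [pot, mul_add]; exact integral_add hu hv

lemma pot_sub {k u v : ℝ → ℝ} {x : ℝ} (hu : PotConv k u x) (hv : PotConv k v x) :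
    pot k (fun t => u t - v t) x = pot k u x - pot k v x := by
  simp only [pot, mul_sub]; exact integral_sub hu hv

lemma pot_const_mul (k u : ℝ → ℝ) (x c : ℝ) :
    pot k (fun t => c * u t) x = c * pot k u x := by
  simp only [pot, mul_left_comm]; exact integral_const_mul _ _

lemma pot_undef {k u : ℝ → ℝ} {x : ℝ} (hu : ¬ PotConv k u x) : pot k u x = 0 :=
  integral_undef hu

lemma pot_congr_ae {k u v : ℝ → ℝ} (h : u =ᵐ[volume] v) (x : ℝ) : pot k u x = pot k v x :=
  integral_congr_ae (h.mono fun t ht => by simp only [ht])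

/-- Away from the points where the density lives, potentials converge and are continuous. -/
lemma pot_far {k w : ℝ → ℝ} {a b R r x₀ : ℝ} (hk : IsKer k R) (hR : b - a < R)
    (hw : IsDens a b w) (hx₀ : x₀ ∈ Icc a b) (hr : 0 < r) (h0 : ∀ t, |t - x₀| < r → w t = 0) :
    PotConv k w x₀ ∧ ContinuousWithinAt (pot k w) (Icc a b) x₀ := by
  obtain ⟨C, hC0, hC⟩ := hk.bound
  have hb : ∀ x, |x - x₀| < r / 2 → ∀ t, ‖k (x - t) * w t‖ ≤ C / (r / 2) * |w t| := by
    intro x hx t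
    by_cases ht : |t - x₀| < r
    · simp [h0 t ht]
    · rw [norm_mul]
      refine mul_le_mul_of_nonneg_right ?_ (abs_nonneg _)
      have h1 : r / 2 ≤ |x - t| := by
        have := abs_sub_le t x x₀
        rw [abs_sub_comm t x] at this; linarith
      rw [le_div_iff₀ (by positivity)]
      exact (mul_le_mul_of_nonneg_left h1 (norm_nonneg _)).trans (hC _)
  constructor
  · exact Integrable.mono' (hw.int.norm.const_mul _)
      (aestronglyMeasurable_pot_integrand hk.meas hw.int.aestronglyMeasurable x₀)
      (.of_forall (hb x₀ (by simpa using by positivity)))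
  · refine tendsto_integral_filter_of_dominated_convergence (fun t => C / (r / 2) * |w t|)
      (.of_forall fun x =>
        aestronglyMeasurable_pot_integrand hk.meas hw.int.aestronglyMeasurable x) ?_
      (hw.int.norm.const_mul _) (.of_forall fun t => ?_)
    · have : ∀ᶠ x in 𝓝[Icc a b] x₀, |x - x₀| < r / 2 := by
        refine nhdsWithin_le_nhds ?_
        have := Metric.ball_mem_nhds x₀ (half_pos hr)
        filter_upwards [this] with x hx
        simpa [Real.dist_eq] using hx
      filter_upwards [this] with x hx
      exact .of_forall (hb x hx)
    · by_cases ht : |t - x₀| < r ∨ t ∉ Icc a b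
      · have : w t = 0 := ht.elim (h0 t) (hw.supp t)
        simpa [this] using tendsto_const_nhds
      · push Not at ht
        refine Tendsto.mul_const _ ?_
        have hc : ContinuousAt k (x₀ - t) := by
          refine hk.cont _ ?_ ?_
          · intro h; rw [sub_eq_zero] at h; simp [h] at ht; linarith [ht.1]
          · refine ne_of_lt ?_
            rw [abs_lt]; constructor <;> linarith [ht.2.1, ht.2.2, hx₀.1, hx₀.2]
        exact (ContinuousAt.comp (f := fun x => x - t) hc
          (by fun_prop)).tendsto.mono_left nhdsWithin_le_nhds

/-- Potentials of densities that are bounded near a point converge and are continuous there. -/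
lemma pot_locally_bdd {k w : ℝ → ℝ} {a b R r M x₀ : ℝ} (hk : IsKer k R) (hR : b - a < R)
    (hw : IsDens a b w) (hx₀ : x₀ ∈ Icc a b) (hr : 0 < r) (h0 : ∀ t, |t - x₀| < r → |w t| ≤ M) :
    PotConv k w x₀ ∧ ContinuousWithinAt (pot k w) (Icc a b) x₀ := by
  set s : Set ℝ := Metric.ball x₀ r
  have hs : MeasurableSet s := measurableSet_ball
  have hmem : ∀ t, t ∈ s ↔ |t - x₀| < r := fun t => by simp [s, Real.dist_eq]
  set u := s.indicator w
  set v := sᶜ.indicator w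
  have huv : w = fun t => u t + v t := by
    ext t; by_cases h : t ∈ s <;> simp [u, v, h]
  have hu : ∀ t, |u t| ≤ max M 0 := by
    intro t
    by_cases h : t ∈ s
    · simp only [u, indicator_of_mem h]; exact (h0 t ((hmem t).1 h)).trans (le_max_left _ _)
    · simp [u, h]
  have hum : AEStronglyMeasurable u volume := hw.int.aestronglyMeasurable.indicator hs
  have hv : IsDens a b v := ⟨hw.int.indicator hs.compl, fun t ht => by
    by_cases h : t ∈ s <;> simp [v, h, hw.supp t ht]⟩
  obtain ⟨hv1, hv2⟩ := pot_far hk hR hv hx₀ hr (fun t ht => by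
    simp [v, (hmem t).2 ht])
  have hu1 := PotConv.of_bdd hk.meas hk.int hum hu
  have hfar : ∀ x, |x - x₀| < r → x ∈ Icc a b → PotConv k v x := by
    intro x hx hxab
    refine (pot_far hk hR hv hxab (r := r - |x - x₀|) (by linarith) fun t ht => ?_).1
    have : t ∈ s := by
      rw [hmem]; have := abs_sub_le t x x₀; linarith
    simp [v, this]
  refine ⟨by rw [huv]; exact (hu1 x₀).add hv1, ?_⟩
  have : ContinuousWithinAt (fun x => pot k u x + pot k v x) (Icc a b) x₀ :=
    (continuous_pot_of_bdd hk.meas hk.int hum hu).continuousWithinAt.add hv2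
  refine this.congr_of_eventuallyEq ?_ ?_
  · filter_upwards [nhdsWithin_le_nhds (Metric.ball_mem_nhds x₀ hr), self_mem_nhdsWithin]
      with x hx hx'
    conv_lhs => rw [huv]
    exact pot_add (hu1 x) (hfar x ((hmem x).1 hx) hx')
  · conv_lhs => rw [huv]
    exact pot_add (hu1 x₀) hv1

/-- The average of `w` over the segment from `t` to `t + s`. -/
def stek (s : ℝ) (w : ℝ → ℝ) (t : ℝ) : ℝ := ∫ u in Ioc (0 : ℝ) 1, w (t + s * u)

lemma stek_integrable_prod {w : ℝ → ℝ} (hw : Integrable w) (s : ℝ) :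
    Integrable (fun p : ℝ × ℝ => w (p.1 + s * p.2))
      (volume.prod (volume.restrict (Ioc (0 : ℝ) 1))) := by
  have hq : Measure.QuasiMeasurePreserving (fun p : ℝ × ℝ => p.1 + s * p.2)
      (volume.prod (volume.restrict (Ioc (0 : ℝ) 1))) volume :=
    QuasiMeasurePreserving.prod_of_left (by fun_prop) (.of_forall fun u =>
      (measurePreserving_add_right volume (s * u)).quasiMeasurePreserving)
  have hm : AEStronglyMeasurable (fun p : ℝ × ℝ => w (p.1 + s * p.2))
      (volume.prod (volume.restrict (Ioc (0 : ℝ) 1))) :=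
    hw.aestronglyMeasurable.comp_quasiMeasurePreserving hq
  rw [integrable_prod_iff' hm]
  refine ⟨.of_forall fun u => hw.comp_add_right (s * u), ?_⟩
  simp only [integral_add_right_eq_self (fun t => ‖w t‖)]
  exact integrable_const _

lemma stek_integrable {w : ℝ → ℝ} (hw : Integrable w) (s : ℝ) : Integrable (stek s w) :=
  (stek_integrable_prod hw s).integral_prod_left

lemma abs_stek_le {w : ℝ → ℝ} (hw : Integrable w) {s : ℝ} (hs : s ≠ 0) (t : ℝ) :
    |stek s w t| ≤ |s|⁻¹ * ∫ t, |w t| := by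
  have : stek s w t = s⁻¹ * ∫ x in (t + s * 0)..(t + s * 1), w x := by
    rw [stek, ← intervalIntegral.integral_of_le zero_le_one,
      intervalIntegral.integral_comp_add_mul (f := w) hs t, smul_eq_mul]
  rw [this, abs_mul, abs_inv]
  gcongr
  calc |∫ x in (t + s * 0)..(t + s * 1), w x|
      ≤ ∫ x in uIoc (t + s * 0) (t + s * 1), ‖w x‖ := by
        rw [← Real.norm_eq_abs]; exact intervalIntegral.norm_integral_le_integral_norm_uIoc
    _ ≤ ∫ x, |w x| := setIntegral_le_integral hw.norm (.of_forall fun x => norm_nonneg _)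

lemma stek_sub_le {w : ℝ → ℝ} (hw : Integrable w) {ε : ℝ} (hε : 0 < ε) :
    ∃ s₀ > 0, ∀ s, |s| < s₀ → ∫ t, |stek s w t - w t| ≤ ε := by
  obtain ⟨δ, hδ, h⟩ := Metric.tendsto_nhds_nhds.1 (tendsto_integral_abs_translate_sub hw) ε hε
  refine ⟨δ, hδ, fun s hs => ?_⟩
  have hintg : Integrable (fun p : ℝ × ℝ => w (p.1 + s * p.2) - w p.1)
      (volume.prod (volume.restrict (Ioc (0 : ℝ) 1))) :=
    (stek_integrable_prod hw s).sub (hw.comp_fst _)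
  have hae : ∀ᵐ t, Integrable (fun u => w (t + s * u)) (volume.restrict (Ioc (0 : ℝ) 1)) :=
    (stek_integrable_prod hw s).prod_right_ae
  calc ∫ t, |stek s w t - w t|
      ≤ ∫ t, ∫ u in Ioc (0 : ℝ) 1, |w (t + s * u) - w t| := by
        refine integral_mono_ae ((stek_integrable hw s).sub hw).norm hintg.norm.integral_prod_left ?_
        filter_upwards [hae] with t ht
        have h1 : stek s w t - w t = ∫ u in Ioc (0 : ℝ) 1, (w (t + s * u) - w t) := by
          rw [integral_sub ht (integrable_const _)]; simp [stek]
        rw [h1]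
        exact norm_integral_le_integral_norm (fun u => w (t + s * u) - w t)
    _ = ∫ u in Ioc (0 : ℝ) 1, ∫ t, |w (t + s * u) - w t| :=
        integral_integral_swap (f := fun t u => |w (t + s * u) - w t|) hintg.norm
    _ ≤ ∫ u in Ioc (0 : ℝ) 1, ε := by
        refine setIntegral_mono_on hintg.norm.integral_prod_right (integrable_const _)
          measurableSet_Ioc fun u hu => ?_
        have h2 := h (x := s * u) (by
          rw [Real.dist_eq, sub_zero, abs_mul, abs_of_pos hu.1]
          nlinarith [hu.2, hu.1, abs_nonneg s])
        rw [Real.dist_eq, sub_zero] at h2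
        exact (le_abs_self _).trans h2.le
    _ = ε := by simp

lemma pot_stek {k w : ℝ → ℝ} (hk : Measurable k) (hki : Integrable k) (hw : Integrable w)
    {s : ℝ} (hs : s ≠ 0) (x : ℝ) :
    pot k (stek s w) x = ∫ u in Ioc (0 : ℝ) 1, pot k w (x + s * u) := by
  have h0 := stek_integrable_prod hw s
  have hm : AEStronglyMeasurable (fun p : ℝ × ℝ => k (x - p.1) * w (p.1 + s * p.2))
      (volume.prod (volume.restrict (Ioc (0 : ℝ) 1))) :=
    (hk.comp (measurable_const.sub measurable_fst)).aestronglyMeasurable.mul h0.1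
  have hintg : Integrable (fun p : ℝ × ℝ => k (x - p.1) * w (p.1 + s * p.2))
      (volume.prod (volume.restrict (Ioc (0 : ℝ) 1))) := by
    rw [integrable_prod_iff hm]
    refine ⟨h0.prod_right_ae.mono fun t ht => ht.const_mul (k (x - t)), ?_⟩
    have h1 : ∀ t, ∫ u in Ioc (0 : ℝ) 1, ‖k (x - t) * w (t + s * u)‖
        = |k (x - t)| * stek s (fun t => |w t|) t := by
      intro t
      simp only [norm_mul, Real.norm_eq_abs]
      exact integral_const_mul _ _
    simp only [h1]
    refine PotConv.of_bdd (k := fun s => |k s|) hk.norm hki.norm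
      (stek_integrable hw.norm s).aestronglyMeasurable (abs_stek_le hw.norm hs) x
  calc pot k (stek s w) x = ∫ t, ∫ u in Ioc (0 : ℝ) 1, k (x - t) * w (t + s * u) := by
        simp only [pot, stek, integral_const_mul]
    _ = ∫ u in Ioc (0 : ℝ) 1, ∫ t, k (x - t) * w (t + s * u) := integral_integral_swap hintg
    _ = _ := by
        congr 1; ext u
        rw [pot, ← integral_add_right_eq_self (fun t => k (x + s * u - t) * w t) (s * u)]
        congr 1; ext t; congr 2; ring

/-- The localized smoothing error `χ (stek s w - w)`. -/
def bump (χ w : ℝ → ℝ) (s t : ℝ) : ℝ := χ t * (stek s w t - w t)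

/-- The commutator of multiplication by `χ` with the potential operator. -/
def cutComm (k χ v : ℝ → ℝ) (x : ℝ) : ℝ := ∫ t, k (x - t) * ((χ t - χ x) * v t)

lemma comm_bound {k χ : ℝ → ℝ} {R Λ : ℝ} (hk : IsKer k R) (hΛ : 0 ≤ Λ)
    (hχ : ∀ s t, |χ s - χ t| ≤ Λ * |s - t|) :
    ∃ C, 0 ≤ C ∧ ∀ x t c, ‖k (x - t) * ((χ t - χ x) * c)‖ ≤ C * |c| := by
  obtain ⟨C, hC0, hC⟩ := hk.bound
  refine ⟨C * Λ, by positivity, fun x t c => ?_⟩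
  calc ‖k (x - t) * ((χ t - χ x) * c)‖ = |k (x - t)| * |χ t - χ x| * |c| := by
        rw [norm_mul, norm_mul, ← mul_assoc]; rfl
    _ ≤ |k (x - t)| * (Λ * |x - t|) * |c| := by
        gcongr; rw [abs_sub_comm x t]; exact hχ t x
    _ = (|k (x - t)| * |x - t|) * Λ * |c| := by ring
    _ ≤ _ := by gcongr; exact hC _

lemma continuous_of_lip {χ : ℝ → ℝ} {Λ : ℝ} (hΛ : 0 ≤ Λ)
    (hχ : ∀ s t, |χ s - χ t| ≤ Λ * |s - t|) : Continuous χ := by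
  have : LipschitzWith ⟨Λ, hΛ⟩ χ := LipschitzWith.of_dist_le_mul fun s t => by
    rw [Real.dist_eq, Real.dist_eq]; exact hχ s t
  exact this.continuous

lemma comm_integrable {k χ v : ℝ → ℝ} {R Λ : ℝ} (hk : IsKer k R) (hΛ : 0 ≤ Λ)
    (hχ : ∀ s t, |χ s - χ t| ≤ Λ * |s - t|) (hv : Integrable v) (x : ℝ) :
    Integrable fun t => k (x - t) * ((χ t - χ x) * v t) := by
  obtain ⟨C, -, hC⟩ := comm_bound hk hΛ hχ
  have hc := continuous_of_lip hΛ hχ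
  refine Integrable.mono' (hv.norm.const_mul C) ?_ (.of_forall fun t => hC x t (v t))
  exact aestronglyMeasurable_pot_integrand hk.meas
    ((hc.sub continuous_const).aestronglyMeasurable.mul hv.aestronglyMeasurable) x

lemma comm_continuous {k χ v : ℝ → ℝ} {R Λ : ℝ} (hk : IsKer k R) (hΛ : 0 ≤ Λ)
    (hχ : ∀ s t, |χ s - χ t| ≤ Λ * |s - t|) (hv : Integrable v) : Continuous (cutComm k χ v) := by
  obtain ⟨C, -, hC⟩ := comm_bound hk hΛ hχ
  have hc := continuous_of_lip hΛ hχ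
  rw [continuous_iff_continuousAt]
  intro x₀
  refine tendsto_integral_filter_of_dominated_convergence (fun t => C * |v t|)
    (.of_forall fun x => (comm_integrable hk hΛ hχ hv x).aestronglyMeasurable)
    (.of_forall fun x => .of_forall fun t => hC x t (v t)) (hv.norm.const_mul C) ?_
  have hnull : ∀ᵐ t : ℝ, t ∉ ({x₀, x₀ - R, x₀ + R} : Set ℝ) := by
    refine measure_eq_zero_iff_ae_notMem.1 ?_
    exact (Set.toFinite _).measure_zero _
  filter_upwards [hnull] with t ht
  simp only [mem_insert_iff, mem_singleton_iff, not_or] at ht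
  have hkc : ContinuousAt k (x₀ - t) := by
    refine hk.cont _ (fun h => ht.1 (by linarith)) fun h => ?_
    rcases abs_choice (x₀ - t) with h' | h'
    · exact ht.2.1 (by linarith)
    · exact ht.2.2 (by linarith)
  have h1 : ContinuousAt (fun x => k (x - t)) x₀ :=
    ContinuousAt.comp (f := fun x => x - t) hkc (by fun_prop)
  exact (h1.mul ((continuousAt_const.sub hc.continuousAt).mul continuousAt_const)).tendsto

lemma pot_mul_cutoff {k χ v : ℝ → ℝ} {R Λ x : ℝ} (hk : IsKer k R) (hΛ : 0 ≤ Λ)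
    (hχ : ∀ s t, |χ s - χ t| ≤ Λ * |s - t|) (hv : Integrable v) (hc : PotConv k v x) :
    pot k (fun t => χ t * v t) x = χ x * pot k v x + cutComm k χ v x := by
  rw [pot, pot, cutComm, ← integral_const_mul,
    ← integral_add (Integrable.const_mul hc _) (comm_integrable hk hΛ hχ hv x)]
  congr 1; ext t; ring

lemma ae_affine {p : ℝ → Prop} (h : ∀ᵐ x, p x) {s : ℝ} (hs : s ≠ 0) (x : ℝ) :
    ∀ᵐ u : ℝ, p (x + s * u) := by
  have h1 : ∀ᵐ v : ℝ, p (x + v) := 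
    (measurePreserving_add_left volume x).quasiMeasurePreserving.ae h
  have : Measure.QuasiMeasurePreserving (fun u : ℝ => s * u) volume volume := by
    refine ⟨by fun_prop, ?_⟩
    rw [Real.map_volume_mul_left hs]
    exact Measure.smul_absolutelyContinuous
  exact this.ae h1

lemma bump_remainder {k w F χ : ℝ → ℝ} {a b R Λ δ τ : ℝ} (hk : IsKer k R)
    (hw : IsDens a b w) (hF : Continuous F) (hwF : ∀ᵐ x, x ∈ Icc a b → pot k w x = F x)
    (hΛ : 0 ≤ Λ) (hχ : ∀ s t, |χ s - χ t| ≤ Λ * |s - t|) (hχ1 : ∀ t, |χ t| ≤ 1)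
    (hδ : 0 < δ) (hχs : ∀ t, t ∉ Icc (a + δ) (b - δ) → χ t = 0) (hτ : 0 < τ) :
    ∃ s₀ > 0, ∀ s, s ≠ 0 → |s| < s₀ → (∫ t, |bump χ w s t|) ≤ τ ∧
      ∃ r : ℝ → ℝ, Continuous r ∧ (∀ x ∈ Icc a b, |r x| ≤ τ) ∧
        (∀ᵐ x, x ∈ Icc a b → pot k (bump χ w s) x = r x) ∧
        ∀ x, χ x = 0 → r x = pot k (bump χ w s) x := by
  obtain ⟨C, hC0, hC⟩ := comm_bound hk hΛ hχ
  have hη : 0 < τ / (2 * (C + 1)) := by positivity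
  obtain ⟨s₁, hs₁, h1⟩ := stek_sub_le hw.int (lt_min hτ hη)
  have huc := (isCompact_Icc (a := a - 1) (b := b + 1)).uniformContinuousOn_of_continuous
    hF.continuousOn
  obtain ⟨s₂, hs₂, h2⟩ := Metric.uniformContinuousOn_iff.1 huc (τ / 2) (by positivity)
  have hcχ := continuous_of_lip hΛ hχ
  refine ⟨min s₁ (min s₂ (min δ 1)), by positivity, fun s hs hss => ?_⟩
  simp only [lt_min_iff] at hss
  obtain ⟨hs1, hs2, hs3, hs4⟩ := hss
  have hI := h1 s hs1
  have hv : Integrable fun t => stek s w t - w t := (stek_integrable hw.int s).sub hw.int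
  have hsu : ∀ u ∈ Ioc (0 : ℝ) 1, |s * u| ≤ |s| := fun u hu => by
    rw [abs_mul, abs_of_pos hu.1]; nlinarith [abs_nonneg s, hu.2]
  have hpar : Continuous fun x => ∫ u in Ioc (0 : ℝ) 1, F (x + s * u) := by
    simp only [← intervalIntegral.integral_of_le (zero_le_one' ℝ)]
    exact intervalIntegral.continuous_parametric_intervalIntegral_of_continuous'
      (f := fun x u => F (x + s * u)) (by fun_prop) 0 1
  refine ⟨?_, fun x => χ x * ((∫ u in Ioc (0 : ℝ) 1, F (x + s * u)) - F x)
      + cutComm k χ (fun t => stek s w t - w t) x, ?_, ?_, ?_, ?_⟩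
  · refine le_trans (integral_mono_of_nonneg (.of_forall fun t => abs_nonneg _) hv.norm
      (.of_forall fun t => ?_)) (hI.trans (min_le_left _ _))
    simp only [bump, abs_mul]
    exact mul_le_of_le_one_left (abs_nonneg _) (hχ1 t)
  · exact (hcχ.mul (hpar.sub hF)).add (comm_continuous hk hΛ hχ hv)
  · intro x hx
    have hFi : IntegrableOn (fun u => F (x + s * u)) (Ioc (0 : ℝ) 1) :=
      (Continuous.integrableOn_Icc (by fun_prop)).mono_set Ioc_subset_Icc_self
    have e1 : |(∫ u in Ioc (0 : ℝ) 1, F (x + s * u)) - F x| ≤ τ / 2 := by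
      have : (∫ u in Ioc (0 : ℝ) 1, F (x + s * u)) - F x
          = ∫ u in Ioc (0 : ℝ) 1, (F (x + s * u) - F x) := by
        rw [integral_sub hFi (integrable_const _)]; simp
      rw [this]
      have := norm_setIntegral_le_of_norm_le_const (μ := volume) (s := Ioc (0 : ℝ) 1)
        (f := fun u => F (x + s * u) - F x) (C := τ / 2) (by simp) (fun u hu => by
          have h3 := hsu u hu
          have h4 := abs_le.1 (h3.trans hs4.le)
          have := h2 (x + s * u) ⟨by linarith [hx.1, h4.1], by linarith [hx.2, h4.2]⟩ x
            ⟨by linarith [hx.1], by linarith [hx.2]⟩ (by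
              rw [Real.dist_eq]; simpa using lt_of_le_of_lt h3 hs2)
          rw [Real.dist_eq] at this
          exact this.le)
      simpa using this
    have e2 : |cutComm k χ (fun t => stek s w t - w t) x| ≤ τ / 2 := by
      have e3 : |cutComm k χ (fun t => stek s w t - w t) x| ≤ ∫ t, C * |stek s w t - w t| :=
        norm_integral_le_of_norm_le (hv.norm.const_mul C) (.of_forall fun t => hC x t _)
      rw [integral_const_mul] at e3
      refine e3.trans ((mul_le_mul_of_nonneg_left (hI.trans (min_le_right _ _)) hC0).trans ?_)
      rw [mul_div_assoc', div_le_div_iff₀ (by positivity) (by positivity)]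
      nlinarith
    refine (abs_add_le _ _).trans ?_
    rw [abs_mul]
    have := mul_le_mul (hχ1 x) e1 (abs_nonneg _) zero_le_one
    linarith
  · filter_upwards [hwF, PotConv.ae hk.int hw.int] with x hx hx' hxab
    have hst := PotConv.of_bdd hk.meas hk.int (stek_integrable hw.int s).aestronglyMeasurable
      (abs_stek_le hw.int hs) x
    have : pot k (bump χ w s) x = _ := pot_mul_cutoff hk hΛ hχ hv (hst.sub hx')
    rw [this, pot_sub hst hx', hx hxab, pot_stek hk.meas hk.int hw.int hs]
    by_cases hχx : χ x = 0
    · simp [hχx]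
    · congr 3
      have hxδ : x ∈ Icc (a + δ) (b - δ) := by by_contra h; exact hχx (hχs x h)
      refine setIntegral_congr_ae measurableSet_Ioc ?_
      filter_upwards [ae_affine hwF hs x] with u hu hu'
      refine hu ?_
      have h4 := abs_le.1 ((hsu u hu').trans hs3.le)
      exact ⟨by linarith [hxδ.1, h4.1], by linarith [hxδ.2, h4.2]⟩
  · intro x hx
    simp only [hx, zero_mul, zero_add, cutComm, sub_zero, pot, bump]

lemma isDens_bump {w χ : ℝ → ℝ} {a b δ : ℝ} (hw : IsDens a b w) (hc : Continuous χ)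
    (hχ1 : ∀ t, |χ t| ≤ 1) (hδ : 0 < δ) (hχs : ∀ t, t ∉ Icc (a + δ) (b - δ) → χ t = 0) (s : ℝ) :
    IsDens a b (bump χ w s) := by
  refine ⟨((stek_integrable hw.int s).sub hw.int).bdd_mul hc.aestronglyMeasurable
    (.of_forall hχ1), fun t ht => ?_⟩
  have : χ t = 0 := hχs t fun h => ht ⟨by linarith [h.1], by linarith [h.2]⟩
  simp [bump, this]

lemma ae_summable_of_summable_integral {f : ℕ → ℝ → ℝ} (hf : ∀ i, Integrable (f i))
    (hs : Summable fun i => ∫ t, |f i t|) : ∀ᵐ t, Summable fun i => |f i t| := by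
  have hfin : ∑' i, ∫⁻ t, ‖f i t‖ₑ ≠ ⊤ := by
    have h1 : ∀ i, ∫⁻ t, ‖f i t‖ₑ = ENNReal.ofReal (∫ t, |f i t|) := fun i => by
      rw [← ofReal_integral_norm_eq_lintegral_enorm (hf i)]; rfl
    simp only [h1]
    exact hs.tsum_ofReal_ne_top
  rw [← lintegral_tsum fun i => (hf i).1.enorm] at hfin
  filter_upwards [ae_lt_top' (AEMeasurable.tsum fun i => (hf i).1.enorm) hfin] with t ht
  have h2 := ENNReal.summable_toReal ht.ne
  simpa using h2

lemma integrable_tsum_of_summable_integral {f : ℕ → ℝ → ℝ} (hf : ∀ i, Integrable (f i))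
    (hs : Summable fun i => ∫ t, |f i t|) :
    Integrable (fun t => ∑' i, f i t) ∧ ∫ t, |∑' i, f i t| ≤ ∑' i, ∫ t, |f i t| := by
  have hae := ae_summable_of_summable_integral hf hs
  have hm : AEStronglyMeasurable (fun t => ∑' i, f i t) volume := by
    refine aestronglyMeasurable_of_tendsto_ae atTop
      (f := fun (n : ℕ) t => ∑ i ∈ Finset.range n, f i t)
      (fun n => Finset.aestronglyMeasurable_fun_sum _ fun i _ => (hf i).1) ?_
    filter_upwards [hae] with t ht
    exact (Summable.of_abs ht).hasSum.tendsto_sum_nat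
  have hma : AEStronglyMeasurable (fun t => ∑' i, |f i t|) volume := by
    refine aestronglyMeasurable_of_tendsto_ae atTop
      (f := fun (n : ℕ) t => ∑ i ∈ Finset.range n, |f i t|)
      (fun n => Finset.aestronglyMeasurable_fun_sum _ fun i _ => (hf i).1.norm) ?_
    filter_upwards [hae] with t ht
    exact ht.hasSum.tendsto_sum_nat
  have hintg : Integrable (fun t => ∑' i, |f i t|) := by
    refine ⟨hma, ?_⟩
    have hfin : ∑' i, ∫⁻ t, ‖f i t‖ₑ ≠ ⊤ := by
      have h1 : ∀ i, ∫⁻ t, ‖f i t‖ₑ = ENNReal.ofReal (∫ t, |f i t|) := fun i => by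
        rw [← ofReal_integral_norm_eq_lintegral_enorm (hf i)]; rfl
      simp only [h1]
      exact hs.tsum_ofReal_ne_top
    rw [← lintegral_tsum fun i => (hf i).1.enorm] at hfin
    refine lt_of_le_of_lt (lintegral_mono_ae ?_) hfin.lt_top
    filter_upwards [hae] with t ht
    rw [Real.enorm_of_nonneg (tsum_nonneg fun i => abs_nonneg _),
      ENNReal.ofReal_tsum_of_nonneg (fun i => abs_nonneg _) ht]
    refine le_of_eq (tsum_congr fun i => ?_)
    rw [← Real.enorm_of_nonneg (abs_nonneg _), Real.enorm_abs]
  have hle : ∀ᵐ t, |∑' i, f i t| ≤ ∑' i, |f i t| := by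
    filter_upwards [hae] with t ht
    exact norm_tsum_le_tsum_norm (f := fun i => f i t) ht
  refine ⟨hintg.mono' hm hle, ?_⟩
  rw [integral_tsum_of_summable_integral_norm (F := fun i t => |f i t|) (fun i => (hf i).norm)
    (by simpa using hs)]
  exact integral_mono_ae (hintg.mono' hm hle).norm hintg hle

lemma pot_tsum {k : ℝ → ℝ} {G : ℕ → ℝ → ℝ} {x : ℝ} (hG : ∀ i, PotConv k (G i) x)
    (hs : Summable fun i => ∫ t, |k (x - t) * G i t|) :
    PotConv k (fun t => ∑' i, G i t) x ∧
      HasSum (fun i => pot k (G i) x) (pot k (fun t => ∑' i, G i t) x) := by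
  have h1 := (integrable_tsum_of_summable_integral hG hs).1
  have h2 := hasSum_integral_of_summable_integral_norm hG hs
  simp only [tsum_mul_left] at h1 h2
  exact ⟨h1, h2⟩

lemma pot_tsum_ae {k : ℝ → ℝ} {G : ℕ → ℝ → ℝ} (hki : Integrable k)
    (hG : ∀ i, Integrable (G i)) (hs : Summable fun i => ∫ t, |G i t|) :
    ∀ᵐ x, HasSum (fun i => pot k (G i) x) (pot k (fun t => ∑' i, G i t) x) := by
  have h1 : ∀ i, Integrable (fun p : ℝ × ℝ => |k (p.1 - p.2) * G i p.2|)
      (volume.prod volume) := fun i => by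
    have := (hG i).convolution_integrand (L := ContinuousLinearMap.mul ℝ ℝ) (ν := volume)
      (μ := volume) hki
    refine this.norm.congr (.of_forall fun p => ?_)
    simp [mul_comm]
  have h2 : ∀ i, ∫ x, |(∫ t, |k (x - t) * G i t|)| = (∫ s, |k s|) * ∫ t, |G i t| := fun i => by
    calc ∫ x, |(∫ t, |k (x - t) * G i t|)| = ∫ x, ∫ t, |k (x - t) * G i t| := by
          congr 1; ext x; exact abs_of_nonneg (integral_nonneg fun t => abs_nonneg _)
      _ = ∫ t, ∫ x, |k (x - t) * G i t| :=
          integral_integral_swap (f := fun x t => |k (x - t) * G i t|) (h1 i)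
      _ = ∫ t, (∫ s, |k s|) * |G i t| := by
          congr 1; ext t
          simp only [abs_mul, integral_mul_const]
          rw [integral_sub_right_eq_self (fun s => |k s|) t]
      _ = _ := integral_const_mul _ _
  have h3 := ae_summable_of_summable_integral (f := fun i x => ∫ t, |k (x - t) * G i t|)
    (fun i => (h1 i).integral_prod_left) (by simpa only [h2] using hs.mul_left _)
  have h4 : ∀ᵐ x, ∀ i, PotConv k (G i) x := ae_all_iff.2 fun i => PotConv.ae hki (hG i)
  filter_upwards [h3, h4] with x hx hx'
  refine (pot_tsum hx' (hx.congr fun i => ?_)).2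
  exact abs_of_nonneg (integral_nonneg fun t => abs_nonneg _)

/-- The truncated power kernel `s ^ (-α)` on `(0, R)`. -/
def powKer (α R s : ℝ) : ℝ := (Ioo 0 R).indicator (fun s => s ^ (-α)) s

lemma isKer_powKer {α R : ℝ} (hα : α < 1) (hR : 0 < R) : IsKer (powKer α R) R := by
  have hm : Measurable fun s : ℝ => s ^ (-α) := by fun_prop
  refine ⟨hm.indicator measurableSet_Ioo, ?_, ⟨R ^ (1 - α), by positivity, ?_⟩, ?_⟩
  · have := intervalIntegral.intervalIntegrable_rpow' (a := 0) (b := R) (r := -α) (by linarith)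
    rw [intervalIntegrable_iff_integrableOn_Ioo_of_le hR.le] at this
    exact this.integrable_indicator measurableSet_Ioo
  · intro s
    by_cases hs : s ∈ Ioo 0 R
    · rw [powKer, indicator_of_mem hs, abs_of_pos (rpow_pos_of_pos hs.1 _), abs_of_pos hs.1]
      nth_rewrite 2 [← rpow_one s]
      rw [← rpow_add hs.1]
      exact (rpow_le_rpow hs.1.le hs.2.le (by linarith)).trans_eq' (by ring_nf)
    · rw [powKer, indicator_of_notMem hs]; simp; positivity
  · intro s hs hsR
    by_cases h1 : s ∈ Ioo 0 R
    · have : powKer α R =ᶠ[𝓝 s] fun s => s ^ (-α) := by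
        filter_upwards [isOpen_Ioo.mem_nhds h1] with t ht
        rw [powKer, indicator_of_mem ht]
      rw [continuousAt_congr this]
      exact continuousAt_rpow_const _ _ (Or.inl hs)
    · have hs' : s ∈ (Icc 0 R)ᶜ := by
        intro h2
        refine h1 ⟨lt_of_le_of_ne h2.1 (Ne.symm hs), lt_of_le_of_ne h2.2 fun h => hsR ?_⟩
        rw [h, abs_of_pos hR]
      have : powKer α R =ᶠ[𝓝 s] fun _ => 0 := by
        filter_upwards [isClosed_Icc.isOpen_compl.mem_nhds hs'] with t ht
        rw [powKer, indicator_of_notMem fun h => ht (Ioo_subset_Icc_self h)]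
      rw [continuousAt_congr this]
      exact continuousAt_const

lemma IsKer.reflect {k : ℝ → ℝ} {R : ℝ} (hk : IsKer k R) : IsKer (fun s => k (-s)) R := by
  obtain ⟨C, hC0, hC⟩ := hk.bound
  refine ⟨hk.meas.comp measurable_neg, hk.int.comp_neg, ⟨C, hC0, fun s => ?_⟩, fun s hs hsR => ?_⟩
  · simpa using hC (-s)
  · exact ContinuousAt.comp (f := fun s => -s) (hk.cont (-s) (by simpa) (by simpa)) (by fun_prop)

/-- Distance from `x` to the endpoints of `[a, b]`. -/
def edge (a b x : ℝ) : ℝ := min (x - a) (b - x)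

lemma edge_lip (a b s t : ℝ) : |edge a b s - edge a b t| ≤ |s - t| := by
  have := abs_min_sub_min_le_max (s - a) (b - s) (t - a) (b - t)
  refine this.trans (max_le (by simp) ?_)
  rw [abs_sub_comm s t]; simp

/-- Cutoff vanishing near the endpoints of `[a, b]` and tending to one inside. -/
def cut (a b : ℝ) (n : ℕ) (x : ℝ) : ℝ := max 0 (min 1 (n * edge a b x - 1))

/-- Partition of unity on `(a, b)`. -/
def pou (a b : ℝ) (n : ℕ) (x : ℝ) : ℝ := cut a b (n + 1) x - cut a b n x

lemma cut_nonneg (a b : ℝ) (n : ℕ) (x : ℝ) : 0 ≤ cut a b n x := le_max_left _ _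

lemma cut_le_one (a b : ℝ) (n : ℕ) (x : ℝ) : cut a b n x ≤ 1 :=
  max_le zero_le_one (min_le_left _ _)

lemma cut_zero (a b x : ℝ) : cut a b 0 x = 0 := by simp [cut]

lemma sum_pou (a b : ℝ) (n : ℕ) (x : ℝ) : ∑ k ∈ Finset.range n, pou a b k x = cut a b n x := by
  simp only [pou]
  rw [Finset.sum_range_sub (fun k => cut a b k x), cut_zero, sub_zero]

lemma abs_pou_le (a b : ℝ) (n : ℕ) (x : ℝ) : |pou a b n x| ≤ 1 := by
  rw [pou, abs_le]
  constructor <;> linarith [cut_nonneg a b n x, cut_nonneg a b (n + 1) x, cut_le_one a b n x,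
    cut_le_one a b (n + 1) x]

lemma cut_lip (a b : ℝ) (n : ℕ) (s t : ℝ) : |cut a b n s - cut a b n t| ≤ n * |s - t| := by
  have h1 := abs_max_sub_max_le_max 0 (min 1 (n * edge a b s - 1)) 0 (min 1 (n * edge a b t - 1))
  have h2 := abs_min_sub_min_le_max 1 (n * edge a b s - 1) 1 (n * edge a b t - 1)
  have h3 : |(n * edge a b s - 1) - (n * edge a b t - 1)| ≤ n * |s - t| := by
    have : (n * edge a b s - 1) - (n * edge a b t - 1) = n * (edge a b s - edge a b t) := by ring
    rw [this, abs_mul, Nat.abs_cast]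
    exact mul_le_mul_of_nonneg_left (edge_lip a b s t) (Nat.cast_nonneg n)
  have h4 : 0 ≤ (n : ℝ) * |s - t| := by positivity
  have h5 : |min 1 (n * edge a b s - 1) - min 1 (n * edge a b t - 1)| ≤ n * |s - t| :=
    h2.trans (max_le (by simpa using h4) h3)
  exact h1.trans (max_le (by simpa using h4) h5)

lemma pou_lip (a b : ℝ) (n : ℕ) (s t : ℝ) :
    |pou a b n s - pou a b n t| ≤ (2 * n + 1 : ℝ) * |s - t| := by
  have h1 := cut_lip a b n s t
  have h2 := cut_lip a b (n + 1) s t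
  push_cast at h2
  have : pou a b n s - pou a b n t
      = (cut a b (n + 1) s - cut a b (n + 1) t) - (cut a b n s - cut a b n t) := by
    simp only [pou]; ring
  rw [this]
  exact (abs_sub _ _).trans (by nlinarith)

lemma cut_eq_zero {a b : ℝ} {n : ℕ} {x : ℝ} (h : n * edge a b x ≤ 1) : cut a b n x = 0 :=
  max_eq_left ((min_le_right _ _).trans (by linarith))

lemma cut_eq_one {a b : ℝ} {n : ℕ} {x : ℝ} (h : 2 ≤ n * edge a b x) : cut a b n x = 1 := by
  rw [cut, min_eq_left (by linarith), max_eq_right zero_le_one]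

lemma edge_le_of_pou_ne {a b : ℝ} {n : ℕ} {x : ℝ} (h : pou a b n x ≠ 0) :
    1 / (n + 1 : ℝ) ≤ edge a b x := by
  by_contra hc
  push Not at hc
  rw [lt_div_iff₀ (by positivity)] at hc
  apply h
  have h1 : cut a b (n + 1) x = 0 := cut_eq_zero (by push_cast; linarith)
  have h2 : cut a b n x = 0 := by
    rcases le_or_gt (edge a b x) 0 with h' | h'
    · exact cut_eq_zero (by nlinarith [(Nat.cast_nonneg n : (0 : ℝ) ≤ n)])
    · exact cut_eq_zero (by nlinarith)
  rw [pou, h1, h2, sub_zero]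

lemma pou_eq_zero {a b : ℝ} {n : ℕ} {x : ℝ} (hx : x ∉ Icc (a + 1 / (n + 1 : ℝ)) (b - 1 / (n + 1 : ℝ))) :
    pou a b n x = 0 := by
  by_contra h
  have := edge_le_of_pou_ne h
  rw [edge, le_min_iff] at this
  exact hx ⟨by linarith [this.1], by linarith [this.2]⟩

lemma pou_eq_zero_of_le {a b : ℝ} {n : ℕ} {x : ℝ} (hx : 2 ≤ n * edge a b x) (h0 : 0 ≤ edge a b x) :
    pou a b n x = 0 := by
  rw [pou, cut_eq_one hx, cut_eq_one (by push_cast; linarith), sub_self]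

/-- Two kernels on an interval, with the weights of a two-sided potential operator. -/
structure PotSys where
  (a b R κ₁ κ₂ : ℝ)
  (k₁ k₂ : ℝ → ℝ)
  hab : a < b
  hR : b - a < R
  ker₁ : IsKer k₁ R
  ker₂ : IsKer k₂ R

namespace PotSys

/-- The two-sided potential operator. -/
def K (S : PotSys) (w : ℝ → ℝ) (x : ℝ) : ℝ := S.κ₁ * pot S.k₁ w x - S.κ₂ * pot S.k₂ w x

/-- The combined kernel. -/
def kk (S : PotSys) (s : ℝ) : ℝ := S.κ₁ * S.k₁ s + -S.κ₂ * S.k₂ s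

lemma isKer_kk (S : PotSys) : IsKer S.kk S.R := S.ker₁.linComb S.ker₂ _ _

variable {S : PotSys}

lemma K_eq_pot {w : ℝ → ℝ} {x : ℝ} (h1 : PotConv S.k₁ w x) (h2 : PotConv S.k₂ w x) :
    S.K w x = pot S.kk w x := by
  rw [K, pot, pot, ← integral_const_mul, ← integral_const_mul,
    ← integral_sub (Integrable.const_mul h1 _) (Integrable.const_mul h2 _), pot]
  congr 1; ext t; simp only [kk]; ring

lemma K_add {u v : ℝ → ℝ} {x : ℝ} (h1 : PotConv S.k₁ u x) (h2 : PotConv S.k₂ u x)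
    (h3 : PotConv S.k₁ v x) (h4 : PotConv S.k₂ v x) :
    S.K (fun t => u t + v t) x = S.K u x + S.K v x := by
  rw [K, pot_add h1 h3, pot_add h2 h4, K, K]; ring

lemma K_sub {u v : ℝ → ℝ} {x : ℝ} (h1 : PotConv S.k₁ u x) (h2 : PotConv S.k₂ u x)
    (h3 : PotConv S.k₁ v x) (h4 : PotConv S.k₂ v x) :
    S.K (fun t => u t - v t) x = S.K u x - S.K v x := by
  rw [K, pot_sub h1 h3, pot_sub h2 h4, K, K]; ring

lemma K_const_mul (S : PotSys) (u : ℝ → ℝ) (c x : ℝ) :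
    S.K (fun t => c * u t) x = c * S.K u x := by
  rw [K, pot_const_mul, pot_const_mul, K]; ring

/-- The smoothing correction attached to a sequence of step sizes. -/
def corr (S : PotSys) (w : ℝ → ℝ) (σ : ℕ → ℝ) (t : ℝ) : ℝ :=
  ∑' k, bump (pou S.a S.b k) w (σ k) t

/-- `w + corr S w σ` is a good approximation of `w`, up to `τ`. -/
structure Smoothing (S : PotSys) (w F : ℝ → ℝ) (τ : ℝ) (σ : ℕ → ℝ) : Prop where
  piece : ∀ k, ∫ t, |bump (pou S.a S.b k) w (σ k) t| ≤ τ / 2 / 2 ^ k / (k + 1)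
  dens : IsDens S.a S.b (S.corr w σ)
  small : ∫ t, |S.corr w σ t| ≤ τ
  locBdd : ∀ x ∈ Ioo S.a S.b, ∃ r > 0, ∃ M, ∀ t, |t - x| < r → |w t + S.corr w σ t| ≤ M
  rem : ∃ r : ℝ → ℝ, ContinuousOn r (Icc S.a S.b) ∧ (∀ x ∈ Icc S.a S.b, |r x| ≤ τ) ∧
    (∀ x ∈ Ioo S.a S.b, S.K (fun t => w t + S.corr w σ t) x = F x + r x) ∧
    r S.a = S.K (S.corr w σ) S.a ∧ r S.b = S.K (S.corr w σ) S.b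
  conv₁ : ∀ x, x = S.a ∨ x = S.b → PotConv S.k₁ (S.corr w σ) x ∧ |pot S.k₁ (S.corr w σ) x| ≤ τ
  conv₂ : ∀ x, x = S.a ∨ x = S.b → PotConv S.k₂ (S.corr w σ) x ∧ |pot S.k₂ (S.corr w σ) x| ≤ τ

lemma edge_eq_zero (S : PotSys) {x : ℝ} (hx : x = S.a ∨ x = S.b) : edge S.a S.b x = 0 := by
  have := S.hab
  rcases hx with rfl | rfl <;> simp [edge] <;> linarith

lemma isDens_pouBump {w : ℝ → ℝ} (hw : IsDens S.a S.b w) (k : ℕ) (s : ℝ) :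
    IsDens S.a S.b (bump (pou S.a S.b k) w s) :=
  isDens_bump hw (continuous_of_lip (by positivity) (pou_lip _ _ k)) (abs_pou_le _ _ k)
    (δ := 1 / (k + 1 : ℝ)) (by positivity) (fun _ => pou_eq_zero) s

lemma K_of_locBdd {v : ℝ → ℝ} (hv : IsDens S.a S.b v) {x : ℝ} (hx : x ∈ Icc S.a S.b)
    (h : ∃ r > 0, ∃ M, ∀ t, |t - x| < r → |v t| ≤ M) :
    PotConv S.k₁ v x ∧ PotConv S.k₂ v x ∧ ContinuousWithinAt (S.K v) (Icc S.a S.b) x := by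
  obtain ⟨r, hr, M, hM⟩ := h
  obtain ⟨h1, h2⟩ := pot_locally_bdd S.ker₁ S.hR hv hx hr hM
  obtain ⟨h3, h4⟩ := pot_locally_bdd S.ker₂ S.hR hv hx hr hM
  exact ⟨h1, h3, (h2.const_mul S.κ₁).sub (h4.const_mul S.κ₂)⟩

lemma corr_locBdd {w : ℝ → ℝ} (hw : IsDens S.a S.b w) {σ : ℕ → ℝ} (hσ : ∀ k, σ k ≠ 0) {x : ℝ}
    (hx : x ∈ Ioo S.a S.b) :
    ∃ r > 0, ∃ M, ∀ t, |t - x| < r → |w t + S.corr w σ t| ≤ M := by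
  have hd : 0 < edge S.a S.b x := lt_min (by linarith [hx.1]) (by linarith [hx.2])
  obtain ⟨n, hn⟩ := exists_nat_gt (4 / edge S.a S.b x)
  rw [div_lt_iff₀ hd] at hn
  refine ⟨edge S.a S.b x / 2, by positivity,
    ∑ k ∈ Finset.range n, |σ k|⁻¹ * ∫ t, |w t|, fun t ht => ?_⟩
  have h1 := abs_le.1 ((edge_lip S.a S.b t x).trans ht.le)
  have hdt : edge S.a S.b x / 2 ≤ edge S.a S.b t := by linarith [h1.1]
  have hz : ∀ k, k ∉ Finset.range n → pou S.a S.b k t = 0 := fun k hk => by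
    have hk' : (n : ℝ) ≤ k := by exact_mod_cast not_lt.1 fun h => hk (Finset.mem_range.2 h)
    refine pou_eq_zero_of_le ?_ (by linarith)
    nlinarith
  have h2 : S.corr w σ t = ∑ k ∈ Finset.range n, bump (pou S.a S.b k) w (σ k) t :=
    tsum_eq_sum fun k hk => by rw [bump, hz k hk, zero_mul]
  have h3 : w t + S.corr w σ t = ∑ k ∈ Finset.range n, pou S.a S.b k t * stek (σ k) w t := by
    have h4 : w t = ∑ k ∈ Finset.range n, pou S.a S.b k t * w t := by
      rw [← Finset.sum_mul, sum_pou, cut_eq_one (by nlinarith), one_mul]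
    rw [h2]
    nth_rewrite 1 [h4]
    rw [← Finset.sum_add_distrib]
    refine Finset.sum_congr rfl fun k _ => ?_
    rw [bump]; ring
  rw [h3]
  refine (Finset.abs_sum_le_sum_abs _ _).trans (Finset.sum_le_sum fun k _ => ?_)
  rw [abs_mul]
  exact (mul_le_of_le_one_left (abs_nonneg _) (abs_pou_le _ _ k t)).trans
    (abs_stek_le hw.int (hσ k) t)

lemma end_pieces {k : ℝ → ℝ} {R C : ℝ} {χ : ℕ → ℝ → ℝ} (hk : IsKer k R)
    (hC : ∀ s, |k s| * |s| ≤ C) (hC0 : 0 ≤ C) {G : ℕ → ℝ → ℝ} {x τ : ℝ}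
    (hG : ∀ n, Integrable (G n)) (hGχ : ∀ n t, χ n t = 0 → G n t = 0)
    (hχ : ∀ n t, χ n t ≠ 0 → 1 / (n + 1 : ℝ) ≤ |x - t|)
    (hsmall : ∀ n, ∫ t, |G n t| ≤ τ / 2 / 2 ^ n / ((n + 1) * (C + 1))) (hτ : 0 ≤ τ) :
    (∀ n, PotConv k (G n) x) ∧ (Summable fun n => ∫ t, |k (x - t) * G n t|) ∧
      (∑' n, ∫ t, |k (x - t) * G n t|) ≤ τ := by
  have hb : ∀ n t, |k (x - t) * G n t| ≤ C * (n + 1) * |G n t| := by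
    intro n t
    by_cases h : χ n t = 0
    · simp [hGχ n t h]
    · rw [abs_mul]
      refine mul_le_mul_of_nonneg_right ?_ (abs_nonneg _)
      have h1 := hχ n t h
      have h2 := hC (x - t)
      have h3 : |k (x - t)| * (1 / (n + 1 : ℝ)) ≤ C :=
        (mul_le_mul_of_nonneg_left h1 (abs_nonneg _)).trans h2
      rw [mul_one_div, div_le_iff₀ (by positivity)] at h3
      exact h3
  have hconv : ∀ n, PotConv k (G n) x := fun n =>
    Integrable.mono' ((hG n).norm.const_mul (C * (n + 1)))
      (aestronglyMeasurable_pot_integrand hk.meas (hG n).1 x) (.of_forall fun t => hb n t)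
  have hle : ∀ n, ∫ t, |k (x - t) * G n t| ≤ τ / 2 / 2 ^ n := fun n => by
    calc ∫ t, |k (x - t) * G n t| ≤ ∫ t, C * (n + 1) * |G n t| :=
          integral_mono (hconv n).norm ((hG n).norm.const_mul _) (hb n)
      _ = C * (n + 1) * ∫ t, |G n t| := integral_const_mul _ _
      _ ≤ C * (n + 1) * (τ / 2 / 2 ^ n / ((n + 1) * (C + 1))) := by
          gcongr; exact hsmall n
      _ = τ / 2 / 2 ^ n * (C / (C + 1)) := by field_simp
      _ ≤ τ / 2 / 2 ^ n * 1 := by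
          gcongr; rw [div_le_one (by positivity)]; linarith
      _ = _ := mul_one _
  have hsum : Summable fun n => ∫ t, |k (x - t) * G n t| :=
    Summable.of_nonneg_of_le (fun n => integral_nonneg fun t => abs_nonneg _) hle
      (summable_geometric_two' τ)
  exact ⟨hconv, hsum, (hsum.tsum_le_tsum hle (summable_geometric_two' τ)).trans_eq
    (tsum_geometric_two' τ)⟩

lemma exists_smoothing {w F : ℝ → ℝ} (hw : IsDens S.a S.b w) (hF : Continuous F)
    (hwF : ∀ x ∈ Icc S.a S.b, S.K w x = F x) {τ : ℝ} (hτ : 0 < τ) :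
    ∃ s₀ : ℕ → ℝ, (∀ k, 0 < s₀ k) ∧
      ∀ σ : ℕ → ℝ, (∀ k, σ k ≠ 0 ∧ |σ k| < s₀ k) → S.Smoothing w F τ σ := by
  obtain ⟨C₁, hC₁0, hC₁⟩ := S.ker₁.bound
  obtain ⟨C₂, hC₂0, hC₂⟩ := S.ker₂.bound
  set C := max C₁ C₂
  have hC0 : 0 ≤ C := hC₁0.trans (le_max_left _ _)
  have hwF' : ∀ᵐ x, x ∈ Icc S.a S.b → pot S.kk w x = F x := by
    filter_upwards [PotConv.ae S.ker₁.int hw.int, PotConv.ae S.ker₂.int hw.int] with x h1 h2 hx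
    rw [← K_eq_pot h1 h2, hwF x hx]
  set τ' : ℕ → ℝ := fun n => τ / 2 / 2 ^ n / ((n + 1) * (C + 1))
  have hτ'pos : ∀ n, 0 < τ' n := fun n => by positivity
  have hτ'le : ∀ n, τ' n ≤ τ / 2 / 2 ^ n := fun n => by
    refine div_le_self (by positivity) ?_
    have : (0 : ℝ) ≤ n := Nat.cast_nonneg n
    nlinarith
  have hex := fun n : ℕ => bump_remainder (χ := pou S.a S.b n) S.isKer_kk hw hF hwF'
    (Λ := 2 * n + 1) (by positivity) (pou_lip _ _ n) (abs_pou_le _ _ n)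
    (δ := 1 / (n + 1 : ℝ)) (by positivity) (fun _ => pou_eq_zero) (hτ'pos n)
  choose s₀ hs₀ hrem using hex
  refine ⟨s₀, hs₀, fun σ hσ => ?_⟩
  have hrem' := fun n => (hrem n (σ n) (hσ n).1 (hσ n).2).2
  have hsmall := fun n => (hrem n (σ n) (hσ n).1 (hσ n).2).1
  choose r hrc hrb hrae hrz using hrem'
  set G : ℕ → ℝ → ℝ := fun n => bump (pou S.a S.b n) w (σ n)
  have hG : ∀ n, IsDens S.a S.b (G n) := fun n => isDens_pouBump hw n _
  have hsumG : Summable fun n => ∫ t, |G n t| :=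
    Summable.of_nonneg_of_le (fun n => integral_nonneg fun t => abs_nonneg _)
      (fun n => (hsmall n).trans (hτ'le n)) (summable_geometric_two' τ)
  have hGi := integrable_tsum_of_summable_integral (fun n => (hG n).int) hsumG
  have hGχ : ∀ n t, pou S.a S.b n t = 0 → G n t = 0 := fun n t h => by simp [G, bump, h]
  have hdist : ∀ x, x = S.a ∨ x = S.b → ∀ n t, pou S.a S.b n t ≠ 0 →
      1 / (n + 1 : ℝ) ≤ |x - t| := by
    intro x hx n t h
    have h1 := edge_le_of_pou_ne h
    have h2 := (le_abs_self _).trans (edge_lip S.a S.b t x)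
    rw [S.edge_eq_zero hx, sub_zero, abs_sub_comm] at h2
    exact h1.trans h2
  have hend₁ := fun x hx => end_pieces S.ker₁ (fun s => (hC₁ s).trans (le_max_left C₁ C₂)) hC0
    (fun n => (hG n).int) hGχ (hdist x hx) hsmall hτ.le
  have hend₂ := fun x hx => end_pieces S.ker₂ (fun s => (hC₂ s).trans (le_max_right C₁ C₂)) hC0
    (fun n => (hG n).int) hGχ (hdist x hx) hsmall hτ.le
  have hD : IsDens S.a S.b (S.corr w σ) := ⟨hGi.1, fun t ht => by
    have : ∀ n, G n t = 0 := fun n => (hG n).supp t ht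
    change ∑' n, G n t = 0
    simp [this]⟩
  have hloc : ∀ x ∈ Ioo S.a S.b, ∃ r > 0, ∃ M, ∀ t, |t - x| < r → |w t + S.corr w σ t| ≤ M :=
    fun x hx => corr_locBdd hw (fun k => (hσ k).1) hx
  have hrsum : ∀ x ∈ Icc S.a S.b, Summable fun n => |r n x| := fun x hx =>
    Summable.of_nonneg_of_le (fun n => abs_nonneg _)
      (fun n => (hrb n x hx).trans (hτ'le n)) (summable_geometric_two' τ)
  have hrK : ∀ x, x = S.a ∨ x = S.b → ∑' n, r n x = S.K (S.corr w σ) x := by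
    intro x hx
    have h1 := (pot_tsum (hend₁ x hx).1 (hend₁ x hx).2.1).2
    have h2 := (pot_tsum (hend₂ x hx).1 (hend₂ x hx).2.1).2
    refine (((h1.mul_left S.κ₁).sub (h2.mul_left S.κ₂)).congr_fun ?_).tsum_eq
    intro n
    rw [hrz n x]
    · exact (K_eq_pot ((hend₁ x hx).1 n) ((hend₂ x hx).1 n)).symm
    · by_contra h
      have := edge_le_of_pou_ne h
      rw [S.edge_eq_zero hx] at this
      have h3 : 0 < 1 / (n + 1 : ℝ) := by positivity
      linarith
  have hpotle : ∀ {k : ℝ → ℝ} {x : ℝ}, (∀ n, PotConv k (G n) x) →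
      (Summable fun n => ∫ t, |k (x - t) * G n t|) →
      (∑' n, ∫ t, |k (x - t) * G n t|) ≤ τ → |pot k (S.corr w σ) x| ≤ τ := by
    intro k x h1 h2 h3
    refine le_trans ?_ h3
    have h4 := (pot_tsum h1 h2).2
    change |pot k (fun t => ∑' n, G n t) x| ≤ _
    rw [← h4.tsum_eq]
    have h5 : ∀ n, ‖pot k (G n) x‖ ≤ ∫ t, |k (x - t) * G n t| := fun n =>
      norm_integral_le_integral_norm _
    exact tsum_of_norm_bounded h2.hasSum h5
  have hpiece : ∀ n, τ' n ≤ τ / 2 / 2 ^ n / (n + 1) := fun n => by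
    have : (0 : ℝ) ≤ n := Nat.cast_nonneg n
    refine div_le_div_of_nonneg_left (by positivity) (by positivity) ?_
    nlinarith
  refine ⟨fun n => (hsmall n).trans (hpiece n), hD, ?_, hloc, ?_, ?_, ?_⟩
  · refine hGi.2.trans ((hsumG.tsum_le_tsum (fun n => (hsmall n).trans (hτ'le n))
      (summable_geometric_two' τ)).trans_eq (tsum_geometric_two' τ))
  · have hcont : ContinuousOn (fun x => ∑' n, r n x) (Icc S.a S.b) :=
      continuousOn_tsum (fun n => (hrc n).continuousOn) (summable_geometric_two' τ)
        fun n x hx => (hrb n x hx).trans (hτ'le n)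
    refine ⟨fun x => ∑' n, r n x, hcont, fun x hx => ?_, ?_, hrK _ (Or.inl rfl), hrK _ (Or.inr rfl)⟩
    · exact (tsum_of_norm_bounded (f := fun n => r n x) (summable_geometric_two' τ).hasSum
        (fun n => (hrb n x hx).trans (hτ'le n))).trans_eq (tsum_geometric_two' τ)
    · have hIoo := Ioo_subset_Icc_self (a := S.a) (b := S.b)
      have hc1 : ContinuousOn (S.K fun t => w t + S.corr w σ t) (Ioo S.a S.b) := fun x hx =>
        ((K_of_locBdd (hw.add hD) (hIoo hx) (hloc x hx)).2.2).mono hIoo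
      refine Measure.eqOn_open_of_ae_eq (μ := volume) ?_ isOpen_Ioo hc1
        (hF.continuousOn.add (hcont.mono hIoo))
      rw [EventuallyEq, ae_restrict_iff' measurableSet_Ioo]
      filter_upwards [PotConv.ae S.ker₁.int hw.int, PotConv.ae S.ker₂.int hw.int,
        PotConv.ae S.ker₁.int hD.int, PotConv.ae S.ker₂.int hD.int, ae_all_iff.2 hrae,
        pot_tsum_ae S.isKer_kk.int (fun n => (hG n).int) hsumG] with x h1 h2 h3 h4 h5 h6 hx
      rw [K_add h1 h2 h3 h4, hwF x (hIoo hx), K_eq_pot h3 h4]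
      change _ + pot S.kk (fun t => ∑' n, G n t) x = _
      rw [← h6.tsum_eq]
      congr 1
      exact tsum_congr fun n => h5 n (hIoo hx)
  · intro x hx
    exact ⟨(pot_tsum (hend₁ x hx).1 (hend₁ x hx).2.1).1,
      hpotle (hend₁ x hx).1 (hend₁ x hx).2.1 (hend₁ x hx).2.2⟩
  · intro x hx
    exact ⟨(pot_tsum (hend₂ x hx).1 (hend₂ x hx).2.1).1,
      hpotle (hend₂ x hx).1 (hend₂ x hx).2.1 (hend₂ x hx).2.2⟩

end PotSys

lemma powKer_of_mem {p R s : ℝ} (hs : s ∈ Ioo 0 R) : powKer p R s = s ^ (-p) :=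
  indicator_of_mem hs _

lemma powKer_of_notMem {p R s : ℝ} (hs : s ∉ Ioo 0 R) : powKer p R s = 0 :=
  indicator_of_notMem hs _

lemma powKer_nonpos {p R s : ℝ} (hs : s ≤ 0) : powKer p R s = 0 :=
  powKer_of_notMem fun h => absurd h.1 (not_lt.2 hs)

lemma powKer_nonneg (p R s : ℝ) : 0 ≤ powKer p R s :=
  indicator_nonneg (fun _ hs => rpow_nonneg hs.1.le _) s

lemma pot_pot {j k D : ℝ → ℝ} (hjm : Measurable j) (hj : Integrable j) (hkm : Measurable k)
    (hk : Integrable k) (hD : Integrable D) {M : ℝ} (hM : ∀ t, |D t| ≤ M) (y : ℝ) :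
    pot j (pot k D) y = pot (pot j k) D y := by
  have hm : AEStronglyMeasurable (fun z : ℝ × ℝ => j (y - z.1) * (k (z.1 - z.2) * D z.2))
      (volume.prod volume) := by
    refine AEStronglyMeasurable.mul ?_ (AEStronglyMeasurable.mul ?_ ?_)
    · exact (hjm.comp (measurable_const.sub measurable_fst)).aestronglyMeasurable
    · exact (hkm.comp (measurable_fst.sub measurable_snd)).aestronglyMeasurable
    · exact hD.aestronglyMeasurable.comp_snd
  have hintg : Integrable (fun z : ℝ × ℝ => j (y - z.1) * (k (z.1 - z.2) * D z.2))
      (volume.prod volume) := by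
    rw [integrable_prod_iff hm]
    refine ⟨.of_forall fun s => Integrable.const_mul (PotConv.of_bdd hkm hk hD.1 hM s) (j (y - s)), ?_⟩
    refine Integrable.mono' ((hj.comp_sub_left y).norm.mul_const (M * ∫ s, |k s|))
      hm.norm.integral_prod_right' (.of_forall fun s => ?_)
    simp only [norm_mul]
    rw [integral_const_mul, norm_mul, norm_norm]
    refine mul_le_mul_of_nonneg_left ?_ (norm_nonneg _)
    have h := abs_pot_le_of_bdd (k := fun s => |k s|) (w := fun t => |D t|) hk.norm
      (M := M) (fun t => by rw [abs_abs]; exact hM t) s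
    simpa [pot] using h
  calc pot j (pot k D) y = ∫ s, ∫ t, j (y - s) * (k (s - t) * D t) := by
        simp only [pot, integral_const_mul]
    _ = ∫ t, ∫ s, j (y - s) * (k (s - t) * D t) := integral_integral_swap hintg
    _ = pot (pot j k) D y := by
        refine integral_congr_ae (.of_forall fun t => ?_)
        simp only [pot, ← mul_assoc]
        rw [integral_mul_const]
        congr 1
        rw [← integral_sub_right_eq_self (fun s => j (y - t - s) * k s) t]
        congr 1; ext s; congr 2; ring

lemma exists_pot_powKer_eq {p : ℝ} (hp0 : 0 < p) (hp1 : p < 1) (R : ℝ) :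
    ∃ B > 0, ∀ u ∈ Ioo 0 R, pot (powKer (1 - p) R) (powKer p R) u = B := by
  refine ⟨∫ v in (0:ℝ)..1, (1 - v) ^ (p - 1) * v ^ (-p), ?_, ?_⟩
  · have hi : IntervalIntegrable (fun v : ℝ => (1 - v) ^ (p - 1) * v ^ (-p)) volume 0 1 := by
      have h1 : IntervalIntegrable (fun v : ℝ => (1 - v) ^ (p - 1) * v ^ (-p)) volume 0 (1 / 2) := by
        refine (intervalIntegral.intervalIntegrable_rpow' (by linarith)).continuousOn_mul ?_
        refine ContinuousOn.rpow_const (by fun_prop) fun v hv => Or.inl ?_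
        rw [uIcc_of_le (by norm_num)] at hv
        linarith [hv.2]
      have h2 : IntervalIntegrable (fun v : ℝ => (1 - v) ^ (p - 1) * v ^ (-p)) volume (1 / 2) 1 := by
        have h3 := (intervalIntegral.intervalIntegrable_rpow' (a := 1 / 2) (b := 0) (r := p - 1)
          (by linarith)).comp_sub_left 1
        norm_num at h3
        refine h3.mul_continuousOn ?_
        refine ContinuousOn.rpow_const (by fun_prop) fun v hv => Or.inl ?_
        rw [uIcc_of_le (by norm_num)] at hv
        linarith [hv.1]
      exact h1.trans h2
    refine intervalIntegral.intervalIntegral_pos_of_pos_on hi (fun v hv => ?_) one_pos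
    exact mul_pos (rpow_pos_of_pos (by linarith [hv.2]) _) (rpow_pos_of_pos hv.1 _)
  · intro u hu
    have h1 : pot (powKer (1 - p) R) (powKer p R) u =
        ∫ v in (0:ℝ)..u, (u - v) ^ (p - 1) * v ^ (-p) := by
      rw [intervalIntegral.integral_of_le hu.1.le, integral_Ioc_eq_integral_Ioo,
        ← integral_indicator measurableSet_Ioo, pot]
      congr 1; ext v
      by_cases hv : v ∈ Ioo 0 u
      · rw [indicator_of_mem hv, powKer_of_mem ⟨hv.1, hv.2.trans hu.2⟩,
          powKer_of_mem ⟨by linarith [hv.2], by linarith [hv.1, hu.2]⟩]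
        congr 2; ring
      · rw [indicator_of_notMem hv]
        by_cases h0 : 0 < v
        · rw [powKer_nonpos (s := u - v), zero_mul]
          by_contra h; exact hv ⟨h0, by linarith⟩
        · rw [powKer_nonpos (s := v) (not_lt.1 h0), mul_zero]
    rw [h1]
    have h2 := intervalIntegral.integral_comp_mul_left (a := 0) (b := 1)
      (fun v : ℝ => (u - v) ^ (p - 1) * v ^ (-p)) hu.1.ne'
    rw [mul_zero, mul_one] at h2
    rw [eq_comm, inv_smul_eq_iff₀ hu.1.ne'] at h2
    rw [h2, ← intervalIntegral.integral_smul]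
    refine intervalIntegral.integral_congr fun v hv => ?_
    rw [uIcc_of_le zero_le_one] at hv
    simp only [smul_eq_mul]
    have : u - u * v = u * (1 - v) := by ring
    rw [this, mul_rpow hu.1.le (by linarith [hv.2]), mul_rpow hu.1.le hv.1]
    have h3 : u * (u ^ (p - 1) * u ^ (-p)) = 1 := by
      nth_rewrite 1 [← rpow_one u]
      rw [← rpow_add hu.1, ← rpow_add hu.1, show 1 + (p - 1 + -p) = 0 by ring, rpow_zero]
    linear_combination ((1 - v) ^ (p - 1) * v ^ (-p)) * h3

lemma integral_Ici_powKer {p R c x : ℝ} (hp : 0 < p) (hcx : c ≤ x) (hR : x - c < R) :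
    ∫ s in Ici c, powKer (1 - p) R (x - s) = (x - c) ^ p / p := by
  have h1 : ∫ s in Ici c, powKer (1 - p) R (x - s) = ∫ s in c..x, (x - s) ^ (p - 1) := by
    rw [intervalIntegral.integral_of_le hcx, integral_Ioc_eq_integral_Ioo,
      integral_Ici_eq_integral_Ioi,
      ← integral_indicator measurableSet_Ioo, ← integral_indicator measurableSet_Ioi]
    congr 1; ext s
    by_cases hs : s ∈ Ioo c x
    · rw [indicator_of_mem hs, indicator_of_mem (by exact hs.1),
        powKer_of_mem ⟨by linarith [hs.2], by linarith [hs.1]⟩]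
      congr 1; ring
    · rw [indicator_of_notMem hs]
      by_cases h0 : s ∈ Ioi c
      · rw [indicator_of_mem h0, powKer_nonpos]
        by_contra h; exact hs ⟨h0, by linarith⟩
      · rw [indicator_of_notMem h0]
  rw [h1, intervalIntegral.integral_comp_sub_left (fun s => s ^ (p - 1)), sub_self,
    integral_rpow (Or.inl (by linarith))]
  simp [zero_rpow hp.ne']

lemma pot_pot_powKer {p R B a b : ℝ} (hp0 : 0 < p) (hp1 : p < 1) (hR : b - a < R) (hab : a < b)
    (hB : ∀ u ∈ Ioo 0 R, pot (powKer (1 - p) R) (powKer p R) u = B) {D : ℝ → ℝ}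
    (hD : IsBddDens a b D) {y : ℝ} (hy : y ≤ b) :
    pot (powKer (1 - p) R) (pot (powKer p R) D) y = B * ∫ t in Iio y, D t := by
  obtain ⟨M, -, hM⟩ := hD.bdd
  have hRpos : 0 < R := by linarith
  have k1 := isKer_powKer (α := 1 - p) (by linarith) hRpos
  have k2 := isKer_powKer (α := p) hp1 hRpos
  rw [pot_pot k1.meas k1.int k2.meas k2.int hD.int hM, pot, ← integral_const_mul,
    ← integral_indicator measurableSet_Iio]
  congr 1; ext t
  by_cases ht : t ∈ Icc a b
  · by_cases hty : t ∈ Iio y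
    · rw [indicator_of_mem hty, hB _ ⟨by simpa using hty, by linarith [ht.1]⟩]
    · rw [indicator_of_notMem hty]
      have h0 : pot (powKer (1 - p) R) (powKer p R) (y - t) = 0 := by
        rw [pot]
        refine integral_eq_zero_of_ae (.of_forall fun v => ?_)
        have h3 : y ≤ t := by simpa using hty
        by_cases hv : 0 < v
        · simp [powKer_nonpos (show y - t - v ≤ 0 by linarith)]
        · simp [powKer_nonpos (not_lt.1 hv)]
      rw [h0, zero_mul]
  · rw [hD.supp t ht, mul_zero]
    by_cases hty : t ∈ Iio y
    · rw [indicator_of_mem hty, hD.supp t ht, mul_zero]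
    · rw [indicator_of_notMem hty]

lemma abs_integral_le_of_pot_le {p R B a b A : ℝ} (hp0 : 0 < p) (hp1 : p < 1) (hR : b - a < R)
    (hab : a < b)
    (hB : ∀ u ∈ Ioo 0 R, pot (powKer (1 - p) R) (powKer p R) u = B) {D : ℝ → ℝ}
    (hD : IsBddDens a b D) (hA : ∀ x ∈ Icc a b, |pot (powKer p R) D x| ≤ A) {x y : ℝ}
    (hax : a ≤ x) (hxy : x ≤ y) (hyb : y ≤ b) :
    |B * ∫ t in Ico x y, D t| ≤ 2 * A * (y - x) ^ p / p := by
  obtain ⟨M, -, hM⟩ := hD.bdd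
  have hRpos : 0 < R := by linarith
  have hA0 : 0 ≤ A := (abs_nonneg _).trans (hA a ⟨le_rfl, hab.le⟩)
  have k1 := isKer_powKer (α := 1 - p) (by linarith) hRpos
  have k2 := isKer_powKer (α := p) hp1 hRpos
  have hPm : AEStronglyMeasurable (pot (powKer p R) D) volume :=
    (continuous_pot_of_bdd k2.meas k2.int hD.int.1 hM).aestronglyMeasurable
  have hPb := fun s => abs_pot_le_of_bdd k2.int hM s
  have c1 : ∀ z, PotConv (powKer (1 - p) R) (pot (powKer p R) D) z := fun z =>
    PotConv.of_bdd k1.meas k1.int hPm hPb z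
  have hsplit : ∫ t in Iio y, D t = (∫ t in Iio x, D t) + ∫ t in Ico x y, D t := by
    have hdisj : Disjoint (Iio x) (Ico x y) :=
      Set.disjoint_left.2 fun t h1 h2 => absurd h1 (not_lt.2 h2.1)
    rw [← setIntegral_union hdisj measurableSet_Ico hD.int.integrableOn hD.int.integrableOn,
      Iio_union_Ico_eq_Iio hxy]
  have hdiff : B * ∫ t in Ico x y, D t =
      ∫ s, (powKer (1 - p) R (y - s) * pot (powKer p R) D s
        - powKer (1 - p) R (x - s) * pot (powKer p R) D s) := by
    rw [integral_sub (c1 y) (c1 x)]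
    have e1 := pot_pot_powKer hp0 hp1 hR hab hB hD hyb
    have e2 := pot_pot_powKer hp0 hp1 hR hab hB hD (hxy.trans hyb)
    rw [pot] at e1 e2
    rw [e1, e2, hsplit]; ring
  set j := powKer (1 - p) R
  have hj0 := powKer_nonneg (1 - p) R
  have hjx : Integrable fun s => j (x - s) := k1.int.comp_sub_left x
  have hjy : Integrable fun s => j (y - s) := k1.int.comp_sub_left y
  set bd : ℝ → ℝ := fun s => A * ((Ici a).indicator (fun s => j (x - s)) s
    - (Ici a).indicator (fun s => j (y - s)) s) + 2 * A * (Ici x).indicator (fun s => j (y - s)) s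
  have i1 := (hjx.indicator (measurableSet_Ici (a := a)))
  have i2 := (hjy.indicator (measurableSet_Ici (a := a)))
  have i3 := (hjy.indicator (measurableSet_Ici (a := x)))
  have hbd : Integrable bd := ((i1.sub i2).const_mul A).add (i3.const_mul (2 * A))
  rw [hdiff]
  refine (norm_integral_le_of_norm_le (f := fun s => j (y - s) * pot (powKer p R) D s
        - j (x - s) * pot (powKer p R) D s) hbd (.of_forall fun s => ?_)).trans ?_
  · rw [← sub_mul, norm_mul, Real.norm_eq_abs, Real.norm_eq_abs]
    by_cases hsa : s < a
    · have : pot (powKer p R) D s = 0 := by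
        rw [pot]
        refine integral_eq_zero_of_ae (.of_forall fun t => ?_)
        by_cases ht : t ∈ Icc a b
        · simp [powKer_nonpos (show s - t ≤ 0 by linarith [ht.1])]
        · simp [hD.supp t ht]
      rw [this, abs_zero, mul_zero]
      simp only [bd]
      rw [indicator_of_notMem (by simpa using hsa), indicator_of_notMem (by simpa using hsa),
        indicator_of_notMem (by simpa using hsa.trans_le hax)]
      simp
    · rw [not_lt] at hsa
      simp only [bd]
      rw [indicator_of_mem (by exact hsa), indicator_of_mem (by exact hsa)]
      by_cases hsb : s ≤ b
      · refine (mul_le_mul_of_nonneg_left (hA s ⟨hsa, hsb⟩) (abs_nonneg _)).trans ?_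
        by_cases hsx : x ≤ s
        · rw [indicator_of_mem (by exact hsx)]
          have : j (x - s) = 0 := powKer_nonpos (by linarith)
          rw [this, sub_zero, abs_of_nonneg (hj0 _)]
          linarith
        · rw [indicator_of_notMem (by simpa using hsx)]
          rw [not_le] at hsx
          have : j (y - s) ≤ j (x - s) := by
            simp only [j]
            rw [powKer_of_mem ⟨by linarith, by linarith⟩, powKer_of_mem ⟨by linarith, by linarith⟩]
            exact rpow_le_rpow_of_nonpos (by linarith) (by linarith) (by linarith)
          rw [abs_sub_comm, abs_of_nonneg (by linarith)]
          linarith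
      · have e1 : j (x - s) = 0 := powKer_nonpos (by linarith)
        have e2 : j (y - s) = 0 := powKer_nonpos (by linarith)
        rw [indicator_of_mem (show s ∈ Ici x from by simp; linarith), e1, e2]
        simp
  · have : ∫ s, bd s = A * ((x - a) ^ p / p - (y - a) ^ p / p) + 2 * A * ((y - x) ^ p / p) := by
      simp only [bd]
      rw [integral_add (f := fun s => A * ((Ici a).indicator (fun s => j (x - s)) s
        - (Ici a).indicator (fun s => j (y - s)) s)) ((i1.sub i2).const_mul A)
        (i3.const_mul (2 * A)), integral_const_mul,
        integral_const_mul, integral_sub i1 i2, integral_indicator measurableSet_Ici,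
        integral_indicator measurableSet_Ici, integral_indicator measurableSet_Ici,
        integral_Ici_powKer hp0 hax (by linarith), integral_Ici_powKer hp0 (by linarith) (by linarith),
        integral_Ici_powKer hp0 (by linarith) (by linarith)]
    rw [this]
    have h1 : (x - a) ^ p ≤ (y - a) ^ p := rpow_le_rpow (by linarith) (by linarith) hp0.le
    have h2 : (x - a) ^ p / p ≤ (y - a) ^ p / p := by gcongr
    have h3 : A * ((x - a) ^ p / p - (y - a) ^ p / p) ≤ 0 :=
      mul_nonpos_of_nonneg_of_nonpos hA0 (by linarith)
    have h4 : 2 * A * (y - x) ^ p / p = 2 * A * ((y - x) ^ p / p) := by ring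
    linarith

lemma pot_powKer_near {q h x : ℝ} (hq0 : 0 < q) (hq1 : q < 1) (hh : 0 < h) {D : ℝ → ℝ}
    (hD : Integrable D) {M : ℝ} (hM : ∀ t, |D t| ≤ M) :
    pot (fun s => powKer q h (-s)) D x = h ^ (-q) * (∫ t in Ioo x (x + h), D t) +
      q * ∫ ρ in Ioo 0 h, ρ ^ (-q - 1) * ∫ t in Ico x (x + ρ), D t := by
  have hM0 : 0 ≤ M := (abs_nonneg _).trans (hM 0)
  set G : ℝ → ℝ → ℝ := fun ρ t => ρ ^ (-q - 1) * (Ico x (x + ρ)).indicator D t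
  have hset : MeasurableSet {z : ℝ × ℝ | z.2 ∈ Ico x (x + z.1)} := by
    have : {z : ℝ × ℝ | z.2 ∈ Ico x (x + z.1)} = {z | x ≤ z.2} ∩ {z | z.2 < x + z.1} := rfl
    rw [this]
    exact (measurableSet_le measurable_const measurable_snd).inter
      (measurableSet_lt measurable_snd (measurable_const.add measurable_fst))
  have hm : AEStronglyMeasurable (fun z : ℝ × ℝ => G z.1 z.2)
      ((volume.restrict (Ioo 0 h)).prod volume) := by
    have h1 : Measurable fun ρ : ℝ => ρ ^ (-q - 1) := by fun_prop
    have h2 : AEStronglyMeasurable ({z : ℝ × ℝ | z.2 ∈ Ico x (x + z.1)}.indicator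
        fun z : ℝ × ℝ => D z.2) ((volume.restrict (Ioo 0 h)).prod volume) :=
      hD.1.comp_snd.indicator hset
    exact (h1.comp measurable_fst).aestronglyMeasurable.mul h2
  have hsl : ∀ ρ, Integrable ((Ico x (x + ρ)).indicator D) := fun ρ =>
    hD.indicator measurableSet_Ico
  have hintg : Integrable (fun z : ℝ × ℝ => G z.1 z.2)
      ((volume.restrict (Ioo 0 h)).prod volume) := by
    rw [integrable_prod_iff hm]
    refine ⟨.of_forall fun ρ => (hsl ρ).const_mul (ρ ^ (-q - 1)), ?_⟩
    have hpow : Integrable (fun ρ : ℝ => M * ρ ^ (-q)) (volume.restrict (Ioo 0 h)) := by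
      have := intervalIntegral.intervalIntegrable_rpow' (a := 0) (b := h) (r := -q) (by linarith)
      rw [intervalIntegrable_iff_integrableOn_Ioo_of_le hh.le] at this
      exact this.const_mul M
    refine hpow.mono' hm.norm.integral_prod_right' ?_
    rw [ae_restrict_iff' measurableSet_Ioo]
    refine .of_forall fun ρ hρ => ?_
    rw [Real.norm_of_nonneg (integral_nonneg fun _ => norm_nonneg _)]
    simp only [G, norm_mul]
    rw [integral_const_mul, Real.norm_of_nonneg (rpow_nonneg hρ.1.le _)]
    have h3 : ∫ t, ‖(Ico x (x + ρ)).indicator D t‖ ≤ ρ * M := by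
      simp only [norm_indicator_eq_indicator_norm]
      rw [integral_indicator measurableSet_Ico]
      calc ∫ t in Ico x (x + ρ), ‖D t‖ ≤ ∫ t in Ico x (x + ρ), M :=
            setIntegral_mono hD.norm.integrableOn (integrableOn_const (by simp)) hM
        _ = ρ * M := by simp [hρ.1.le]
    calc ρ ^ (-q - 1) * ∫ t, ‖(Ico x (x + ρ)).indicator D t‖ ≤ ρ ^ (-q - 1) * (ρ * M) :=
          mul_le_mul_of_nonneg_left h3 (rpow_nonneg hρ.1.le _)
      _ = M * ρ ^ (-q) := by
          rw [rpow_sub_one hρ.1.ne']; have := hρ.1.ne'; field_simp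
  have hswap : ∫ ρ in Ioo 0 h, ρ ^ (-q - 1) * ∫ t in Ico x (x + ρ), D t =
      ∫ t, ∫ ρ in Ioo 0 h, G ρ t := by
    rw [← integral_integral_swap hintg]
    refine setIntegral_congr_fun measurableSet_Ioo fun ρ _ => ?_
    simp only [G]
    rw [integral_const_mul, integral_indicator measurableSet_Ico]
  rw [hswap, ← integral_indicator measurableSet_Ioo, ← integral_const_mul, ← integral_const_mul,
    ← integral_add ((hD.indicator measurableSet_Ioo).const_mul _)
      (hintg.integral_prod_right.const_mul q), pot]
  refine integral_congr_ae ?_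
  have hne : ∀ᵐ t : ℝ, t ≠ x := Measure.ae_ne volume x
  filter_upwards [hne] with t htx
  rw [neg_sub]
  by_cases ht : t ∈ Ioo x (x + h)
  · have hr : t - x ∈ Ioo 0 h := ⟨by linarith [ht.1], by linarith [ht.2]⟩
    rw [indicator_of_mem ht, powKer_of_mem hr]
    have h1 : ∫ ρ in Ioo 0 h, G ρ t = ∫ ρ in (t - x)..h, ρ ^ (-q - 1) * D t := by
      rw [intervalIntegral.integral_of_le hr.2.le, integral_Ioc_eq_integral_Ioo,
        ← integral_indicator measurableSet_Ioo, ← integral_indicator measurableSet_Ioo]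
      congr 1; ext ρ
      by_cases hρ : ρ ∈ Ioo (t - x) h
      · rw [indicator_of_mem hρ, indicator_of_mem (show ρ ∈ Ioo 0 h from ⟨hr.1.trans hρ.1, hρ.2⟩)]
        simp only [G]
        rw [indicator_of_mem (show t ∈ Ico x (x + ρ) from ⟨ht.1.le, by linarith [hρ.1]⟩)]
      · rw [indicator_of_notMem hρ]
        by_cases h0 : ρ ∈ Ioo 0 h
        · rw [indicator_of_mem h0]
          simp only [G]
          rw [indicator_of_notMem, mul_zero]
          intro h2
          exact hρ ⟨by linarith [h2.2], h0.2⟩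
        · rw [indicator_of_notMem h0]
    rw [h1, intervalIntegral.integral_mul_const, integral_rpow (Or.inr ⟨by linarith, fun h0 => by
      rw [uIcc_of_le hr.2.le] at h0; linarith [h0.1, hr.1]⟩)]
    rw [show -q - 1 + 1 = -q by ring]
    field_simp
    ring
  · rw [indicator_of_notMem ht, powKer_of_notMem (fun h2 => ht ⟨by linarith [h2.1], by linarith [h2.2]⟩)]
    have : ∫ ρ in Ioo 0 h, G ρ t = 0 := by
      refine setIntegral_eq_zero_of_forall_eq_zero fun ρ hρ => ?_
      simp only [G]
      rw [indicator_of_notMem, mul_zero]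
      intro h2
      exact ht ⟨lt_of_le_of_ne h2.1 (Ne.symm htx), by linarith [h2.2, hρ.2]⟩
    rw [this]; ring

lemma abs_pot_le_interp {p q R B a b A h : ℝ} (hq0 : 0 < q) (hqp : q < p) (hp1 : p < 1)
    (hR : b - a < R) (hab : a < b) (hB0 : 0 < B)
    (hB : ∀ u ∈ Ioo 0 R, pot (powKer (1 - p) R) (powKer p R) u = B) (hh : 0 < h) (hhR : h < R)
    {D : ℝ → ℝ} (hD : IsBddDens a b D) (hA : ∀ x ∈ Icc a b, |pot (powKer p R) D x| ≤ A)
    {x : ℝ} (hx : x ∈ Icc a b) :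
    |pot (fun s => powKer q R (-s)) D x| ≤
      2 * h ^ (-q) * (∫ t, |D t|) + 2 * q / (p * B * (p - q)) * h ^ (p - q) * A := by
  obtain ⟨M, -, hM⟩ := hD.bdd
  have hp0 : 0 < p := hq0.trans hqp
  have hA0 : 0 ≤ A := (abs_nonneg _).trans (hA x hx)
  have hk := (isKer_powKer (α := q) (by linarith) hh).reflect
  have hkR := (isKer_powKer (α := q) (by linarith) (hh.trans hhR)).reflect
  have c1 := PotConv.of_bdd hk.meas hk.int hD.int.1 hM x
  have c2 := PotConv.of_bdd hkR.meas hkR.int hD.int.1 hM x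
  have hfar : |pot (fun s => powKer q R (-s)) D x - pot (fun s => powKer q h (-s)) D x| ≤
      h ^ (-q) * ∫ t, |D t| := by
    rw [pot, pot, ← integral_sub c2 c1, ← integral_const_mul]
    refine norm_integral_le_of_norm_le (f := fun t => powKer q R (-(x - t)) * D t
      - powKer q h (-(x - t)) * D t) (hD.int.norm.const_mul _) (.of_forall fun t => ?_)
    rw [← sub_mul, norm_mul]
    refine mul_le_mul_of_nonneg_right ?_ (norm_nonneg _)
    rw [Real.norm_eq_abs]
    by_cases h1 : -(x - t) ∈ Ioo 0 h
    · rw [powKer_of_mem h1, powKer_of_mem ⟨h1.1, h1.2.trans hhR⟩, sub_self, abs_zero]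
      positivity
    · rw [powKer_of_notMem h1, sub_zero, abs_of_nonneg (powKer_nonneg _ _ _)]
      by_cases h2 : -(x - t) ∈ Ioo 0 R
      · rw [powKer_of_mem h2]
        have h3 : h ≤ -(x - t) := by
          by_contra h4; exact h1 ⟨h2.1, not_le.1 h4⟩
        exact rpow_le_rpow_of_nonpos hh h3 (by linarith)
      · rw [powKer_of_notMem h2]; positivity
  have hnear := pot_powKer_near (x := x) hq0 (by linarith) hh hD.int hM
  have hN1 : |(∫ t in Ioo x (x + h), D t)| ≤ ∫ t, |D t| :=
    (norm_integral_le_integral_norm _).trans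
      (setIntegral_le_integral hD.int.norm (.of_forall fun _ => norm_nonneg _))
  have hinc : ∀ ρ, 0 < ρ → |(∫ t in Ico x (x + ρ), D t)| ≤ 2 * A / (p * B) * ρ ^ p := by
    intro ρ hρ
    have h1 : ∫ t in Ico x (x + ρ), D t = ∫ t in Ico x (min (x + ρ) b), D t := by
      rw [← integral_indicator measurableSet_Ico, ← integral_indicator measurableSet_Ico]
      refine integral_congr_ae ?_
      filter_upwards [Measure.ae_ne volume b] with t ht
      by_cases htb : t ∈ Icc a b
      · have : t < b := lt_of_le_of_ne htb.2 ht
        have h2 : t ∈ Ico x (x + ρ) ↔ t ∈ Ico x (min (x + ρ) b) := by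
          simp [this]
        by_cases h3 : t ∈ Ico x (x + ρ)
        · rw [indicator_of_mem h3, indicator_of_mem (h2.1 h3)]
        · rw [indicator_of_notMem h3, indicator_of_notMem (fun h4 => h3 (h2.2 h4))]
      · simp [indicator, hD.supp t htb]
    have h2 := abs_integral_le_of_pot_le hp0 hp1 hR hab hB hD hA hx.1
      (y := min (x + ρ) b) (le_min (by linarith) hx.2) (min_le_right _ _)
    rw [h1]
    rw [abs_mul, abs_of_pos hB0] at h2
    have h3 : (min (x + ρ) b - x) ^ p ≤ ρ ^ p :=
      rpow_le_rpow (sub_nonneg.2 (le_min (by linarith) hx.2))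
        (by linarith [min_le_left (x + ρ) b]) hp0.le
    have h4 : 2 * A * (min (x + ρ) b - x) ^ p / p ≤ 2 * A * ρ ^ p / p := by gcongr
    have h5 := h2.trans h4
    rw [mul_comm, ← le_div_iff₀ hB0] at h5
    refine h5.trans_eq ?_
    field_simp
  have hpi : IntegrableOn (fun ρ : ℝ => ρ ^ (p - q - 1)) (Ioo 0 h) := by
    have := intervalIntegral.intervalIntegrable_rpow' (a := 0) (b := h) (r := p - q - 1)
      (by linarith)
    rwa [intervalIntegrable_iff_integrableOn_Ioo_of_le hh.le] at this
  have hN2 : |(∫ ρ in Ioo 0 h, ρ ^ (-q - 1) * ∫ t in Ico x (x + ρ), D t)| ≤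
      2 * A / (p * B) * (h ^ (p - q) / (p - q)) := by
    have e1 : ∫ ρ in Ioo 0 h, ρ ^ (p - q - 1) = h ^ (p - q) / (p - q) := by
      rw [← integral_Ioc_eq_integral_Ioo, ← intervalIntegral.integral_of_le hh.le,
        integral_rpow (Or.inl (by linarith)), sub_add_cancel,
        zero_rpow (by linarith : p - q ≠ 0), sub_zero]
    rw [← e1, ← integral_const_mul]
    refine norm_integral_le_of_norm_le (f := fun ρ => ρ ^ (-q - 1) * ∫ t in Ico x (x + ρ), D t)
      (hpi.const_mul _) ?_
    rw [ae_restrict_iff' measurableSet_Ioo]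
    refine .of_forall fun ρ hρ => ?_
    rw [norm_mul, Real.norm_of_nonneg (rpow_nonneg hρ.1.le _), Real.norm_eq_abs]
    refine (mul_le_mul_of_nonneg_left (hinc ρ hρ.1) (rpow_nonneg hρ.1.le _)).trans_eq ?_
    rw [show p - q - 1 = (-q - 1) + p by ring, rpow_add hρ.1]
    ring
  have hnb : |pot (fun s => powKer q h (-s)) D x| ≤ h ^ (-q) * (∫ t, |D t|) +
      q * (2 * A / (p * B) * (h ^ (p - q) / (p - q))) := by
    rw [hnear]
    refine (abs_add_le _ _).trans (add_le_add ?_ ?_)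
    · rw [abs_mul, abs_of_pos (rpow_pos_of_pos hh _)]
      exact mul_le_mul_of_nonneg_left hN1 (rpow_nonneg hh.le _)
    · rw [abs_mul, abs_of_pos hq0]
      exact mul_le_mul_of_nonneg_left hN2 hq0.le
  have e2 : q * (2 * A / (p * B) * (h ^ (p - q) / (p - q))) =
      2 * q / (p * B * (p - q)) * h ^ (p - q) * A := by
    have : p - q ≠ 0 := by linarith
    field_simp
  rw [e2] at hnb
  have h9 := abs_sub_abs_le_abs_sub (pot (fun s => powKer q R (-s)) D x)
    (pot (fun s => powKer q h (-s)) D x)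
  linarith

/-- A two-sided potential whose left part has the higher order controls both parts. -/
lemma exists_pot_bound {p q R a b κ₁ κ₂ : ℝ} (hq0 : 0 < q) (hqp : q < p) (hp1 : p < 1)
    (hR : b - a < R) (hab : a < b) (hκ₁ : 0 < κ₁) (hκ₂ : 0 ≤ κ₂) :
    ∃ C ≥ 0, ∀ D, IsBddDens a b D → ∀ M, (∀ x ∈ Icc a b,
      |κ₁ * pot (powKer p R) D x - κ₂ * pot (fun s => powKer q R (-s)) D x| ≤ M) →
      ∀ x ∈ Icc a b, |pot (powKer p R) D x| ≤ C * (M + ∫ t, |D t|) := by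
  obtain ⟨B, hB0, hB⟩ := exists_pot_powKer_eq (hq0.trans hqp) hp1 R
  have hRpos : 0 < R := by linarith
  set c := 2 * q / (p * B * (p - q))
  obtain ⟨h, hh, hhR, hch⟩ : ∃ h, 0 < h ∧ h < R ∧ κ₂ * (c * h ^ (p - q)) ≤ κ₁ / 2 := by
    have ht : Tendsto (fun h : ℝ => κ₂ * (c * h ^ (p - q))) (𝓝[>] 0) (𝓝 (κ₂ * (c * 0 ^ (p - q)))) := by
      refine (((continuousAt_rpow_const 0 (p - q) (Or.inr (by linarith))).tendsto.const_mul
        c).const_mul κ₂).mono_left nhdsWithin_le_nhds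
    rw [zero_rpow (by linarith : p - q ≠ 0), mul_zero, mul_zero] at ht
    have h1 := ht.eventually (gt_mem_nhds (show (0:ℝ) < κ₁ / 2 by positivity))
    have h2 : ∀ᶠ h : ℝ in 𝓝[>] 0, h < R := nhdsWithin_le_nhds (gt_mem_nhds hRpos)
    obtain ⟨h, hh1, hh2, hh3⟩ := (h1.and (h2.and self_mem_nhdsWithin)).exists
    exact ⟨h, hh3, hh2, hh1.le⟩
  refine ⟨2 / κ₁ * (1 + 2 * κ₂ * h ^ (-q)), by positivity, fun D hD M hM x hx => ?_⟩
  obtain ⟨MD, -, hMD⟩ := hD.bdd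
  have hk := isKer_powKer hp1 hRpos
  have hcont := continuous_pot_of_bdd hk.meas hk.int hD.int.1 hMD
  obtain ⟨x₀, hx₀, hmax⟩ := isCompact_Icc.exists_isMaxOn ⟨a, left_mem_Icc.2 hab.le⟩
    hcont.abs.continuousOn
  have hA : ∀ x ∈ Icc a b, |pot (powKer p R) D x| ≤ |pot (powKer p R) D x₀| := fun x hx => hmax hx
  refine (hA x hx).trans ?_
  have h1 := abs_pot_le_interp hq0 hqp hp1 hR hab hB0 hB hh hhR hD hA hx₀
  have h2 := hM x₀ hx₀
  set A := |pot (powKer p R) D x₀| with hAdef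
  set n := ∫ t, |D t|
  have hn : 0 ≤ n := integral_nonneg fun _ => abs_nonneg _
  have hM0 : 0 ≤ M := (abs_nonneg _).trans h2
  have h3 := abs_sub_abs_le_abs_sub (κ₁ * pot (powKer p R) D x₀)
    (κ₂ * pot (fun s => powKer q R (-s)) D x₀)
  rw [abs_mul, abs_mul, abs_of_pos hκ₁, abs_of_nonneg hκ₂, ← hAdef] at h3
  have h4 := mul_le_mul_of_nonneg_left h1 hκ₂
  have h5 := mul_le_mul_of_nonneg_right hch (abs_nonneg (pot (powKer p R) D x₀))
  rw [← hAdef] at h5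
  have h6 : κ₁ / 2 * A ≤ M + 2 * κ₂ * h ^ (-q) * n := by
    nlinarith
  have h7 : A ≤ 2 / κ₁ * (M + 2 * κ₂ * h ^ (-q) * n) := by
    rw [div_mul_eq_mul_div, le_div_iff₀ hκ₁]; linarith
  refine h7.trans ?_
  rw [mul_assoc (2 / κ₁)]
  refine mul_le_mul_of_nonneg_left ?_ (show (0 : ℝ) ≤ 2 / κ₁ by positivity)
  have h8 : 0 ≤ 2 * κ₂ * h ^ (-q) := by positivity
  nlinarith

lemma pot_reflect (k D : ℝ → ℝ) (c x : ℝ) :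
    pot (fun s => k (-s)) D x = pot k (fun t => D (c - t)) (c - x) := by
  rw [pot, pot, ← integral_sub_left_eq_self (fun t => k (c - x - t) * D (c - t)) volume c]
  congr 1; ext t; congr 2 <;> ring_nf

lemma IsBddDens.reflect {a b : ℝ} {D : ℝ → ℝ} (hD : IsBddDens a b D) :
    IsBddDens a b (fun t => D (a + b - t)) := by
  obtain ⟨M, hM0, hM⟩ := hD.bdd
  refine ⟨⟨hD.int.comp_sub_left (a + b), fun t ht => hD.supp _ fun h => ht ?_⟩, M, hM0,
    fun t => hM _⟩
  exact ⟨by linarith [h.2], by linarith [h.1]⟩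

lemma integral_powKer_Iic {α R c : ℝ} (hα : α < 1) (hc : c ∈ Icc 0 R) :
    ∫ s in Iic c, powKer α R s = c ^ (1 - α) / (1 - α) := by
  have h1 : ∫ s in Iic c, powKer α R s = ∫ s in (0:ℝ)..c, s ^ (-α) := by
    rw [intervalIntegral.integral_of_le hc.1, integral_Ioc_eq_integral_Ioo,
      integral_Iic_eq_integral_Iio,
      ← integral_indicator measurableSet_Ioo, ← integral_indicator measurableSet_Iio]
    congr 1; ext s
    by_cases hs : s ∈ Ioo 0 c
    · rw [indicator_of_mem hs, indicator_of_mem (by exact hs.2),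
        powKer_of_mem ⟨hs.1, by linarith [hs.2, hc.2]⟩]
    · rw [indicator_of_notMem hs]
      by_cases h0 : s ∈ Iio c
      · rw [indicator_of_mem h0, powKer_nonpos]
        by_contra h; exact hs ⟨by linarith, h0⟩
      · rw [indicator_of_notMem h0]
  rw [h1, integral_rpow (Or.inl (by linarith)), show -α + 1 = 1 - α by ring,
    zero_rpow (by linarith), sub_zero]

lemma integral_powKer_shift_le {α R T s : ℝ} (hα0 : 0 < α) (hα : α < 1) (hT : T < R) (hR : 0 < R)
    (hs : 0 < s) :
    ∫ u in Ioc (0:ℝ) 1, powKer α R (T - s * u) ≤ (1 - α)⁻¹ * powKer α R T := by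
  have hk := isKer_powKer hα hR
  by_cases hT0 : T ≤ 0
  · rw [powKer_nonpos hT0, mul_zero]
    refine (setIntegral_eq_zero_of_forall_eq_zero fun u hu => ?_).le
    exact powKer_nonpos (by nlinarith [hu.1])
  rw [not_le] at hT0
  rw [← intervalIntegral.integral_of_le zero_le_one,
    intervalIntegral.integral_comp_sub_mul (powKer α R) hs.ne', smul_eq_mul, mul_zero, sub_zero,
    mul_one, powKer_of_mem ⟨hT0, hT⟩]
  have h1 : ∫ v in (T - s)..T, powKer α R v =
      (∫ v in Iic T, powKer α R v) - ∫ v in Iic (T - s), powKer α R v :=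
    (intervalIntegral.integral_Iic_sub_Iic hk.int.integrableOn hk.int.integrableOn).symm
  rw [h1, integral_powKer_Iic hα ⟨hT0.le, hT.le⟩]
  have hTT : T ^ (1 - α) = T * T ^ (-α) := by
    rw [sub_eq_add_neg, rpow_add hT0, rpow_one]
  have hp : 0 < T ^ (-α) := rpow_pos_of_pos hT0 _
  have h1α : 0 < 1 - α := by linarith
  rw [inv_mul_le_iff₀ hs]
  by_cases hsT : s < T
  · rw [integral_powKer_Iic hα ⟨by linarith, by linarith⟩, ← sub_div, div_eq_inv_mul]
    have h2 : (T - s) ^ (1 - α) = (T - s) * (T - s) ^ (-α) := by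
      rw [sub_eq_add_neg 1, rpow_add (by linarith), rpow_one]
    have h3 : T ^ (-α) ≤ (T - s) ^ (-α) :=
      rpow_le_rpow_of_nonpos (by linarith) (by linarith) (by linarith)
    have h4 : T ^ (1 - α) - (T - s) ^ (1 - α) ≤ s * T ^ (-α) := by
      rw [hTT, h2]; nlinarith
    calc _ ≤ (1 - α)⁻¹ * (s * T ^ (-α)) := by gcongr
      _ = _ := by ring
  · rw [not_lt] at hsT
    have h2 : 0 ≤ ∫ v in Iic (T - s), powKer α R v := integral_nonneg fun v => powKer_nonneg _ _ _
    have h3 : T ^ (1 - α) / (1 - α) ≤ s * ((1 - α)⁻¹ * T ^ (-α)) := by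
      rw [hTT, div_eq_inv_mul]
      calc (1 - α)⁻¹ * (T * T ^ (-α)) ≤ (1 - α)⁻¹ * (s * T ^ (-α)) := by gcongr
        _ = _ := by ring
    linarith

lemma lintegral_powKer_stek_le {α R x₀ s : ℝ} (hα0 : 0 < α) (hα : α < 1) (hR : 0 < R) (hs : 0 < s)
    {w : ℝ → ℝ} (hw : Integrable w) (hsupp : ∀ t, R ≤ x₀ - t → w t = 0) :
    ∫⁻ t, ‖powKer α R (x₀ - t)‖ₑ * ‖stek (-s) w t‖ₑ ≤
      ENNReal.ofReal (1 - α)⁻¹ * ∫⁻ t, ‖powKer α R (x₀ - t)‖ₑ * ‖w t‖ₑ := by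
  have hk := isKer_powKer hα hR
  have hkm : Measurable fun t => ‖powKer α R t‖ₑ := hk.meas.enorm
  have hq : Measure.QuasiMeasurePreserving (fun p : ℝ × ℝ => p.1 + -s * p.2)
      (volume.prod (volume.restrict (Ioc (0 : ℝ) 1))) volume :=
    QuasiMeasurePreserving.prod_of_left (by fun_prop) (.of_forall fun u =>
      (measurePreserving_add_right volume (-s * u)).quasiMeasurePreserving)
  calc ∫⁻ t, ‖powKer α R (x₀ - t)‖ₑ * ‖stek (-s) w t‖ₑ
      ≤ ∫⁻ t, ∫⁻ u in Ioc (0:ℝ) 1, ‖powKer α R (x₀ - t)‖ₑ * ‖w (t + -s * u)‖ₑ := by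
        refine lintegral_mono fun t => ?_
        rw [lintegral_const_mul' _ _ (by simp)]
        exact mul_le_mul_right (enorm_integral_le_lintegral_enorm _) _
    _ = ∫⁻ u in Ioc (0:ℝ) 1, ∫⁻ t, ‖powKer α R (x₀ - t)‖ₑ * ‖w (t + -s * u)‖ₑ := by
        have h1 : AEMeasurable (fun z : ℝ × ℝ => ‖powKer α R (x₀ - z.1)‖ₑ)
            (volume.prod (volume.restrict (Ioc (0 : ℝ) 1))) :=
          (hkm.comp (measurable_const.sub measurable_fst)).aemeasurable
        have h2 : AEMeasurable (fun z : ℝ × ℝ => ‖w (z.1 + -s * z.2)‖ₑ)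
            (volume.prod (volume.restrict (Ioc (0 : ℝ) 1))) :=
          (hw.1.comp_quasiMeasurePreserving hq).enorm
        exact lintegral_lintegral_swap (h1.mul h2)
    _ = ∫⁻ u in Ioc (0:ℝ) 1, ∫⁻ t, ‖powKer α R (x₀ - t - s * u)‖ₑ * ‖w t‖ₑ := by
        congr 1; ext u
        rw [← lintegral_add_right_eq_self
          (fun t => ‖powKer α R (x₀ - t)‖ₑ * ‖w (t + -s * u)‖ₑ) (s * u)]
        congr 1; ext t; congr 3 <;> ring_nf
    _ = ∫⁻ t, ∫⁻ u in Ioc (0:ℝ) 1, ‖powKer α R (x₀ - t - s * u)‖ₑ * ‖w t‖ₑ := by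
        have h1 : AEMeasurable (fun z : ℝ × ℝ => ‖powKer α R (x₀ - z.2 - s * z.1)‖ₑ)
            ((volume.restrict (Ioc (0 : ℝ) 1)).prod volume) :=
          (hkm.comp ((measurable_const.sub measurable_snd).sub
            (measurable_fst.const_mul s))).aemeasurable
        have h2 : AEMeasurable (fun z : ℝ × ℝ => ‖w z.2‖ₑ)
            ((volume.restrict (Ioc (0 : ℝ) 1)).prod volume) := hw.1.comp_snd.enorm
        exact lintegral_lintegral_swap (h1.mul h2)
    _ ≤ ∫⁻ t, ENNReal.ofReal (1 - α)⁻¹ * (‖powKer α R (x₀ - t)‖ₑ * ‖w t‖ₑ) := by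
        refine lintegral_mono fun t => ?_
        rw [lintegral_mul_const' _ _ (by simp), ← mul_assoc]
        by_cases ht : R ≤ x₀ - t
        · simp [hsupp t ht]
        refine mul_le_mul_left ?_ _
        have h1 := integral_powKer_shift_le hα0 hα (not_le.1 ht) hR hs
        have h2 : Integrable (fun u => powKer α R (x₀ - t - s * u))
            (volume.restrict (Ioc (0:ℝ) 1)) :=
          ((hk.int.comp_sub_left (x₀ - t)).comp_mul_left' hs.ne').integrableOn
        have h3 : ∫⁻ u in Ioc (0:ℝ) 1, ‖powKer α R (x₀ - t - s * u)‖ₑ =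
            ENNReal.ofReal (∫ u in Ioc (0:ℝ) 1, powKer α R (x₀ - t - s * u)) := by
          rw [ofReal_integral_eq_lintegral_ofReal h2 (.of_forall fun u => powKer_nonneg _ _ _)]
          congr 1; ext u
          exact Real.enorm_of_nonneg (powKer_nonneg _ _ _)
        rw [h3, Real.enorm_of_nonneg (powKer_nonneg _ _ _),
          ← ENNReal.ofReal_mul (by simp; linarith)]
        exact ENNReal.ofReal_le_ofReal h1
    _ = _ := lintegral_const_mul' _ _ (by simp)

lemma stek_add {u v : ℝ → ℝ} (hu : Integrable u) (hv : Integrable v) {s : ℝ} (hs : s ≠ 0) (t : ℝ) :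
    stek s (fun t => u t + v t) t = stek s u t + stek s v t :=
  integral_add ((hu.comp_add_left t).comp_mul_left' hs).integrableOn
    ((hv.comp_add_left t).comp_mul_left' hs).integrableOn

lemma exists_stek_close {α R x₀ ε : ℝ} (hα0 : 0 < α) (hα : α < 1) (hR : 0 < R)
    {w : ℝ → ℝ} (hw : Integrable w) (hsupp : ∀ t, R ≤ x₀ - t → w t = 0)
    (hc : PotConv (powKer α R) w x₀) (hε : 0 < ε) :
    ∃ s₀ > 0, ∀ s ∈ Ioo 0 s₀,
      Integrable (fun t => powKer α R (x₀ - t) * (stek (-s) w t - w t)) ∧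
      ∫ t, |powKer α R (x₀ - t) * (stek (-s) w t - w t)| ≤ ε := by
  have hk := isKer_powKer hα hR
  obtain ⟨C, hC0, hC⟩ := hk.bound
  set c := (1 - α)⁻¹
  have hcpos : 0 < c := inv_pos.2 (by linarith)
  set ε₁ := ε / (2 * (c + 1))
  have hε₁ : 0 < ε₁ := by positivity
  obtain ⟨δ, hδ, hδ'⟩ := exists_pos_setLIntegral_lt_of_measure_lt
    (f := fun t => ‖powKer α R (x₀ - t) * w t‖ₑ) (μ := volume) hc.2.ne
    (ε := ENNReal.ofReal ε₁) (by simpa using hε₁)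
  obtain ⟨η, hη, hηδ⟩ : ∃ η > 0, volume (Metric.ball x₀ η) < δ := by
    obtain ⟨d, hd0, hd⟩ := ENNReal.lt_iff_exists_nnreal_btwn.1 hδ
    refine ⟨d / 2, ?_, ?_⟩
    · have : (0:ℝ) < d := by exact_mod_cast hd0
      positivity
    · rw [Real.volume_ball, mul_div_cancel₀ _ (two_ne_zero)]
      simpa using hd
  have hI := hδ' _ hηδ
  set s := Metric.ball x₀ η
  have hsm : MeasurableSet s := measurableSet_ball
  set w₁ := s.indicator w
  set w₂ := sᶜ.indicator w
  have hw₁ : Integrable w₁ := hw.indicator hsm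
  have hw₂ : Integrable w₂ := hw.indicator hsm.compl
  have hsum : ∀ t, w t = w₁ t + w₂ t := fun t => (indicator_self_add_compl_apply s w t).symm
  have hI₁ : ∫⁻ t, ‖powKer α R (x₀ - t)‖ₑ * ‖w₁ t‖ₑ < ENNReal.ofReal ε₁ := by
    rw [← lintegral_indicator hsm] at hI
    refine hI.trans_le' (lintegral_mono fun t => ?_)
    simp only [w₁]
    by_cases ht : t ∈ s
    · rw [indicator_of_mem ht, indicator_of_mem ht, enorm_mul]
    · rw [indicator_of_notMem ht, indicator_of_notMem ht]; simp
  obtain ⟨s₁, hs₁, hs₁'⟩ := stek_sub_le hw₂ (ε := ε * η / (4 * (C + 1))) (by positivity)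
  refine ⟨min s₁ (η / 2), lt_min hs₁ (by positivity), fun σ hσ => ?_⟩
  have hσ0 := hσ.1
  have hσ1 := hσ.2.trans_le (min_le_left _ _)
  have hσ2 := hσ.2.trans_le (min_le_right _ _)
  have hst : ∀ t, stek (-σ) w t = stek (-σ) w₁ t + stek (-σ) w₂ t := fun t => by
    rw [← stek_add hw₁ hw₂ (neg_ne_zero.2 hσ0.ne')]
    congr 1; ext t; exact hsum t
  have hnear : ∀ t, |t - x₀| < η / 2 → stek (-σ) w₂ t - w₂ t = 0 := by
    intro t ht
    have h1 : ∀ t', |t' - x₀| < η → w₂ t' = 0 := fun t' h => by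
      simp only [w₂]
      rw [indicator_of_notMem]
      simpa [s, Real.dist_eq] using h
    rw [h1 t (by linarith), sub_zero, stek]
    refine setIntegral_eq_zero_of_forall_eq_zero fun u hu => h1 _ ?_
    rw [abs_lt] at ht ⊢
    have : σ * u ≤ σ := by nlinarith [hu.2]
    have : 0 ≤ σ * u := mul_nonneg hσ0.le hu.1.le
    constructor <;> linarith [ht.1, ht.2]
  have hI₂ : ∫⁻ t, ‖powKer α R (x₀ - t)‖ₑ * ‖stek (-σ) w₂ t - w₂ t‖ₑ ≤ ENNReal.ofReal (ε / 2) := by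
    have h1 : ∀ t, ‖powKer α R (x₀ - t)‖ₑ * ‖stek (-σ) w₂ t - w₂ t‖ₑ ≤
        ENNReal.ofReal (C / (η / 2)) * ‖stek (-σ) w₂ t - w₂ t‖ₑ := by
      intro t
      by_cases ht : |t - x₀| < η / 2
      · simp [hnear t ht]
      · refine mul_le_mul_left ?_ _
        rw [not_lt, abs_sub_comm] at ht
        rw [← ofReal_norm]
        refine ENNReal.ofReal_le_ofReal ?_
        rw [le_div_iff₀ (by positivity)]
        exact (mul_le_mul_of_nonneg_left ht (norm_nonneg _)).trans (hC _)
    refine (lintegral_mono h1).trans ?_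
    rw [lintegral_const_mul' _ _ (by simp),
      ← ofReal_integral_norm_eq_lintegral_enorm (f := fun t => stek (-σ) w₂ t - w₂ t)
        ((stek_integrable hw₂ _).sub hw₂),
      ← ENNReal.ofReal_mul (by positivity)]
    refine ENNReal.ofReal_le_ofReal ?_
    have h2 := hs₁' (-σ) (by rwa [abs_neg, abs_of_pos hσ0])
    calc C / (η / 2) * ∫ t, ‖stek (-σ) w₂ t - w₂ t‖ ≤ C / (η / 2) * (ε * η / (4 * (C + 1))) := by
          gcongr; exact h2
      _ = ε / 2 * (C / (C + 1)) := by field_simp; ring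
      _ ≤ ε / 2 * 1 := by
          gcongr; rw [div_le_one (by positivity)]; linarith
      _ = ε / 2 := mul_one _
  have hI₃ := lintegral_powKer_stek_le (x₀ := x₀) hα0 hα hR hσ0 hw₁ (fun t ht => by
    simp [w₁, indicator, hsupp t ht])
  have hkm : AEMeasurable (fun t => ‖powKer α R (x₀ - t)‖ₑ) volume :=
    (hk.meas.comp (measurable_const.sub measurable_id)).enorm.aemeasurable
  have htot : ∫⁻ t, ‖powKer α R (x₀ - t) * (stek (-σ) w t - w t)‖ₑ ≤ ENNReal.ofReal ε := by
    calc ∫⁻ t, ‖powKer α R (x₀ - t) * (stek (-σ) w t - w t)‖ₑ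
        ≤ ∫⁻ t, (‖powKer α R (x₀ - t)‖ₑ * ‖stek (-σ) w₁ t‖ₑ + ‖powKer α R (x₀ - t)‖ₑ * ‖w₁ t‖ₑ +
            ‖powKer α R (x₀ - t)‖ₑ * ‖stek (-σ) w₂ t - w₂ t‖ₑ) := by
          refine lintegral_mono fun t => ?_
          rw [enorm_mul, ← mul_add, ← mul_add]
          refine mul_le_mul_right ?_ _
          rw [hst, hsum t, show stek (-σ) w₁ t + stek (-σ) w₂ t - (w₁ t + w₂ t) =
            stek (-σ) w₁ t - w₁ t + (stek (-σ) w₂ t - w₂ t) by ring]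
          exact (enorm_add_le _ _).trans (add_le_add_left enorm_sub_le _)
      _ = (∫⁻ t, ‖powKer α R (x₀ - t)‖ₑ * ‖stek (-σ) w₁ t‖ₑ) +
          (∫⁻ t, ‖powKer α R (x₀ - t)‖ₑ * ‖w₁ t‖ₑ) +
            ∫⁻ t, ‖powKer α R (x₀ - t)‖ₑ * ‖stek (-σ) w₂ t - w₂ t‖ₑ := by
          rw [lintegral_add_left' ?_, lintegral_add_left' ?_]
          · exact hkm.mul (stek_integrable hw₁ _).1.enorm
          · exact (hkm.mul (stek_integrable hw₁ _).1.enorm).add (hkm.mul hw₁.1.enorm)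
      _ ≤ ENNReal.ofReal c * ENNReal.ofReal ε₁ + ENNReal.ofReal ε₁ + ENNReal.ofReal (ε / 2) := by
          refine add_le_add (add_le_add (hI₃.trans ?_) hI₁.le) hI₂
          exact mul_le_mul_right hI₁.le _
      _ = ENNReal.ofReal ε := by
          rw [← ENNReal.ofReal_mul hcpos.le, ← ENNReal.ofReal_add (by positivity) hε₁.le,
            ← ENNReal.ofReal_add (by positivity) (by positivity)]
          congr 1
          simp only [ε₁]
          field_simp
          ring
  have hintg : Integrable (fun t => powKer α R (x₀ - t) * (stek (-σ) w t - w t)) :=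
    ⟨aestronglyMeasurable_pot_integrand hk.meas ((stek_integrable hw _).sub hw).1 x₀,
      htot.trans_lt ENNReal.ofReal_lt_top⟩
  refine ⟨hintg, ?_⟩
  have h9 := ofReal_integral_norm_eq_lintegral_enorm hintg
  rw [← h9] at htot
  exact (ENNReal.ofReal_le_ofReal_iff hε.le).1 htot

lemma exists_stek_close_reflect {α R x₀ ε : ℝ} (hα0 : 0 < α) (hα : α < 1) (hR : 0 < R)
    {w : ℝ → ℝ} (hw : Integrable w) (hsupp : ∀ t, R ≤ t - x₀ → w t = 0)
    (hc : PotConv (fun s => powKer α R (-s)) w x₀) (hε : 0 < ε) :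
    ∃ s₀ > 0, ∀ s ∈ Ioo 0 s₀,
      Integrable (fun t => powKer α R (-(x₀ - t)) * (stek s w t - w t)) ∧
      ∫ t, |powKer α R (-(x₀ - t)) * (stek s w t - w t)| ≤ ε := by
  have hst : ∀ s t, stek (-s) (fun t => w (-t)) t = stek s w (-t) := fun s t => by
    simp only [stek]; congr 1; ext u; congr 1; ring
  have hc' : PotConv (powKer α R) (fun t => w (-t)) (-x₀) := by
    refine (hc.comp_neg).congr (.of_forall fun t => ?_)
    simp only; congr 2; ring
  obtain ⟨s₀, hs₀, h⟩ := exists_stek_close hα0 hα hR hw.comp_neg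
    (fun t ht => hsupp (-t) (by linarith)) hc' hε
  refine ⟨s₀, hs₀, fun s hs => ?_⟩
  obtain ⟨h1, h2⟩ := h s hs
  constructor
  · refine h1.comp_neg.congr (.of_forall fun t => ?_)
    simp only [hst, neg_neg]; congr 2; ring
  · rw [← integral_neg_eq_self] at h2
    refine h2.trans_eq' ?_
    congr 1; ext t; simp only [hst, neg_neg]; congr 3; ring

lemma IsBddDens.potConv {a b R : ℝ} {k u : ℝ → ℝ} (hu : IsBddDens a b u) (hk : IsKer k R) (x : ℝ) :
    PotConv k u x := by
  obtain ⟨M, -, hM⟩ := hu.bdd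
  exact PotConv.of_bdd hk.meas hk.int hu.int.1 hM x

lemma IsBddDens.continuous_pot {a b R : ℝ} {k u : ℝ → ℝ} (hu : IsBddDens a b u) (hk : IsKer k R) :
    Continuous (pot k u) := by
  obtain ⟨M, -, hM⟩ := hu.bdd
  exact continuous_pot_of_bdd hk.meas hk.int hu.int.1 hM

namespace PotSys

variable {S : PotSys}

lemma continuous_K {u : ℝ → ℝ} (hu : IsBddDens S.a S.b u) : Continuous (S.K u) :=
  ((hu.continuous_pot S.ker₁).const_mul _).sub ((hu.continuous_pot S.ker₂).const_mul _)

lemma edge_pos {x : ℝ} (hx : x ∈ Ioo S.a S.b) : 0 < edge S.a S.b x :=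
  lt_min (by linarith [hx.1]) (by linarith [hx.2])

/-- A sequence of step sizes can be modified at finitely many places so that the potential of the
smoothing correction becomes small at a point where one-sided averages are well behaved. -/
lemma exists_steps_close {w k : ℝ → ℝ} {R x₀ τ θ ε : ℝ} (hw : IsDens S.a S.b w) (hk : IsKer k R)
    (hx₀ : x₀ ∈ Ioo S.a S.b) (hτ : 0 < τ) {s₀ σ : ℕ → ℝ} (hs₀ : ∀ n, 0 < s₀ n)
    (hσ : ∀ n, σ n ≠ 0 ∧ |σ n| < s₀ n)
    (hpiece : ∀ σ' : ℕ → ℝ, (∀ n, σ' n ≠ 0 ∧ |σ' n| < s₀ n) → ∀ n,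
      ∫ t, |bump (pou S.a S.b n) w (σ' n) t| ≤ τ / 2 / 2 ^ n / (n + 1))
    (hθ : |θ| = 1)
    (hclose : ∀ ε > 0, ∃ s₁ > 0, ∀ s ∈ Ioo 0 s₁,
      Integrable (fun t => k (x₀ - t) * (stek (θ * s) w t - w t)) ∧
      ∫ t, |k (x₀ - t) * (stek (θ * s) w t - w t)| ≤ ε) (hε : 0 < ε) :
    ∃ (n : ℕ) (σ' : ℕ → ℝ), (∀ i, σ' i ≠ 0 ∧ |σ' i| < s₀ i) ∧ (∀ i, n ≤ i → σ' i = σ i) ∧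
      PotConv k (S.corr w σ') x₀ ∧ |pot k (S.corr w σ') x₀| ≤ ε := by
  obtain ⟨C, hC0, hC⟩ := hk.bound
  have hd := edge_pos hx₀
  set d := edge S.a S.b x₀
  obtain ⟨n₁, hn₁⟩ := exists_nat_gt (4 / d)
  obtain ⟨n₂, hn₂⟩ := exists_nat_gt (2 * C * τ / (d * ε))
  set n := max n₁ n₂
  have hn1 : 4 / d < n := hn₁.trans_le (by exact_mod_cast le_max_left _ _)
  have hn2 : 2 * C * τ / (d * ε) < n := hn₂.trans_le (by exact_mod_cast le_max_right _ _)
  rw [div_lt_iff₀ hd] at hn1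
  rw [div_lt_iff₀ (by positivity)] at hn2
  obtain ⟨s₁, hs₁, hs₁'⟩ := hclose (ε / 2 / 2 ^ n) (by positivity)
  obtain ⟨s₂, hs₂, hs₂'⟩ : ∃ s₂ > 0, ∀ i < n, s₂ ≤ s₀ i := by
    clear hs₁' hn1 hn2
    induction n with
    | zero => exact ⟨1, one_pos, fun i hi => absurd hi (Nat.not_lt_zero i)⟩
    | succ m ih =>
      obtain ⟨s, hs, h⟩ := ih
      refine ⟨min s (s₀ m), lt_min hs (hs₀ m), fun i hi => ?_⟩
      rcases Nat.lt_succ_iff_lt_or_eq.1 hi with hi | rfl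
      · exact (min_le_left _ _).trans (h i hi)
      · exact min_le_right _ _
  set s := min s₁ s₂ / 2
  have hs : 0 < s := half_pos (lt_min hs₁ hs₂)
  have hss : s < min s₁ s₂ := half_lt_self (lt_min hs₁ hs₂)
  have hs' := hs₁' s ⟨hs, hss.trans_le (min_le_left _ _)⟩
  have hθ0 : θ ≠ 0 := fun h => by simp [h] at hθ
  set σ' : ℕ → ℝ := fun i => if i < n then θ * s else σ i
  have hσ' : ∀ i, σ' i ≠ 0 ∧ |σ' i| < s₀ i := fun i => by
    simp only [σ']
    split_ifs with h
    · refine ⟨mul_ne_zero hθ0 hs.ne', ?_⟩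
      rw [abs_mul, hθ, one_mul, abs_of_pos hs]
      exact (hss.trans_le (min_le_right _ _)).trans_le (hs₂' i h)
    · exact hσ i
  set G : ℕ → ℝ → ℝ := fun i => bump (pou S.a S.b i) w (σ' i)
  have hGi : ∀ i, Integrable (G i) := fun i => (isDens_pouBump hw i _).int
  have hbd : ∀ i, PotConv k (G i) x₀ ∧ ∫ t, |k (x₀ - t) * G i t| ≤ ε / 2 / 2 ^ i := by
    intro i
    by_cases hi : i < n
    · have hGe : ∀ t, |k (x₀ - t) * G i t| ≤ |k (x₀ - t) * (stek (θ * s) w t - w t)| := fun t => by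
        simp only [G, bump, σ', if_pos hi]
        rw [abs_mul, abs_mul, abs_mul]
        gcongr
        exact mul_le_of_le_one_left (abs_nonneg _) (abs_pou_le _ _ i t)
      have hP : PotConv k (G i) x₀ := Integrable.mono' hs'.1.norm
        (aestronglyMeasurable_pot_integrand hk.meas (hGi i).1 x₀) (.of_forall hGe)
      refine ⟨hP, (integral_mono hP.norm hs'.1.norm hGe).trans (hs'.2.trans ?_)⟩
      gcongr
      norm_num
    · push Not at hi
      have hi' : (n : ℝ) ≤ i := by exact_mod_cast hi
      have hGe : ∀ t, |k (x₀ - t) * G i t| ≤ C / (d / 2) * |G i t| := fun t => by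
        by_cases h : pou S.a S.b i t = 0
        · simp [G, bump, h]
        · rw [abs_mul]
          gcongr
          rw [le_div_iff₀ (by positivity)]
          refine (mul_le_mul_of_nonneg_left ?_ (abs_nonneg _)).trans (hC (x₀ - t))
          by_contra hlt
          push Not at hlt
          have h1 := (le_abs_self _).trans (edge_lip S.a S.b x₀ t)
          have h2 : d / 2 ≤ edge S.a S.b t := by
            change d - edge S.a S.b t ≤ _ at h1
            linarith
          exact h (pou_eq_zero_of_le (by nlinarith) (by linarith))
      have hP : PotConv k (G i) x₀ := Integrable.mono' ((hGi i).norm.const_mul _)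
        (aestronglyMeasurable_pot_integrand hk.meas (hGi i).1 x₀) (.of_forall hGe)
      refine ⟨hP, (integral_mono hP.norm ((hGi i).norm.const_mul _) hGe).trans ?_⟩
      rw [integral_const_mul]
      calc C / (d / 2) * ∫ t, ‖G i t‖ ≤ C / (d / 2) * (τ / 2 / 2 ^ i / (i + 1)) := by
            gcongr; exact hpiece σ' hσ' i
        _ = (2 * C * τ / (d * (i + 1))) / 2 / 2 ^ i := by field_simp
        _ ≤ ε / 2 / 2 ^ i := by
            gcongr
            rw [div_le_iff₀ (by positivity)]
            have := mul_le_mul_of_nonneg_right hi' (mul_pos hd hε).le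
            nlinarith [mul_pos hd hε]
  have hsum : Summable fun i => ∫ t, |k (x₀ - t) * G i t| :=
    Summable.of_nonneg_of_le (fun n => integral_nonneg fun t => abs_nonneg _)
      (fun i => (hbd i).2) (summable_geometric_two' ε)
  have hp := pot_tsum (fun i => (hbd i).1) hsum
  refine ⟨n, σ', hσ', fun i hi => by simp [σ', not_lt.2 hi], hp.1, ?_⟩
  change |pot k (fun t => ∑' i, G i t) x₀| ≤ ε
  rw [← hp.2.tsum_eq]
  have h5 : ∀ i, ‖pot k (G i) x₀‖ ≤ ε / 2 / 2 ^ i := fun i =>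
    (norm_integral_le_integral_norm _).trans (hbd i).2
  exact (tsum_of_norm_bounded (summable_geometric_two' ε).hasSum h5).trans_eq
    (tsum_geometric_two' ε)

lemma corr_sub_eq {w : ℝ → ℝ} {σ σ' : ℕ → ℝ} {n : ℕ} (h : ∀ i, n ≤ i → σ' i = σ i)
    (t : ℝ) : S.corr w σ' t - S.corr w σ t =
      ∑ i ∈ Finset.range n, pou S.a S.b i t * (stek (σ' i) w t - stek (σ i) w t) := by
  have hf : ∃ m ≥ n, ∀ i, i ∉ Finset.range m → pou S.a S.b i t = 0 := by
    by_cases hd : 0 < edge S.a S.b t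
    · obtain ⟨m, hm⟩ := exists_nat_gt (2 / edge S.a S.b t)
      refine ⟨max n m, le_max_left _ _, fun i hi => pou_eq_zero_of_le ?_ hd.le⟩
      rw [div_lt_iff₀ hd] at hm
      have : (m : ℝ) ≤ i := by
        exact_mod_cast (le_max_right n m).trans (not_lt.1 fun h => hi (Finset.mem_range.2 h))
      nlinarith
    · refine ⟨n, le_rfl, fun i _ => ?_⟩
      by_contra h
      have h1 := edge_le_of_pou_ne h
      have : 0 < 1 / (i + 1 : ℝ) := by positivity
      linarith
  obtain ⟨m, hmn, hm⟩ := hf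
  have hc : ∀ σ : ℕ → ℝ, S.corr w σ t = ∑ i ∈ Finset.range m, bump (pou S.a S.b i) w (σ i) t :=
    fun σ => tsum_eq_sum fun i hi => by rw [bump, hm i hi, zero_mul]
  rw [hc, hc, ← Finset.sum_sub_distrib]
  symm
  rw [← Finset.sum_subset (Finset.range_subset_range.2 hmn)]
  · refine Finset.sum_congr rfl fun i _ => ?_
    rw [bump, bump]; ring
  · intro i _ hi
    rw [bump, bump, h i (not_lt.1 fun h => hi (Finset.mem_range.2 h)), sub_self]

lemma isBddDens_corr_sub {w : ℝ → ℝ} (hw : IsDens S.a S.b w) {σ σ' : ℕ → ℝ} {n : ℕ}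
    (hσ : ∀ i, σ i ≠ 0) (hσ' : ∀ i, σ' i ≠ 0) (h : ∀ i, n ≤ i → σ' i = σ i) :
    IsBddDens S.a S.b (fun t => S.corr w σ' t - S.corr w σ t) := by
  simp only [corr_sub_eq h]
  refine isBddDens_sum _ fun i => ?_
  have h1 := (isDens_pouBump hw i (σ' i)).sub (isDens_pouBump hw i (σ i))
  refine ⟨?_, |σ' i|⁻¹ * (∫ t, |w t|) + |σ i|⁻¹ * (∫ t, |w t|),
    add_nonneg (by positivity) (by positivity), fun t => ?_⟩
  · convert h1 using 2 with t
    simp only [bump]; ring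
  · rw [abs_mul]
    refine (mul_le_of_le_one_left (abs_nonneg _) (abs_pou_le _ _ i t)).trans ((abs_sub _ _).trans ?_)
    exact add_le_add (abs_stek_le hw.int (hσ' i) t) (abs_stek_le hw.int (hσ i) t)

/-- The one-sided potentials of bounded densities are controlled by the two-sided one. -/
def PotBound (S : PotSys) : Prop :=
  ∃ C ≥ 0, ∀ D, IsBddDens S.a S.b D → ∀ M, (∀ x ∈ Icc S.a S.b, |S.K D x| ≤ M) →
    ∀ x ∈ Icc S.a S.b, |pot S.k₁ D x| ≤ C * (M + ∫ t, |D t|) ∧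
      |pot S.k₂ D x| ≤ C * (M + ∫ t, |D t|)

lemma abs_K_corr_sub_le {w F : ℝ → ℝ} {τ : ℝ} {σ σ' : ℕ → ℝ} {n : ℕ} (hw : IsDens S.a S.b w)
    (hσ : ∀ i, σ i ≠ 0) (hσ' : ∀ i, σ' i ≠ 0) (h : ∀ i, n ≤ i → σ' i = σ i)
    (hS : S.Smoothing w F τ σ) (hS' : S.Smoothing w F τ σ') {x : ℝ} (hx : x ∈ Icc S.a S.b) :
    |S.K (fun t => S.corr w σ' t - S.corr w σ t) x| ≤ 2 * τ := by
  have hb := isBddDens_corr_sub hw hσ hσ' h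
  have hx' : x ∈ closure (Ioo S.a S.b) := by rwa [closure_Ioo S.hab.ne]
  refine le_on_closure (fun x hx => ?_) (continuous_K hb).abs.continuousOn continuousOn_const hx'
  obtain ⟨r, -, hr, hrK, -⟩ := hS.rem
  obtain ⟨r', -, hr', hrK', -⟩ := hS'.rem
  have hIcc := Ioo_subset_Icc_self hx
  have h1 := K_of_locBdd (hw.add hS.dens) hIcc (hS.locBdd x hx)
  have h2 := K_of_locBdd (hw.add hS'.dens) hIcc (hS'.locBdd x hx)
  have h3 := K_sub h2.1 h2.2.1 h1.1 h1.2.1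
  simp only [add_sub_add_left_eq_sub] at h3
  rw [h3, hrK x hx, hrK' x hx, add_sub_add_left_eq_sub]
  linarith [abs_sub (r' x) (r x), hr x hIcc, hr' x hIcc]

end PotSys

namespace PotSys

variable {S : PotSys}

/-- Only the first potential diverges at `x`. -/
def BadL (S : PotSys) (w : ℝ → ℝ) (x : ℝ) : Prop := ¬ PotConv S.k₁ w x ∧ PotConv S.k₂ w x

/-- Only the second potential diverges at `x`. -/
def BadR (S : PotSys) (w : ℝ → ℝ) (x : ℝ) : Prop := PotConv S.k₁ w x ∧ ¬ PotConv S.k₂ w x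

/-- `m` is an approximation of `w`, up to `τ`, whose potentials converge in the open interval. -/
structure Approx (S : PotSys) (w F : ℝ → ℝ) (τ : ℝ) (m : ℝ → ℝ) : Prop where
  dens : IsDens S.a S.b m
  close : ∫ t, |m t - w t| ≤ τ
  conv : ∀ x ∈ Ioo S.a S.b, PotConv S.k₁ m x ∧ PotConv S.k₂ m x
  rem : ∃ r : ℝ → ℝ, ContinuousOn r (Icc S.a S.b) ∧ (∀ x ∈ Icc S.a S.b, |r x| ≤ τ) ∧
    (∀ x ∈ Ioo S.a S.b, S.K m x = F x + r x) ∧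
    r S.a = S.K (fun t => m t - w t) S.a ∧ r S.b = S.K (fun t => m t - w t) S.b
  conv₁ : ∀ x, x = S.a ∨ x = S.b →
    PotConv S.k₁ (fun t => m t - w t) x ∧ |pot S.k₁ (fun t => m t - w t) x| ≤ τ
  conv₂ : ∀ x, x = S.a ∨ x = S.b →
    PotConv S.k₂ (fun t => m t - w t) x ∧ |pot S.k₂ (fun t => m t - w t) x| ≤ τ

/-- The potentials of `m` that diverge for `w` are small wherever the other one converges. -/
def Controlled (S : PotSys) (w : ℝ → ℝ) (τ : ℝ) (m : ℝ → ℝ) : Prop :=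
  (∀ x ∈ Ioo S.a S.b, S.BadL w x → S.κ₁ * |pot S.k₁ m x| ≤ τ) ∧
    ∀ x ∈ Ioo S.a S.b, S.BadR w x → S.κ₂ * |pot S.k₂ m x| ≤ τ

/-- The potentials of `m` are unbounded on the set where exactly one potential of `w` diverges. -/
def Uncontrolled (S : PotSys) (w m : ℝ → ℝ) : Prop :=
  ¬ BddAbove ((fun x => S.κ₁ * |pot S.k₁ m x|) '' {x ∈ Ioo S.a S.b | S.BadL w x ∨ S.BadR w x})

lemma Approx.mono {w F m : ℝ → ℝ} {τ τ' : ℝ} (h : S.Approx w F τ m) (hτ : τ ≤ τ') :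
    S.Approx w F τ' m := by
  obtain ⟨r, h1, h2, h3⟩ := h.rem
  exact ⟨h.dens, h.close.trans hτ, h.conv, ⟨r, h1, fun x hx => (h2 x hx).trans hτ, h3⟩,
    fun x hx => ⟨(h.conv₁ x hx).1, (h.conv₁ x hx).2.trans hτ⟩,
    fun x hx => ⟨(h.conv₂ x hx).1, (h.conv₂ x hx).2.trans hτ⟩⟩

lemma Smoothing.approx {w F : ℝ → ℝ} {τ : ℝ} {σ : ℕ → ℝ} (hw : IsDens S.a S.b w)
    (h : S.Smoothing w F τ σ) : S.Approx w F τ (fun t => w t + S.corr w σ t) where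
  dens := hw.add h.dens
  close := by simpa only [add_sub_cancel_left] using h.small
  conv x hx :=
    have h1 := K_of_locBdd (hw.add h.dens) (Ioo_subset_Icc_self hx) (h.locBdd x hx)
    ⟨h1.1, h1.2.1⟩
  rem := by simpa only [add_sub_cancel_left] using h.rem
  conv₁ := by simpa only [add_sub_cancel_left] using h.conv₁
  conv₂ := by simpa only [add_sub_cancel_left] using h.conv₂

lemma K_of_badL {w : ℝ → ℝ} {x : ℝ} (h : S.BadL w x) : S.K w x = -(S.κ₂ * pot S.k₂ w x) := by
  rw [K, pot_undef h.1]; ring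

lemma K_of_badR {w : ℝ → ℝ} {x : ℝ} (h : S.BadR w x) : S.K w x = S.κ₁ * pot S.k₁ w x := by
  rw [K, pot_undef h.2]; ring

lemma Approx.controlled_of_zero {w F m : ℝ → ℝ} {τ : ℝ} (h : S.Approx w F τ m)
    (hwF : ∀ x ∈ Icc S.a S.b, S.K w x = F x) (hκ₁ : 0 ≤ S.κ₁) (hκ₂ : 0 ≤ S.κ₂)
    (h0 : S.κ₁ = 0 ∨ S.κ₂ = 0) : S.Controlled w τ m := by
  obtain ⟨r, -, hr, hK, -⟩ := h.rem
  have hτ : 0 ≤ τ := (abs_nonneg _).trans (hr S.a ⟨le_rfl, S.hab.le⟩)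
  refine ⟨fun x hx hb => ?_, fun x hx hb => ?_⟩ <;> have h1 := hr x (Ioo_subset_Icc_self hx) <;>
    have h2 := hK x hx <;> rw [← hwF x (Ioo_subset_Icc_self hx)] at h2
  · rcases h0 with h0 | h0
    · rwa [h0, zero_mul]
    · rw [K_of_badL hb, K, h0] at h2
      rw [← abs_of_nonneg hκ₁, ← abs_mul]
      rw [zero_mul, zero_mul, sub_zero, neg_zero, zero_add] at h2
      rwa [h2]
  · rcases h0 with h0 | h0
    · rw [K_of_badR hb, K, h0] at h2
      rw [zero_mul, zero_mul, zero_sub, zero_add] at h2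
      rwa [← abs_of_nonneg hκ₂, ← abs_mul, ← abs_neg, h2]
    · rwa [h0, zero_mul]

/-- The averages over one-sided neighbourhoods converge in the potential norm `∫ |k (x₀ - t) · |`
wherever the potential converges. -/
def AvgClose (S : PotSys) (k : ℝ → ℝ) : Prop :=
  ∃ θ : ℝ, |θ| = 1 ∧ ∀ w, IsDens S.a S.b w → ∀ x₀ ∈ Ioo S.a S.b, PotConv k w x₀ →
    ∀ ε > 0, ∃ s₁ > 0, ∀ s ∈ Ioo 0 s₁,
      Integrable (fun t => k (x₀ - t) * (stek (θ * s) w t - w t)) ∧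
      ∫ t, |k (x₀ - t) * (stek (θ * s) w t - w t)| ≤ ε

lemma abs_pot_corr_le {w F k : ℝ → ℝ} {R x₀ τ C : ℝ} (hw : IsDens S.a S.b w) (hk : IsKer k R)
    (hav : S.AvgClose k) (hx₀ : x₀ ∈ Ioo S.a S.b) (hτ : 0 < τ) {s₀ σ : ℕ → ℝ}
    (hs₀ : ∀ n, 0 < s₀ n) (hσ : ∀ n, σ n ≠ 0 ∧ |σ n| < s₀ n)
    (hS : ∀ σ : ℕ → ℝ, (∀ k, σ k ≠ 0 ∧ |σ k| < s₀ k) → S.Smoothing w F τ σ)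
    (hC0 : 0 ≤ C)
    (hC : ∀ D, IsBddDens S.a S.b D → ∀ M, (∀ x ∈ Icc S.a S.b, |S.K D x| ≤ M) →
      ∀ x ∈ Icc S.a S.b, |pot k D x| ≤ C * (M + ∫ t, |D t|))
    (hc : PotConv k w x₀) :
    PotConv k (S.corr w σ) x₀ ∧ |pot k (S.corr w σ) x₀| ≤ (1 + 4 * C) * τ := by
  obtain ⟨θ, hθ, hav⟩ := hav
  obtain ⟨n, σ', hσ', hn, hc', hle⟩ := exists_steps_close hw hk hx₀ hτ hs₀ hσ
    (fun σ' h => (hS σ' h).piece) hθ (hav w hw x₀ hx₀ hc) hτ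
  have hb := isBddDens_corr_sub hw (fun i => (hσ i).1) (fun i => (hσ' i).1) hn
  have h1 := hC _ hb (2 * τ) (fun x hx => abs_K_corr_sub_le hw (fun i => (hσ i).1)
    (fun i => (hσ' i).1) hn (hS σ hσ) (hS σ' hσ') hx) x₀ (Ioo_subset_Icc_self hx₀)
  have h2 : ∫ t, |S.corr w σ' t - S.corr w σ t| ≤ 2 * τ := by
    have hi' := (hS σ' hσ').dens.int.abs
    have hi := (hS σ hσ).dens.int.abs
    calc ∫ t, |S.corr w σ' t - S.corr w σ t| ≤ ∫ t, (|S.corr w σ' t| + |S.corr w σ t|) :=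
          integral_mono hb.int.abs (hi'.add hi) fun t => abs_sub _ _
      _ = (∫ t, |S.corr w σ' t|) + ∫ t, |S.corr w σ t| := integral_add hi' hi
      _ ≤ 2 * τ := by linarith [(hS σ' hσ').small, (hS σ hσ).small]
  have h3 := hc'.sub (hb.potConv hk x₀)
  have h4 := pot_sub hc' (hb.potConv hk x₀)
  simp only [sub_sub_cancel] at h3 h4
  refine ⟨h3, ?_⟩
  rw [h4]
  refine (abs_sub _ _).trans ((add_le_add hle h1).trans ?_)
  have := mul_le_mul_of_nonneg_left h2 hC0
  linarith

lemma exists_approx_of_potBound {w F : ℝ → ℝ} (hw : IsDens S.a S.b w) (hF : Continuous F)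
    (hwF : ∀ x ∈ Icc S.a S.b, S.K w x = F x) (hκ₁ : 0 ≤ S.κ₁) (hκ₂ : 0 ≤ S.κ₂)
    (hB : S.PotBound) (h₁ : S.AvgClose S.k₁) (h₂ : S.AvgClose S.k₂) {τ : ℝ} (hτ : 0 < τ) :
    ∃ m, S.Approx w F τ m ∧ S.Controlled w τ m := by
  obtain ⟨C, hC0, hC⟩ := hB
  set A := 1 + (S.κ₁ + S.κ₂) * (1 + 4 * C)
  have hA : 1 ≤ A := by simp only [A]; nlinarith [mul_nonneg (add_nonneg hκ₁ hκ₂) hC0]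
  have hA0 : 0 < A := by linarith
  have hτ' : 0 < τ / A := by positivity
  obtain ⟨s₀, hs₀, hS⟩ := exists_smoothing hw hF hwF hτ'
  set σ : ℕ → ℝ := fun k => s₀ k / 2
  have hσ : ∀ n, σ n ≠ 0 ∧ |σ n| < s₀ n := fun n => by
    have := hs₀ n
    exact ⟨by positivity, by simp only [σ]; rw [abs_of_pos (by positivity)]; linarith⟩
  have hSσ := hS σ hσ
  have hap := hSσ.approx hw
  refine ⟨_, hap.mono (div_le_self hτ.le hA), ?_⟩
  obtain ⟨r, -, hr, hK, -⟩ := hap.rem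
  have hfin : τ / A + S.κ₁ * ((1 + 4 * C) * (τ / A)) + S.κ₂ * ((1 + 4 * C) * (τ / A)) = τ := by
    have : τ / A * A = τ := div_mul_cancel₀ _ hA0.ne'
    simp only [A] at this ⊢
    linarith
  have hC0' : 0 ≤ (1 + 4 * C) * (τ / A) := by positivity
  have hκ1' := mul_nonneg hκ₁ hC0'
  have hκ2' := mul_nonneg hκ₂ hC0'
  refine ⟨fun x hx hb => ?_, fun x hx hb => ?_⟩ <;> have h1 := hr x (Ioo_subset_Icc_self hx) <;>
    have h2 := hK x hx <;> rw [← hwF x (Ioo_subset_Icc_self hx)] at h2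
  · obtain ⟨h3, h4⟩ := abs_pot_corr_le hw S.ker₂ h₂ hx hτ' hs₀ hσ hS hC0
      (fun D hD M hM x hx => (hC D hD M hM x hx).2) hb.2
    rw [K_of_badL hb, K, pot_add hb.2 h3] at h2
    rw [← abs_of_nonneg hκ₁, ← abs_mul, show S.κ₁ * pot S.k₁ (fun t => w t + S.corr w σ t) x =
      r x + S.κ₂ * pot S.k₂ (S.corr w σ) x by linarith]
    refine (abs_add_le _ _).trans ?_
    rw [abs_mul, abs_of_nonneg hκ₂]
    linarith [mul_le_mul_of_nonneg_left h4 hκ₂]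
  · obtain ⟨h3, h4⟩ := abs_pot_corr_le hw S.ker₁ h₁ hx hτ' hs₀ hσ hS hC0
      (fun D hD M hM x hx => (hC D hD M hM x hx).1) hb.1
    rw [K_of_badR hb, K, pot_add hb.1 h3] at h2
    rw [← abs_of_nonneg hκ₂, ← abs_mul, show S.κ₂ * pot S.k₂ (fun t => w t + S.corr w σ t) x =
      S.κ₁ * pot S.k₁ (S.corr w σ) x - r x by linarith]
    refine (abs_sub _ _).trans ?_
    rw [abs_mul, abs_of_nonneg hκ₁]
    linarith [mul_le_mul_of_nonneg_left h4 hκ₁]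

lemma exists_approx {w F : ℝ → ℝ} (hw : IsDens S.a S.b w) (hF : Continuous F)
    (hwF : ∀ x ∈ Icc S.a S.b, S.K w x = F x) {τ : ℝ} (hτ : 0 < τ) :
    ∃ m, S.Approx w F τ m := by
  obtain ⟨s₀, hs₀, hS⟩ := exists_smoothing hw hF hwF hτ
  refine ⟨_, (hS (fun k => s₀ k / 2) fun n => ?_).approx hw⟩
  have := hs₀ n
  exact ⟨by positivity, by rw [abs_of_pos (by positivity)]; linarith⟩

end PotSys

/-- The potential system of the power kernels. -/
def powSys {a b α β : ℝ} (hab : a < b) (hα : α < 1) (hβ : β < 1) (κ₁ κ₂ : ℝ) : PotSys where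
  a := a
  b := b
  R := b - a + 1
  κ₁ := κ₁
  κ₂ := κ₂
  k₁ := powKer α (b - a + 1)
  k₂ := fun s => powKer β (b - a + 1) (-s)
  hab := hab
  hR := by linarith
  ker₁ := isKer_powKer hα (by linarith)
  ker₂ := (isKer_powKer hβ (by linarith)).reflect

section powSys

variable {a b α β : ℝ} {hab : a < b} {hα : α < 1} {hβ : β < 1} {κ₁ κ₂ : ℝ}

lemma avgClose_powSys_left (hα0 : 0 < α) :
    (powSys hab hα hβ κ₁ κ₂).AvgClose (powSys hab hα hβ κ₁ κ₂).k₁ := by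
  refine ⟨-1, by simp, fun w hw x₀ hx₀ hc ε hε => ?_⟩
  obtain ⟨s₀, hs₀, h⟩ := exists_stek_close hα0 hα (by linarith) hw.int
    (fun t ht => hw.supp t fun h => by
      have h1 : x₀ < b := hx₀.2
      have h2 : a ≤ t := h.1
      linarith) hc hε
  exact ⟨s₀, hs₀, fun s hs => by simpa only [neg_one_mul, powSys] using h s hs⟩

lemma avgClose_powSys_right (hβ0 : 0 < β) :
    (powSys hab hα hβ κ₁ κ₂).AvgClose (powSys hab hα hβ κ₁ κ₂).k₂ := by
  refine ⟨1, by simp, fun w hw x₀ hx₀ hc ε hε => ?_⟩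
  obtain ⟨s₀, hs₀, h⟩ := exists_stek_close_reflect hβ0 hβ (by linarith) hw.int
    (fun t ht => hw.supp t fun h => by
      have h1 : a < x₀ := hx₀.1
      have h2 : t ≤ b := h.2
      linarith) hc hε
  exact ⟨s₀, hs₀, fun s hs => by simpa only [one_mul, powSys] using h s hs⟩

lemma potBound_powSys (hα0 : 0 < α) (hβ0 : 0 < β) (hκ₁ : 0 < κ₁) (hκ₂ : 0 < κ₂) (hne : α ≠ β) :
    (powSys hab hα hβ κ₁ κ₂).PotBound := by
  rcases lt_or_gt_of_ne hne with h | h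
  · obtain ⟨C, hC0, hC⟩ := exists_pot_bound (R := b - a + 1) (a := a) (b := b) hα0 h hβ
      (by linarith) hab hκ₂ hκ₁.le
    refine ⟨κ₁⁻¹ * (1 + κ₂ * C) + C, by positivity, fun D hD M hM x hx => ?_⟩
    change IsBddDens a b D at hD
    change x ∈ Icc a b at hx
    have h2 : |pot (fun s => powKer β (b - a + 1) (-s)) D x| ≤ C * (M + ∫ t, |D t|) := by
      rw [pot_reflect _ _ (a + b)]
      have hi : ∫ t, |D (a + b - t)| = ∫ t, |D t| :=
        integral_sub_left_eq_self (fun t => |D t|) volume (a + b)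
      rw [← hi]
      refine hC _ hD.reflect M (fun z hz => ?_) _ ⟨by linarith [hx.2], by linarith [hx.1]⟩
      have := hM (a + b - z) ⟨by change a ≤ _; linarith [hz.2], by change _ ≤ b; linarith [hz.1]⟩
      simp only [PotSys.K, powSys] at this
      rw [pot_reflect _ _ (a + b), sub_sub_cancel, abs_sub_comm] at this
      rw [pot_reflect _ _ (a + b)]
      simpa using this
    have h1 := hM x hx
    have hM0 : 0 ≤ M := (abs_nonneg _).trans h1
    have hI : 0 ≤ ∫ t, |D t| := integral_nonneg fun t => abs_nonneg _
    simp only [PotSys.K, powSys] at h1 ⊢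
    set P := pot (powKer α (b - a + 1)) D x
    set Q := pot (fun s => powKer β (b - a + 1) (-s)) D x
    constructor
    · have h3 : |κ₁ * P| ≤ M + κ₂ * (C * (M + ∫ t, |D t|)) := by
        rw [show κ₁ * P = (κ₁ * P - κ₂ * Q) + κ₂ * Q by ring]
        refine (abs_add_le _ _).trans (add_le_add h1 ?_)
        rw [abs_mul, abs_of_pos hκ₂]; gcongr
      rw [abs_mul, abs_of_pos hκ₁] at h3
      have h4 : |P| ≤ κ₁⁻¹ * (M + κ₂ * (C * (M + ∫ t, |D t|))) := by
        rw [inv_mul_eq_div, le_div_iff₀ hκ₁]; linarith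
      refine h4.trans ?_
      have : 0 ≤ κ₁⁻¹ * ∫ t, |D t| := by positivity
      nlinarith [mul_nonneg hC0 (add_nonneg hM0 hI)]
    · refine h2.trans ?_
      gcongr
      have : 0 ≤ κ₁⁻¹ * (1 + κ₂ * C) := by positivity
      linarith
  · obtain ⟨C, hC0, hC⟩ := exists_pot_bound (R := b - a + 1) (a := a) (b := b) hβ0 h hα
      (by linarith) hab hκ₁ hκ₂.le
    refine ⟨κ₂⁻¹ * (1 + κ₁ * C) + C, by positivity, fun D hD M hM x hx => ?_⟩
    have h2 := hC D hD M hM x hx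
    have h1 := hM x hx
    have hM0 : 0 ≤ M := (abs_nonneg _).trans h1
    have hI : 0 ≤ ∫ t, |D t| := integral_nonneg fun t => abs_nonneg _
    simp only [PotSys.K, powSys] at h1 ⊢
    set P := pot (powKer α (b - a + 1)) D x
    set Q := pot (fun s => powKer β (b - a + 1) (-s)) D x
    constructor
    · refine h2.trans ?_
      gcongr
      have : 0 ≤ κ₂⁻¹ * (1 + κ₁ * C) := by positivity
      linarith
    · have h3 : |κ₂ * Q| ≤ M + κ₁ * (C * (M + ∫ t, |D t|)) := by
        rw [show κ₂ * Q = -(κ₁ * P - κ₂ * Q) + κ₁ * P by ring]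
        refine (abs_add_le _ _).trans (add_le_add (by rwa [abs_neg]) ?_)
        rw [abs_mul, abs_of_pos hκ₁]; gcongr
      rw [abs_mul, abs_of_pos hκ₂] at h3
      have h4 : |Q| ≤ κ₂⁻¹ * (M + κ₁ * (C * (M + ∫ t, |D t|))) := by
        rw [inv_mul_eq_div, le_div_iff₀ hκ₂]; linarith
      refine h4.trans ?_
      have : 0 ≤ κ₂⁻¹ * ∫ t, |D t| := by positivity
      nlinarith [mul_nonneg hC0 (add_nonneg hM0 hI)]

end powSys

/-- The truncated power `s₊ ^ (1 - α)`. -/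
def trPow (α s : ℝ) : ℝ := (max s 0) ^ (1 - α)

lemma trPow_mul {α ρ : ℝ} (hρ : 0 ≤ ρ) (s : ℝ) : trPow α (ρ * s) = ρ ^ (1 - α) * trPow α s := by
  rw [trPow, trPow, ← mul_rpow hρ (le_max_right _ _), mul_max_of_nonneg _ _ hρ, mul_zero]

lemma trPow_of_nonpos {α s : ℝ} (hα : α < 1) (hs : s ≤ 0) : trPow α s = 0 := by
  rw [trPow, max_eq_right hs, zero_rpow (by linarith)]

lemma trPow_of_nonneg {α s : ℝ} (hs : 0 ≤ s) : trPow α s = s ^ (1 - α) := by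
  rw [trPow, max_eq_left hs]

lemma trPow_mono {α s t : ℝ} (hα : α < 1) (h : s ≤ t) : trPow α s ≤ trPow α t :=
  rpow_le_rpow (le_max_right _ _) (max_le_max h le_rfl) (by linarith)

lemma integral_powKer_Iic_eq_trPow {α R c : ℝ} (hα : α < 1) (hc : c ≤ R) :
    ∫ s in Iic c, powKer α R s = trPow α c / (1 - α) := by
  rcases le_total 0 c with h | h
  · rw [integral_powKer_Iic hα ⟨h, hc⟩, trPow_of_nonneg h]
  · rw [trPow_of_nonpos hα h, zero_div]
    exact setIntegral_eq_zero_of_forall_eq_zero fun s hs => powKer_nonpos (le_trans hs h)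

lemma pot_box {α R c d x : ℝ} (hα : α < 1) (hR : 0 < R) (hcd : c ≤ d) (hc : x - c ≤ R) :
    pot (powKer α R) ((Ioc c d).indicator 1) x = (trPow α (x - c) - trPow α (x - d)) / (1 - α) := by
  have hi := (isKer_powKer hα hR).int
  have h1 : pot (powKer α R) ((Ioc c d).indicator 1) x = ∫ t in c..d, powKer α R (x - t) := by
    rw [intervalIntegral.integral_of_le hcd, ← integral_indicator measurableSet_Ioc, pot]
    congr 1; ext t
    by_cases ht : t ∈ Ioc c d <;> simp [ht]
  rw [h1, intervalIntegral.integral_comp_sub_left (fun s => powKer α R s),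
    ← intervalIntegral.integral_Iic_sub_Iic hi.integrableOn hi.integrableOn,
    integral_powKer_Iic_eq_trPow hα hc,
    integral_powKer_Iic_eq_trPow hα (by linarith), sub_div]

lemma pot_box_reflect {α R c d x : ℝ} (hα : α < 1) (hR : 0 < R) (hcd : c ≤ d) (hd : d - x ≤ R) :
    pot (fun s => powKer α R (-s)) ((Ioc c d).indicator 1) x =
      (trPow α (d - x) - trPow α (c - x)) / (1 - α) := by
  have hi := (isKer_powKer hα hR).int
  have h1 : pot (fun s => powKer α R (-s)) ((Ioc c d).indicator 1) x =
      ∫ t in c..d, powKer α R (t - x) := by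
    rw [intervalIntegral.integral_of_le hcd, ← integral_indicator measurableSet_Ioc, pot]
    congr 1; ext t
    by_cases ht : t ∈ Ioc c d <;> simp [ht]
  rw [h1, intervalIntegral.integral_comp_sub_right (fun s => powKer α R s),
    ← intervalIntegral.integral_Iic_sub_Iic hi.integrableOn hi.integrableOn,
    integral_powKer_Iic_eq_trPow hα hd,
    integral_powKer_Iic_eq_trPow hα (by linarith), sub_div]

lemma rpow_sub_rpow_le {α s t : ℝ} (hα0 : 0 < α) (hα : α < 1) (ht : 0 < t) (hts : t ≤ s) :
    s ^ (1 - α) - t ^ (1 - α) ≤ t ^ (-α) * (s - t) := by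
  have h1 : s ^ (1 - α) = t ^ (1 - α) * (1 + (s - t) / t) ^ (1 - α) := by
    rw [← mul_rpow ht.le (by have := div_nonneg (sub_nonneg.2 hts) ht.le; linarith)]
    congr 1; field_simp; ring
  have h2 := rpow_one_add_le_one_add_mul_self (s := (s - t) / t) (p := 1 - α)
    (by have := div_nonneg (sub_nonneg.2 hts) ht.le; linarith) (by linarith) (by linarith)
  have h3 : t ^ (1 - α) = t ^ (-α) * t := by
    rw [sub_eq_neg_add, rpow_add ht, rpow_one]
  have h4 : 0 < t ^ (-α) := rpow_pos_of_pos ht _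
  have h5 : 0 ≤ (s - t) / t := div_nonneg (sub_nonneg.2 hts) ht.le
  calc s ^ (1 - α) - t ^ (1 - α) ≤ t ^ (1 - α) * (1 + (1 - α) * ((s - t) / t)) - t ^ (1 - α) := by
        rw [h1]; gcongr
    _ = t ^ (1 - α) * ((1 - α) * ((s - t) / t)) := by ring
    _ ≤ t ^ (1 - α) * (1 * ((s - t) / t)) := by gcongr; linarith
    _ = t ^ (-α) * (s - t) := by rw [h3]; field_simp

lemma two_rpow_le {α : ℝ} (hα : α < 1) : (2 : ℝ) ^ α ≤ 2 := by
  simpa using rpow_le_rpow_of_exponent_le one_le_two hα.le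

lemma abs_trPow_sub_le {α s t : ℝ} (hα0 : 0 < α) (hα : α < 1) (hs : 1 / 2 ≤ s) (ht : 1 / 2 ≤ t) :
    |trPow α s - trPow α t| ≤ 2 * |s - t| := by
  wlog h : t ≤ s generalizing s t with H
  · rw [abs_sub_comm, abs_sub_comm s]; exact H ht hs (le_of_not_ge h)
  rw [abs_of_nonneg (sub_nonneg.2 (trPow_mono hα h)), abs_of_nonneg (sub_nonneg.2 h),
    trPow_of_nonneg (by linarith), trPow_of_nonneg (by linarith)]
  refine (rpow_sub_rpow_le hα0 hα (by linarith) h).trans ?_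
  refine mul_le_mul_of_nonneg_right ?_ (sub_nonneg.2 h)
  calc t ^ (-α) ≤ (1 / 2 : ℝ) ^ (-α) :=
        rpow_le_rpow_of_nonpos (by norm_num) ht (by linarith)
    _ = 2 ^ α := by rw [one_div, inv_rpow (by norm_num), rpow_neg (by norm_num), inv_inv]
    _ ≤ 2 := two_rpow_le hα

lemma trPow_succ_sub_le {α s : ℝ} (hα0 : 0 < α) (hα : α < 1) :
    trPow α (s + 1) - trPow α s ≤ 4 * (1 + |s|) ^ (-α) := by
  have hpos : 0 < (1 + |s|) ^ (-α) := rpow_pos_of_pos (by positivity) _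
  rcases le_or_gt s 1 with h | h
  · rcases le_or_gt s (-1) with h' | h'
    · rw [trPow_of_nonpos hα (by linarith), trPow_of_nonpos hα (by linarith)]; linarith
    · have h1 : trPow α (s + 1) ≤ 2 := by
        refine (trPow_mono hα (show s + 1 ≤ 2 by linarith)).trans ?_
        rw [trPow_of_nonneg (by norm_num)]
        exact two_rpow_le (by linarith)
      have h2 : 0 ≤ trPow α s := rpow_nonneg (le_max_right _ _) _
      have h3 : (1 / 2 : ℝ) ≤ (1 + |s|) ^ (-α) := by
        calc (1 / 2 : ℝ) ≤ (2 ^ α)⁻¹ := by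
              rw [one_div]; exact inv_anti₀ (by positivity) (two_rpow_le hα)
          _ = 2 ^ (-α) := by rw [rpow_neg (by norm_num)]
          _ ≤ (1 + |s|) ^ (-α) := rpow_le_rpow_of_nonpos (by positivity)
            (by have : |s| ≤ 1 := abs_le.2 ⟨h'.le, h⟩; linarith) (by linarith)
      linarith
  · rw [trPow_of_nonneg (by linarith), trPow_of_nonneg (by linarith), abs_of_pos (by linarith)]
    have h1 := rpow_sub_rpow_le hα0 hα (show 0 < s by linarith) (show s ≤ s + 1 by linarith)
    rw [add_sub_cancel_left, mul_one] at h1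
    refine h1.trans ?_
    calc s ^ (-α) ≤ ((1 + s) / 2) ^ (-α) :=
          rpow_le_rpow_of_nonpos (by linarith) (by linarith) (by linarith)
      _ = 2 ^ α * (1 + s) ^ (-α) := by
          rw [div_rpow (by linarith) (by norm_num), rpow_neg (by norm_num : (0:ℝ) ≤ 2), div_inv_eq_mul,
            mul_comm]
      _ ≤ 4 * (1 + s) ^ (-α) := by
          have := two_rpow_le hα
          have : 0 < (1 + s) ^ (-α) := rpow_pos_of_pos (by linarith) _
          gcongr; linarith

/-- The two-sided potential of a pair of boxes, up to normalization. -/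
def boxPot (α κ₁ κ₂ ξ : ℝ) : ℝ :=
  κ₁ * (κ₂ * (trPow α (ξ + 2) - trPow α (ξ + 1)) + κ₁ * (trPow α (ξ - 1) - trPow α (ξ - 2))) -
    κ₂ * (κ₂ * (trPow α (-1 - ξ) - trPow α (-2 - ξ)) + κ₁ * (trPow α (2 - ξ) - trPow α (1 - ξ)))

lemma abs_boxPot_le {α κ₁ κ₂ : ℝ} (hα0 : 0 < α) (hα : α < 1) (hκ₁ : 0 ≤ κ₁) (hκ₂ : 0 ≤ κ₂) (ξ : ℝ) :
    |boxPot α κ₁ κ₂ ξ| ≤ 144 * (κ₁ + κ₂) ^ 2 * (|ξ| ^ α / (1 + |ξ| ^ α) ^ 2) := by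
  have hX : 0 ≤ |ξ| ^ α := rpow_nonneg (abs_nonneg _) _
  rcases le_or_gt |ξ| (1 / 2) with h | h
  · have h' := abs_le.1 h
    have h1 := abs_trPow_sub_le hα0 hα (s := ξ + 2) (t := 2 - ξ) (by linarith) (by linarith)
    have h2 := abs_trPow_sub_le hα0 hα (s := 1 - ξ) (t := ξ + 1) (by linarith) (by linarith)
    rw [show ξ + 2 - (2 - ξ) = 2 * ξ by ring, abs_mul, abs_of_pos (by norm_num : (0:ℝ) < 2)] at h1
    rw [show 1 - ξ - (ξ + 1) = -(2 * ξ) by ring, abs_neg, abs_mul,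
      abs_of_pos (by norm_num : (0:ℝ) < 2)] at h2
    have h3 : boxPot α κ₁ κ₂ ξ = κ₁ * κ₂ * ((trPow α (ξ + 2) - trPow α (2 - ξ)) +
        (trPow α (1 - ξ) - trPow α (ξ + 1))) := by
      rw [boxPot, trPow_of_nonpos hα (show ξ - 1 ≤ 0 by linarith),
        trPow_of_nonpos hα (show ξ - 2 ≤ 0 by linarith),
        trPow_of_nonpos hα (show -1 - ξ ≤ 0 by linarith),
        trPow_of_nonpos hα (show -2 - ξ ≤ 0 by linarith)]
      ring
    have h4 : |ξ| ≤ |ξ| ^ α := by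
      simpa using rpow_le_rpow_of_exponent_ge' (abs_nonneg ξ) (by linarith) hα0.le hα.le
    have h5 : |ξ| ^ α ≤ 1 := rpow_le_one (abs_nonneg _) (by linarith) hα0.le
    have h6 : |ξ| ^ α / 4 ≤ |ξ| ^ α / (1 + |ξ| ^ α) ^ 2 :=
      div_le_div_of_nonneg_left hX (by positivity) (by nlinarith)
    rw [h3, abs_mul, abs_of_nonneg (mul_nonneg hκ₁ hκ₂)]
    calc κ₁ * κ₂ * |trPow α (ξ + 2) - trPow α (2 - ξ) + (trPow α (1 - ξ) - trPow α (ξ + 1))|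
        ≤ κ₁ * κ₂ * (8 * |ξ|) := by
          gcongr; exact (abs_add_le _ _).trans (by linarith)
      _ ≤ (κ₁ + κ₂) ^ 2 * (8 * |ξ| ^ α) := by
          gcongr; nlinarith
      _ ≤ (κ₁ + κ₂) ^ 2 * (144 * (|ξ| ^ α / (1 + |ξ| ^ α) ^ 2)) := by
          refine mul_le_mul_of_nonneg_left ?_ (by positivity)
          linarith
      _ = _ := by ring
  · have hu : 0 < |ξ| := by linarith
    set P := |ξ| ^ (-α)
    have hP : 0 < P := rpow_pos_of_pos hu _
    have hΔ : ∀ s, |ξ| - 2 ≤ |s| → 0 ≤ trPow α (s + 1) - trPow α s ∧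
        trPow α (s + 1) - trPow α s ≤ 16 * P := by
      intro s hs
      refine ⟨sub_nonneg.2 (trPow_mono hα (by linarith)), (trPow_succ_sub_le hα0 hα).trans ?_⟩
      have h1 : |ξ| / 4 ≤ 1 + |s| := by
        have := abs_nonneg s
        rcases le_total |ξ| 4 with h | h <;> linarith
      have h2 : (1 + |s|) ^ (-α) ≤ 4 * P := by
        calc (1 + |s|) ^ (-α) ≤ (|ξ| / 4) ^ (-α) :=
              rpow_le_rpow_of_nonpos (by positivity) h1 (by linarith)
          _ = 4 ^ α * P := by
              rw [div_rpow hu.le (by norm_num), rpow_neg (by norm_num : (0:ℝ) ≤ 4), div_inv_eq_mul,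
                mul_comm]
          _ ≤ 4 * P := by
              gcongr
              simpa using rpow_le_rpow_of_exponent_le (by norm_num : (1:ℝ) ≤ 4) hα.le
      linarith
    have e1 := hΔ (ξ + 1) (by
      have := abs_add_le (ξ + 1) (-1); simp at this; linarith)
    have e2 := hΔ (ξ - 2) (by
      have := abs_add_le (ξ - 2) 2; simp at this; linarith)
    have e3 := hΔ (-2 - ξ) (by
      have := abs_add_le (-2 - ξ) 2; rw [show -2 - ξ + 2 = -ξ by ring, abs_neg] at this
      norm_num at this; linarith)
    have e4 := hΔ (1 - ξ) (by
      have := abs_add_le (1 - ξ) (-1); rw [show 1 - ξ + -1 = -ξ by ring, abs_neg] at this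
      norm_num at this; linarith)
    rw [show ξ + 1 + 1 = ξ + 2 by ring] at e1
    rw [show ξ - 2 + 1 = ξ - 1 by ring] at e2
    rw [show -2 - ξ + 1 = -1 - ξ by ring] at e3
    rw [show 1 - ξ + 1 = 2 - ξ by ring] at e4
    have hbox : |boxPot α κ₁ κ₂ ξ| ≤ (κ₁ + κ₂) ^ 2 * (16 * P) := by
      have hA := mul_nonneg hκ₁ hκ₂
      have hB := mul_nonneg hκ₁ hκ₁
      have hC := mul_nonneg hκ₂ hκ₂
      rw [boxPot, abs_le]
      constructor <;> nlinarith [mul_nonneg hA e1.1, mul_nonneg hB e2.1, mul_nonneg hC e3.1,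
        mul_nonneg hA e4.1, mul_le_mul_of_nonneg_left e1.2 hA, mul_le_mul_of_nonneg_left e2.2 hB,
        mul_le_mul_of_nonneg_left e3.2 hC, mul_le_mul_of_nonneg_left e4.2 hA]
    refine hbox.trans ?_
    have hPX : P * |ξ| ^ α = 1 := by
      simp only [P]; rw [← rpow_add hu]; simp
    have hXh : (1 / 2 : ℝ) ≤ |ξ| ^ α := by
      calc (1 / 2 : ℝ) ≤ (1 / 2) ^ α := by
            simpa using rpow_le_rpow_of_exponent_ge (by norm_num : (0:ℝ) < 1 / 2) (by norm_num) hα.le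
        _ ≤ |ξ| ^ α := rpow_le_rpow (by norm_num) h.le hα0.le
    have hfin : P ≤ 9 * (|ξ| ^ α / (1 + |ξ| ^ α) ^ 2) := by
      rw [← mul_div_assoc, le_div_iff₀ (by positivity)]
      calc P * (1 + |ξ| ^ α) ^ 2 ≤ P * (3 * |ξ| ^ α) ^ 2 := by gcongr; linarith
        _ = 9 * (P * |ξ| ^ α) * |ξ| ^ α := by ring
        _ = 9 * |ξ| ^ α := by rw [hPX]; ring
    calc (κ₁ + κ₂) ^ 2 * (16 * P) ≤ (κ₁ + κ₂) ^ 2 * (16 * (9 * (|ξ| ^ α / (1 + |ξ| ^ α) ^ 2))) := by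
          gcongr
      _ = _ := by ring

lemma sum_dyadic_le {α : ℝ} (hα0 : 0 < α) (n : ℕ) {u : ℝ} (hu : 0 ≤ u) :
    ∑ j ∈ Finset.range n, (2 ^ j * u) ^ α / (1 + (2 ^ j * u) ^ α) ^ 2 ≤
      2 ^ α / (2 ^ α - 1) := by
  have hq : (1 : ℝ) < 2 ^ α := one_lt_rpow one_lt_two hα0
  set q : ℝ := 2 ^ α
  set X : ℕ → ℝ := fun j => (2 ^ j * u) ^ α
  have hX : ∀ j, 0 ≤ X j := fun j => rpow_nonneg (by positivity) _
  have hXs : ∀ j, X (j + 1) = q * X j := fun j => by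
    simp only [X, q]
    rw [← mul_rpow (by norm_num) (by positivity)]
    congr 1; ring
  have hstep : ∀ j, X j / (1 + X j) ^ 2 ≤
      q / (q - 1) * ((1 + X j)⁻¹ - (1 + X (j + 1))⁻¹) := fun j => by
    have h0 := hX j
    have h1 : 0 < 1 + q * X j := by positivity
    have h2 : q / (q - 1) * ((1 + X j)⁻¹ - (1 + q * X j)⁻¹) =
        q * X j / ((1 + X j) * (1 + q * X j)) := by
      have h3 : q - 1 ≠ 0 := by linarith
      have h4 : 1 + X j ≠ 0 := by positivity
      field_simp
      ring
    rw [hXs, h2, div_le_div_iff₀ (by positivity) (by positivity)]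
    nlinarith [mul_nonneg h0 h0, mul_nonneg (mul_nonneg h0 h0) h0]
  refine (Finset.sum_le_sum fun j _ => hstep j).trans ?_
  rw [← Finset.mul_sum, Finset.sum_range_sub' (fun j => (1 + X j)⁻¹)]
  refine mul_le_of_le_one_right (div_nonneg (by linarith) (by linarith)) ?_
  have h1 : (1 + X 0)⁻¹ ≤ 1 := inv_le_one_of_one_le₀ (by linarith [hX 0])
  have h2 : 0 ≤ (1 + X n)⁻¹ := inv_nonneg.2 (by linarith [hX n])
  linarith

lemma isBddDens_box {a b c d : ℝ} (hc : a ≤ c) (hd : d ≤ b) :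
    IsBddDens a b ((Ioc c d).indicator 1) := by
  refine ⟨⟨?_, fun t ht => ?_⟩, 1, zero_le_one, fun t => ?_⟩
  · exact (integrable_indicator_iff measurableSet_Ioc).2 (integrableOn_const (by simp))
  · exact indicator_of_notMem (fun h => ht ⟨hc.trans h.1.le, h.2.trans hd⟩) _
  · by_cases h : t ∈ Ioc c d <;> simp [h]

lemma integral_abs_box {c d : ℝ} (hcd : c ≤ d) :
    ∫ t, |(Ioc c d).indicator (1 : ℝ → ℝ) t| = d - c := by
  have : ∀ t, |(Ioc c d).indicator (1 : ℝ → ℝ) t| = (Ioc c d).indicator (1 : ℝ → ℝ) t := fun t =>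
    abs_of_nonneg (indicator_nonneg (fun _ _ => zero_le_one) t)
  simp only [this]
  rw [integral_indicator measurableSet_Ioc]
  simp [hcd]

/-- A pair of boxes at distance `ρ` from `x₀`, normalized so that its potentials are scale
invariant. -/
def boxPair (α κ₁ κ₂ x₀ ρ t : ℝ) : ℝ :=
  ρ ^ (α - 1) * (κ₂ * (Ioc (x₀ - 2 * ρ) (x₀ - ρ)).indicator 1 t +
    κ₁ * (Ioc (x₀ + ρ) (x₀ + 2 * ρ)).indicator 1 t)

section boxPair

variable {a b α κ₁ κ₂ x₀ ρ : ℝ}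

lemma isBddDens_boxPair (hρ : 0 < ρ) (ha : a ≤ x₀ - 2 * ρ) (hb : x₀ + 2 * ρ ≤ b) :
    IsBddDens a b (boxPair α κ₁ κ₂ x₀ ρ) :=
  (((isBddDens_box ha (by linarith)).const_mul κ₂).add
    ((isBddDens_box (by linarith) hb).const_mul κ₁)).const_mul _

lemma boxPair_eq_zero (hρ : 0 < ρ) {t : ℝ} (ht : 2 * ρ < |t - x₀|) :
    boxPair α κ₁ κ₂ x₀ ρ t = 0 := by
  have h1 : t ∉ Ioc (x₀ - 2 * ρ) (x₀ - ρ) := fun h =>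
    absurd ht (not_lt.2 (abs_le.2 ⟨by linarith [h.1], by linarith [h.2]⟩))
  have h2 : t ∉ Ioc (x₀ + ρ) (x₀ + 2 * ρ) := fun h =>
    absurd ht (not_lt.2 (abs_le.2 ⟨by linarith [h.1], by linarith [h.2]⟩))
  simp [boxPair, h1, h2]

lemma integral_abs_boxPair_le (hκ₁ : 0 ≤ κ₁) (hκ₂ : 0 ≤ κ₂) (hρ : 0 < ρ) :
    ∫ t, |boxPair α κ₁ κ₂ x₀ ρ t| ≤ (κ₁ + κ₂) * ρ ^ α := by
  have hi : ∀ c d : ℝ, Integrable fun t => |(Ioc c d).indicator (1 : ℝ → ℝ) t| := fun c d =>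
    (isBddDens_box (a := c) (b := d) le_rfl le_rfl).int.abs
  have hp : 0 < ρ ^ (α - 1) := rpow_pos_of_pos hρ _
  set u := (Ioc (x₀ - 2 * ρ) (x₀ - ρ)).indicator (1 : ℝ → ℝ)
  set v := (Ioc (x₀ + ρ) (x₀ + 2 * ρ)).indicator (1 : ℝ → ℝ)
  have hu : Integrable u := (isBddDens_box (a := x₀ - 2 * ρ) (b := x₀ - ρ) le_rfl le_rfl).int
  have hv : Integrable v := (isBddDens_box (a := x₀ + ρ) (b := x₀ + 2 * ρ) le_rfl le_rfl).int
  calc ∫ t, |boxPair α κ₁ κ₂ x₀ ρ t| ≤ ∫ t, ρ ^ (α - 1) * (κ₂ * |u t| + κ₁ * |v t|) := by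
        refine integral_mono ?_ ?_ fun t => ?_
        · exact (((hu.const_mul κ₂).add (hv.const_mul κ₁)).const_mul _).abs
        · exact ((hu.abs.const_mul κ₂).add (hv.abs.const_mul κ₁)).const_mul _
        · simp only [boxPair]
          rw [abs_mul, abs_of_pos hp]
          gcongr
          refine (abs_add_le _ _).trans ?_
          rw [abs_mul, abs_mul, abs_of_nonneg hκ₁, abs_of_nonneg hκ₂]
    _ = ρ ^ (α - 1) * (κ₂ * (x₀ - ρ - (x₀ - 2 * ρ)) + κ₁ * (x₀ + 2 * ρ - (x₀ + ρ))) := by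
        rw [integral_const_mul, integral_add (hu.abs.const_mul κ₂) (hv.abs.const_mul κ₁),
          integral_const_mul, integral_const_mul, integral_abs_box (by linarith),
          integral_abs_box (by linarith)]
    _ = (κ₁ + κ₂) * (ρ ^ (α - 1) * ρ) := by ring
    _ = (κ₁ + κ₂) * ρ ^ α := by
        rw [← rpow_add_one hρ.ne', sub_add_cancel]

lemma pot_boxPair {k : ℝ → ℝ} {R : ℝ} (hk : IsKer k R) (x : ℝ) :
    pot k (boxPair α κ₁ κ₂ x₀ ρ) x = ρ ^ (α - 1) *
      (κ₂ * pot k ((Ioc (x₀ - 2 * ρ) (x₀ - ρ)).indicator 1) x +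
        κ₁ * pot k ((Ioc (x₀ + ρ) (x₀ + 2 * ρ)).indicator 1) x) := by
  have hu := isBddDens_box (c := x₀ - 2 * ρ) (d := x₀ - ρ) le_rfl le_rfl
  have hv := isBddDens_box (c := x₀ + ρ) (d := x₀ + 2 * ρ) le_rfl le_rfl
  unfold boxPair
  rw [pot_const_mul, pot_add ((hu.potConv hk x).const_mul _) ((hv.potConv hk x).const_mul _),
    pot_const_mul, pot_const_mul]

lemma trPow_div_eq {α ρ s : ℝ} (hρ : 0 < ρ) : ρ ^ (α - 1) * trPow α s = trPow α (s / ρ) := by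
  have : s = ρ * (s / ρ) := by field_simp
  rw [this, trPow_mul hρ.le, ← mul_assoc, ← rpow_add hρ]
  simp [hρ.ne']

lemma pot_boxPair_left {R x : ℝ} (hα : α < 1) (hR : 0 < R) (hρ : 0 < ρ)
    (hx : x - (x₀ - 2 * ρ) ≤ R) :
    pot (powKer α R) (boxPair α κ₁ κ₂ x₀ ρ) x =
      (κ₂ * (trPow α ((x - x₀) / ρ + 2) - trPow α ((x - x₀) / ρ + 1)) +
        κ₁ * (trPow α ((x - x₀) / ρ - 1) - trPow α ((x - x₀) / ρ - 2))) / (1 - α) := by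
  rw [pot_boxPair (isKer_powKer hα hR), pot_box hα hR (by linarith) hx,
    pot_box hα hR (by linarith) (by linarith),
    show (x - x₀) / ρ + 2 = (x - (x₀ - 2 * ρ)) / ρ by field_simp; ring,
    show (x - x₀) / ρ + 1 = (x - (x₀ - ρ)) / ρ by field_simp; ring,
    show (x - x₀) / ρ - 1 = (x - (x₀ + ρ)) / ρ by field_simp; ring,
    show (x - x₀) / ρ - 2 = (x - (x₀ + 2 * ρ)) / ρ by field_simp; ring,
    ← trPow_div_eq hρ, ← trPow_div_eq hρ, ← trPow_div_eq hρ, ← trPow_div_eq hρ]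
  ring

lemma pot_boxPair_right {R x : ℝ} (hα : α < 1) (hR : 0 < R) (hρ : 0 < ρ)
    (hx : x₀ + 2 * ρ - x ≤ R) :
    pot (fun s => powKer α R (-s)) (boxPair α κ₁ κ₂ x₀ ρ) x =
      (κ₂ * (trPow α (-1 - (x - x₀) / ρ) - trPow α (-2 - (x - x₀) / ρ)) +
        κ₁ * (trPow α (2 - (x - x₀) / ρ) - trPow α (1 - (x - x₀) / ρ))) / (1 - α) := by
  rw [pot_boxPair (isKer_powKer hα hR).reflect, pot_box_reflect hα hR (by linarith) (by linarith),
    pot_box_reflect hα hR (by linarith) hx,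
    show -1 - (x - x₀) / ρ = (x₀ - ρ - x) / ρ by field_simp; ring,
    show -2 - (x - x₀) / ρ = (x₀ - 2 * ρ - x) / ρ by field_simp; ring,
    show 2 - (x - x₀) / ρ = (x₀ + 2 * ρ - x) / ρ by field_simp; ring,
    show 1 - (x - x₀) / ρ = (x₀ + ρ - x) / ρ by field_simp; ring,
    ← trPow_div_eq hρ, ← trPow_div_eq hρ, ← trPow_div_eq hρ, ← trPow_div_eq hρ]
  ring

end boxPair

lemma pot_sum {ι : Type*} (s : Finset ι) {k : ℝ → ℝ} {u : ι → ℝ → ℝ} {x : ℝ}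
    (hu : ∀ i, PotConv k (u i) x) :
    pot k (fun t => ∑ i ∈ s, u i t) x = ∑ i ∈ s, pot k (u i) x := by
  simp only [pot, Finset.mul_sum]
  exact integral_finsetSum s fun i _ => hu i

namespace PotSys

/-- One-sided potentials of bounded densities with small two-sided potential and small mass can be
prescribed at any point. -/
def HasSpikes (S : PotSys) : Prop :=
  ∀ x₀ ∈ Ioo S.a S.b, ∀ A : ℝ, ∀ τ > 0, ∀ ρ > 0, ∃ ω, IsBddDens S.a S.b ω ∧
    (∀ t, ρ ≤ |t - x₀| → ω t = 0) ∧ ∫ t, |ω t| ≤ τ ∧ (∀ x ∈ Icc S.a S.b, |S.K ω x| ≤ τ) ∧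
    pot S.k₁ ω x₀ = A

end PotSys

lemma hasSpikes_powSys {a b α κ₁ κ₂ : ℝ} {hab : a < b} {hα : α < 1} (hα0 : 0 < α) (hκ₁ : 0 < κ₁)
    (hκ₂ : 0 < κ₂) : (powSys hab hα hα κ₁ κ₂).HasSpikes := by
  intro x₀ hx₀ A τ hτ ρ hρ
  change x₀ ∈ Ioo a b at hx₀
  set g : ℝ := κ₂ * (2 ^ (1 - α) - 1) / (1 - α)
  have hg : 0 < g := by
    have : (1 : ℝ) < 2 ^ (1 - α) := one_lt_rpow one_lt_two (by linarith)
    have h2 : 0 < 1 - α := by linarith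
    have h3 : 0 < (2 : ℝ) ^ (1 - α) - 1 := by linarith
    positivity
  obtain ⟨ρ₁, hρ₁, hρ₁ρ, hρ₁a, hρ₁b, hρ₁m⟩ : ∃ ρ₁ > 0, 2 * ρ₁ < ρ ∧ 2 * ρ₁ < x₀ - a ∧
      2 * ρ₁ < b - x₀ ∧ |A| / g * ((κ₁ + κ₂) * ρ₁ ^ α) ≤ τ := by
    have h1 : Tendsto (fun r : ℝ => |A| / g * ((κ₁ + κ₂) * r ^ α)) (𝓝[>] 0) (𝓝 0) := by
      have : ContinuousAt (fun r : ℝ => |A| / g * ((κ₁ + κ₂) * r ^ α)) 0 :=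
        ((continuousAt_rpow_const 0 α (Or.inr hα0.le)).const_mul _).const_mul _
      have h := this.tendsto
      simp only [zero_rpow hα0.ne', mul_zero] at h
      exact h.mono_left nhdsWithin_le_nhds
    have h2 := h1.eventually (ge_mem_nhds hτ)
    have h3 : ∀ c > (0 : ℝ), ∀ᶠ r in 𝓝[>] (0 : ℝ), 2 * r < c := fun c hc => by
      filter_upwards [Ioo_mem_nhdsGT (half_pos hc)] with r hr
      linarith [hr.2]
    have h0 : ∀ᶠ r in 𝓝[>] (0 : ℝ), 0 < r := self_mem_nhdsWithin
    obtain ⟨r, h4, h5, h6, h7, h8⟩ := (h0.and ((h3 ρ hρ).and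
      ((h3 (x₀ - a) (by linarith [hx₀.1])).and ((h3 (b - x₀) (by linarith [hx₀.2])).and h2)))).exists
    exact ⟨r, h4, h5, h6, h7, h8⟩
  set c₀ := 144 * (κ₁ + κ₂) ^ 2 * (2 ^ α / (2 ^ α - 1)) / (1 - α)
  obtain ⟨n, hn⟩ := exists_nat_gt (|A| / g * c₀ / τ)
  have hc₀ : 0 ≤ c₀ := by
    have : (1 : ℝ) < 2 ^ α := one_lt_rpow one_lt_two hα0
    have h2 : 0 < 1 - α := by linarith
    have h3 : 0 < (2 : ℝ) ^ α - 1 := by linarith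
    positivity
  have hn0 : (0 : ℝ) < n := lt_of_le_of_lt (by positivity) hn
  set r : ℕ → ℝ := fun j => ρ₁ / 2 ^ j
  have hr : ∀ j, 0 < r j := fun j => by positivity
  have hrle : ∀ j, r j ≤ ρ₁ := fun j => div_le_self hρ₁.le (one_le_pow₀ one_le_two)
  set S := powSys hab hα hα κ₁ κ₂
  set φ : ℕ → ℝ → ℝ := fun j => boxPair α κ₁ κ₂ x₀ (r j)
  have hφ : ∀ j, IsBddDens a b (φ j) := fun j => isBddDens_boxPair (hr j)
    (by linarith [hrle j]) (by linarith [hrle j])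
  have hR : 0 < b - a + 1 := by linarith
  have hp₁ : ∀ j, ∀ x ∈ Icc a b, pot S.k₁ (φ j) x = _ := fun j x hx =>
    pot_boxPair_left (x := x) (κ₁ := κ₁) (κ₂ := κ₂) (x₀ := x₀) (ρ := r j) hα hR (hr j)
      (by linarith [hx.2, hrle j])
  have hp₂ : ∀ j, ∀ x ∈ Icc a b, pot S.k₂ (φ j) x = _ := fun j x hx =>
    pot_boxPair_right (x := x) (κ₁ := κ₁) (κ₂ := κ₂) (x₀ := x₀) (ρ := r j) hα hR (hr j)
      (by linarith [hx.1, hrle j])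
  have hK : ∀ j, ∀ x ∈ Icc a b, S.κ₁ * pot S.k₁ (φ j) x - S.κ₂ * pot S.k₂ (φ j) x =
      boxPot α κ₁ κ₂ ((x - x₀) / r j) / (1 - α) := fun j x hx => by
    rw [hp₁ j x hx, hp₂ j x hx, boxPot]
    simp only [S, powSys]
    ring
  have hx₀' : x₀ ∈ Icc a b := Ioo_subset_Icc_self hx₀
  have hp0 : ∀ j, pot S.k₁ (φ j) x₀ = g := fun j => by
    rw [hp₁ j x₀ hx₀', sub_self, zero_div, zero_add, zero_add, zero_sub, zero_sub,
      trPow_of_nonneg (by norm_num : (0:ℝ) ≤ 2), trPow_of_nonneg (by norm_num : (0:ℝ) ≤ 1),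
      one_rpow, trPow_of_nonpos hα (by norm_num), trPow_of_nonpos hα (by norm_num), sub_self,
      mul_zero, add_zero]
  have hc₁ : ∀ j x, PotConv S.k₁ (φ j) x := fun j x => (hφ j).potConv S.ker₁ x
  have hc₂ : ∀ j x, PotConv S.k₂ (φ j) x := fun j x => (hφ j).potConv S.ker₂ x
  set c := A / (n * g)
  have hcabs : |c| = |A| / (n * g) := by
    simp only [c]; rw [abs_div, abs_of_pos (a := n * g) (by positivity)]
  have hsum := isBddDens_sum (Finset.range n) hφ
  refine ⟨fun t => c * ∑ j ∈ Finset.range n, φ j t, hsum.const_mul c, fun t ht => ?_, ?_,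
    fun x hx => ?_, ?_⟩
  · change c * ∑ j ∈ Finset.range n, φ j t = 0
    rw [Finset.sum_eq_zero, mul_zero]
    intro j _
    exact boxPair_eq_zero (hr j) (by linarith [hrle j])
  · simp only [abs_mul]
    rw [integral_const_mul, hcabs]
    have h1 : ∫ t, |∑ j ∈ Finset.range n, φ j t| ≤ n * ((κ₁ + κ₂) * ρ₁ ^ α) := by
      calc ∫ t, |∑ j ∈ Finset.range n, φ j t| ≤ ∫ t, ∑ j ∈ Finset.range n, |φ j t| :=
            integral_mono hsum.int.abs (integrable_finsetSum _ fun j _ => (hφ j).int.abs)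
              fun t => Finset.abs_sum_le_sum_abs _ _
        _ = ∑ j ∈ Finset.range n, ∫ t, |φ j t| :=
            integral_finsetSum _ fun j _ => (hφ j).int.abs
        _ ≤ ∑ j ∈ Finset.range n, (κ₁ + κ₂) * ρ₁ ^ α := by
            refine Finset.sum_le_sum fun j _ => (integral_abs_boxPair_le hκ₁.le hκ₂.le (hr j)).trans ?_
            have := rpow_le_rpow (hr j).le (hrle j) hα0.le
            gcongr
        _ = n * ((κ₁ + κ₂) * ρ₁ ^ α) := by simp
    calc |A| / (n * g) * ∫ t, |∑ j ∈ Finset.range n, φ j t|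
        ≤ |A| / (n * g) * (n * ((κ₁ + κ₂) * ρ₁ ^ α)) := by gcongr
      _ = |A| / g * ((κ₁ + κ₂) * ρ₁ ^ α) := by field_simp
      _ ≤ τ := hρ₁m
  · rw [PotSys.K_const_mul, PotSys.K, pot_sum _ fun j => hc₁ j x, pot_sum _ fun j => hc₂ j x,
      Finset.mul_sum, Finset.mul_sum, ← Finset.sum_sub_distrib,
      Finset.sum_congr rfl fun j _ => hK j x hx, abs_mul, hcabs]
    have h1α : 0 < 1 - α := by linarith
    have h1 : |∑ j ∈ Finset.range n, boxPot α κ₁ κ₂ ((x - x₀) / r j) / (1 - α)| ≤ c₀ := by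
      refine (Finset.abs_sum_le_sum_abs _ _).trans ?_
      calc ∑ j ∈ Finset.range n, |boxPot α κ₁ κ₂ ((x - x₀) / r j) / (1 - α)|
          ≤ ∑ j ∈ Finset.range n, 144 * (κ₁ + κ₂) ^ 2 * ((2 ^ j * (|x - x₀| / ρ₁)) ^ α /
              (1 + (2 ^ j * (|x - x₀| / ρ₁)) ^ α) ^ 2) / (1 - α) := by
            refine Finset.sum_le_sum fun j _ => ?_
            rw [abs_div, abs_of_pos h1α]
            have h2 := abs_boxPot_le hα0 hα hκ₁.le hκ₂.le ((x - x₀) / r j)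
            rw [abs_div, abs_of_pos (hr j),
              show |x - x₀| / r j = 2 ^ j * (|x - x₀| / ρ₁) by simp only [r]; field_simp] at h2
            gcongr
        _ = 144 * (κ₁ + κ₂) ^ 2 * (∑ j ∈ Finset.range n, (2 ^ j * (|x - x₀| / ρ₁)) ^ α /
              (1 + (2 ^ j * (|x - x₀| / ρ₁)) ^ α) ^ 2) / (1 - α) := by
            rw [← Finset.sum_div, ← Finset.mul_sum]
        _ ≤ c₀ := by
            have := sum_dyadic_le hα0 n (u := |x - x₀| / ρ₁) (by positivity)
            simp only [c₀]
            gcongr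
    calc |A| / (n * g) * |∑ j ∈ Finset.range n, boxPot α κ₁ κ₂ ((x - x₀) / r j) / (1 - α)|
        ≤ |A| / (n * g) * c₀ := by gcongr
      _ = |A| / g * c₀ / n := by field_simp
      _ ≤ τ := by
          rw [div_le_iff₀ hn0]
          rw [div_lt_iff₀ hτ] at hn
          linarith
  · rw [pot_const_mul, pot_sum _ fun j => hc₁ j x₀, Finset.sum_congr rfl fun j _ => hp0 j]
    simp only [Finset.sum_const, Finset.card_range, nsmul_eq_mul, c]
    field_simp

lemma integral_abs_pot_far_le {k ω : ℝ → ℝ} {C ρ x x₀ : ℝ} (hω : Integrable ω)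
    (hC : ∀ s, |k s| * |s| ≤ C) (hρ : 0 < ρ) (hs : ∀ t, ρ ≤ |t - x₀| → ω t = 0)
    (hx : 2 * ρ ≤ |x - x₀|) : ∫ t, |k (x - t) * ω t| ≤ C / ρ * ∫ t, |ω t| := by
  have hC0 : 0 ≤ C := (mul_nonneg (abs_nonneg _) (abs_nonneg _)).trans (hC 0)
  rw [← integral_const_mul]
  refine integral_mono_of_nonneg (.of_forall fun t => abs_nonneg _) (hω.abs.const_mul _)
    (.of_forall fun t => ?_)
  change |k (x - t) * ω t| ≤ C / ρ * |ω t|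
  rcases le_or_gt ρ |t - x₀| with h | h
  · simp [hs t h]
  · rw [abs_mul]
    refine mul_le_mul_of_nonneg_right ?_ (abs_nonneg _)
    rw [le_div_iff₀ hρ]
    refine le_trans ?_ (hC (x - t))
    refine mul_le_mul_of_nonneg_left ?_ (abs_nonneg _)
    have := abs_sub_le x t x₀
    linarith

namespace PotSys

variable {S : PotSys}

/-- One-sided potentials can be prescribed, up to a small error, on a countable set of isolated
points. -/
lemma HasSpikes.exists_isolated (hS : S.HasSpikes) {P : Set ℝ} (hP : P ⊆ Ioo S.a S.b)
    {f : P → ℕ} (hf : Function.Injective f)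
    (hiso : ∀ p ∈ P, ∃ ρ > 0, ∀ q ∈ P, q ≠ p → ρ ≤ |q - p|) (A : ℝ → ℝ) {τ : ℝ} (hτ : 0 < τ) :
    ∃ ω, IsDens S.a S.b ω ∧ ∫ t, |ω t| ≤ τ ∧ (∀ x, PotConv S.k₁ ω x ∧ PotConv S.k₂ ω x) ∧
      ContinuousOn (S.K ω) (Icc S.a S.b) ∧ (∀ x ∈ Icc S.a S.b, |S.K ω x| ≤ τ) ∧
      (∀ x, x = S.a ∨ x = S.b → |pot S.k₁ ω x| ≤ τ ∧ |pot S.k₂ ω x| ≤ τ) ∧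
      ∀ p ∈ P, |pot S.k₁ ω p - A p| ≤ τ := by
  obtain ⟨C₁, hC₁0, hC₁⟩ := S.ker₁.bound
  obtain ⟨C₂, hC₂0, hC₂⟩ := S.ker₂.bound
  have hrad : ∀ p : P, ∃ ρ > 0, (∀ q : P, q ≠ p → 4 * ρ ≤ |(q : ℝ) - p|) ∧ 2 * ρ ≤ p - S.a ∧
      2 * ρ ≤ S.b - p := fun p => by
    obtain ⟨ρ, hρ, h⟩ := hiso p p.2
    have h1 : 0 < (p : ℝ) - S.a := by linarith [(hP p.2).1]
    have h2 : 0 < S.b - p := by linarith [(hP p.2).2]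
    have h3 := min_le_left ρ (min ((p : ℝ) - S.a) (S.b - p))
    have h4 := min_le_right ρ (min ((p : ℝ) - S.a) (S.b - p))
    have h5 := min_le_left ((p : ℝ) - S.a) (S.b - p)
    have h6 := min_le_right ((p : ℝ) - S.a) (S.b - p)
    have h0 : 0 < min ρ (min ((p : ℝ) - S.a) (S.b - p)) := lt_min hρ (lt_min h1 h2)
    refine ⟨min ρ (min ((p : ℝ) - S.a) (S.b - p)) / 4, by linarith, fun q hq => ?_, by linarith,
      by linarith⟩
    have := h q q.2 fun h => hq (Subtype.ext h)
    linarith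
  choose ρ hρ hsep hρa hρb using hrad
  set N : ℕ → ℝ → Prop := fun n x => ∃ p : P, f p = n ∧ |x - p| < 2 * ρ p
  have hN : ∀ x m n, N m x → N n x → m = n := by
    rintro x _ _ ⟨p, rfl, hp⟩ ⟨q, rfl, hq⟩
    by_contra hne
    have hpq : p ≠ q := fun h => hne (by rw [h])
    have h1 := hsep p q hpq.symm
    have h2 := hsep q p hpq
    rw [abs_sub_comm] at h1
    have h3 := abs_sub_le (p : ℝ) x q
    rw [abs_sub_comm (p : ℝ) x] at h3
    linarith
  have hNe : ∀ n x, x = S.a ∨ x = S.b → ¬ N n x := by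
    rintro n x hx ⟨p, -, hp⟩
    have h1 := hρa p
    have h2 := hρb p
    rcases hx with rfl | rfl
    · linarith [neg_le_abs (S.a - (p : ℝ))]
    · linarith [le_abs_self (S.b - (p : ℝ))]
  set T : ℕ → ℝ := fun n => τ / 2 / 2 ^ n
  have hT : ∀ n, 0 < T n := fun n => by positivity
  have hTs : HasSum T τ := hasSum_geometric_two' τ
  have key : ∀ n, ∃ ω, IsBddDens S.a S.b ω ∧ ∫ t, |ω t| ≤ T n ∧
      (∀ x ∈ Icc S.a S.b, |S.K ω x| ≤ T n) ∧
      (∀ x, ¬ N n x → ∫ t, |S.k₁ (x - t) * ω t| ≤ T n ∧ ∫ t, |S.k₂ (x - t) * ω t| ≤ T n) ∧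
      ∀ p : P, f p = n → pot S.k₁ ω p = A p := by
    intro n
    by_cases h : ∃ p : P, f p = n
    · obtain ⟨p, rfl⟩ := h
      set D := 1 + C₁ / ρ p + C₂ / ρ p
      have hρp := hρ p
      have h1 : 0 ≤ C₁ / ρ p := by positivity
      have h2 : 0 ≤ C₂ / ρ p := by positivity
      have hD : 1 ≤ D := by simp only [D]; linarith
      have hD0 : 0 < D := by linarith
      obtain ⟨ω, hω, hsupp, hintg, hK, hA⟩ := hS p (hP p.2) (A p) (T (f p) / D)
        (div_pos (hT _) hD0) (ρ p) hρp
      have hle : T (f p) / D ≤ T (f p) := div_le_self (hT _).le hD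
      have hfar : ∀ C, 0 ≤ C → C / ρ p ≤ D → ∀ k : ℝ → ℝ, (∀ s, |k s| * |s| ≤ C) → ∀ x, ¬ N (f p) x →
          ∫ t, |k (x - t) * ω t| ≤ T (f p) := by
        intro C hC0 hCD k hk x hx
        have hx' : 2 * ρ p ≤ |x - p| := not_lt.1 fun h => hx ⟨p, rfl, h⟩
        calc ∫ t, |k (x - t) * ω t| ≤ C / ρ p * ∫ t, |ω t| :=
              integral_abs_pot_far_le hω.int hk hρp hsupp hx'
          _ ≤ D * (T (f p) / D) := by gcongr
          _ = T (f p) := mul_div_cancel₀ _ hD0.ne'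
      refine ⟨ω, hω, hintg.trans hle, fun x hx => (hK x hx).trans hle, fun x hx =>
        ⟨hfar C₁ hC₁0 (by simp only [D]; linarith) _ hC₁ x hx,
          hfar C₂ hC₂0 (by simp only [D]; linarith) _ hC₂ x hx⟩, fun q hq => ?_⟩
      rw [hf hq, hA]
    · have := (hT n).le
      refine ⟨fun _ => 0, isBddDens_zero _ _, by simpa, fun x _ => by simpa [K, pot],
        fun x _ => by simpa, fun p hp => (h ⟨p, hp⟩).elim⟩
  choose ω hω hintg hK hfar hA using key
  have hsum : ∀ (k : ℝ → ℝ), IsKer k S.R →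
      (∀ n x, ¬ N n x → ∫ t, |k (x - t) * ω n t| ≤ T n) → ∀ x,
      PotConv k (fun t => ∑' n, ω n t) x ∧
        HasSum (fun n => pot k (ω n) x) (pot k (fun t => ∑' n, ω n t) x) := by
    intro k hk hb x
    refine pot_tsum (fun n => (hω n).potConv hk x) (hTs.summable.of_norm_bounded_eventually ?_)
    have hfin : {n | N n x}.Finite := Set.Subsingleton.finite fun m hm n hn => hN x m n hm hn
    filter_upwards [hfin.compl_mem_cofinite] with n hn
    rw [norm_of_nonneg (integral_nonneg fun t => abs_nonneg _)]
    exact hb n x hn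
  have hs₁ := hsum S.k₁ S.ker₁ fun n x h => (hfar n x h).1
  have hs₂ := hsum S.k₂ S.ker₂ fun n x h => (hfar n x h).2
  have hpotle : ∀ k n x, ∫ t, |k (x - t) * ω n t| ≤ T n → |pot k (ω n) x| ≤ T n :=
    fun k n x h => (abs_integral_le_integral_abs).trans h
  have hKs : ∀ x, HasSum (fun n => S.K (ω n) x) (S.K (fun t => ∑' n, ω n t) x) := fun x =>
    ((hs₁ x).2.mul_left _).sub ((hs₂ x).2.mul_left _)
  have hintsum : Summable fun n => ∫ t, |ω n t| :=
    Summable.of_nonneg_of_le (fun n => integral_nonneg fun t => abs_nonneg _) hintg hTs.summable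
  have hI := integrable_tsum_of_summable_integral (fun n => (hω n).int) hintsum
  have hbd : ∀ (g : ℕ → ℝ) (s : ℝ), HasSum g s → (∀ n, |g n| ≤ T n) → |s| ≤ τ :=
    fun g s hg h => by
      rw [← hg.tsum_eq]
      exact tsum_of_norm_bounded (f := g) hTs h
  refine ⟨fun t => ∑' n, ω n t, ⟨hI.1, fun t ht => ?_⟩, hI.2.trans ?_,
    fun x => ⟨(hs₁ x).1, (hs₂ x).1⟩, ?_, fun x hx => hbd _ _ (hKs x) fun n => hK n x hx,
    fun x hx => ⟨hbd _ _ (hs₁ x).2 fun n => hpotle _ n x (hfar n x (hNe n x hx)).1,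
      hbd _ _ (hs₂ x).2 fun n => hpotle _ n x (hfar n x (hNe n x hx)).2⟩, fun p hp => ?_⟩
  · simp [(hω _).supp t ht]
  · rw [← hTs.tsum_eq]
    exact hintsum.tsum_le_tsum hintg hTs.summable
  · have : S.K (fun t => ∑' n, ω n t) = fun x => ∑' n, S.K (ω n) x :=
      funext fun x => (hKs x).tsum_eq.symm
    rw [this]
    exact continuousOn_tsum (fun n => (continuous_K (hω n)).continuousOn) hTs.summable
      fun n x hx => hK n x hx
  · refine hbd _ _ ((hs₁ p).2.sub (hasSum_ite_eq (f ⟨p, hp⟩) (A p))) fun n => ?_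
    by_cases hn : n = f ⟨p, hp⟩
    · rw [if_pos hn, hA n ⟨p, hp⟩ hn.symm, sub_self, abs_zero]
      exact (hT n).le
    · rw [if_neg hn, sub_zero]
      refine hpotle _ n p (hfar n p fun h => hn (hN p _ _ h ⟨⟨p, hp⟩, rfl, ?_⟩)).1
      have := hρ ⟨p, hp⟩
      simpa using this

lemma Approx.add {w F m ω : ℝ → ℝ} {τ : ℝ} (h : S.Approx w F τ m) (hω : IsDens S.a S.b ω)
    (hintg : ∫ t, |ω t| ≤ τ) (hc : ∀ x, PotConv S.k₁ ω x ∧ PotConv S.k₂ ω x)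
    (hKc : ContinuousOn (S.K ω) (Icc S.a S.b)) (hK : ∀ x ∈ Icc S.a S.b, |S.K ω x| ≤ τ)
    (he : ∀ x, x = S.a ∨ x = S.b → |pot S.k₁ ω x| ≤ τ ∧ |pot S.k₂ ω x| ≤ τ)
    (hw : IsDens S.a S.b w) :
    S.Approx w F (2 * τ) (fun t => m t + ω t) := by
  obtain ⟨r, hr1, hr2, hr3, hra, hrb⟩ := h.rem
  have hmw : (fun t => m t + ω t - w t) = fun t => (m t - w t) + ω t := by ext t; ring
  have hend : ∀ x, x = S.a ∨ x = S.b → S.K (fun t => m t + ω t - w t) x =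
      S.K (fun t => m t - w t) x + S.K ω x := fun x hx => by
    rw [hmw, K_add (h.conv₁ x hx).1 (h.conv₂ x hx).1 (hc x).1 (hc x).2]
  refine ⟨h.dens.add hω, ?_, fun x hx => ⟨(h.conv x hx).1.add (hc x).1, (h.conv x hx).2.add
    (hc x).2⟩, ⟨fun x => r x + S.K ω x, hr1.add hKc, fun x hx => (abs_add_le _ _).trans
      (by linarith [hr2 x hx, hK x hx]), fun x hx => ?_, ?_, ?_⟩, fun x hx => ?_, fun x hx => ?_⟩
  · calc ∫ t, |m t + ω t - w t| ≤ ∫ t, (|m t - w t| + |ω t|) := by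
          refine integral_mono ((h.dens.add hω).sub hw).int.abs
            ((h.dens.sub hw).int.abs.add hω.int.abs) fun t => ?_
          change |m t + ω t - w t| ≤ |m t - w t| + |ω t|
          rw [show m t + ω t - w t = (m t - w t) + ω t by ring]
          exact abs_add_le _ _
      _ = (∫ t, |m t - w t|) + ∫ t, |ω t| := integral_add (h.dens.sub hw).int.abs hω.int.abs
      _ ≤ 2 * τ := by linarith [h.close]
  · rw [K_add (h.conv x hx).1 (h.conv x hx).2 (hc x).1 (hc x).2, hr3 x hx]; ring
  · simp only [hend _ (.inl rfl), hra]
  · simp only [hend _ (.inr rfl), hrb]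
  · rw [hmw, pot_add (h.conv₁ x hx).1 (hc x).1]
    exact ⟨(h.conv₁ x hx).1.add (hc x).1, (abs_add_le _ _).trans
      (by linarith [(h.conv₁ x hx).2, (he x hx).1])⟩
  · rw [hmw, pot_add (h.conv₂ x hx).1 (hc x).2]
    exact ⟨(h.conv₂ x hx).1.add (hc x).2, (abs_add_le _ _).trans
      (by linarith [(h.conv₂ x hx).2, (he x hx).2])⟩

lemma exists_approx_of_hasSpikes {w F : ℝ → ℝ} (hw : IsDens S.a S.b w) (hF : Continuous F)
    (hwF : ∀ x ∈ Icc S.a S.b, S.K w x = F x) (hκ₁ : 0 < S.κ₁)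
    (hS : S.HasSpikes) {τ : ℝ} (hτ : 0 < τ) :
    ∃ m, S.Approx w F τ m ∧ (S.Controlled w τ m ∨ S.Uncontrolled w m) := by
  classical
  set D := 2 + S.κ₁
  have hD : 2 ≤ D := by simp only [D]; linarith
  have hD0 : 0 < D := by linarith
  have hτD : 0 < τ / D := by positivity
  have hDτ : D * (τ / D) = τ := mul_div_cancel₀ _ hD0.ne'
  have h2D : 2 * (τ / D) ≤ τ := by nlinarith
  obtain ⟨m, hm⟩ := exists_approx hw hF hwF hτD
  set P := {x ∈ Ioo S.a S.b | S.BadL w x ∨ S.BadR w x}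
  have hP : P ⊆ Ioo S.a S.b := fun x hx => hx.1
  rcases P.finite_or_infinite with hfin | hinf
  · have : Finite P := hfin
    obtain ⟨f, hf⟩ := exists_injective_nat P
    have hiso : ∀ p ∈ P, ∃ ρ > 0, ∀ q ∈ P, q ≠ p → ρ ≤ |q - p| := fun p _ => by
      have h1 := (hfin.subset (sdiff_subset (t := {p}))).isClosed.isOpen_compl.mem_nhds
        (show p ∈ (P \ {p})ᶜ by simp)
      obtain ⟨ρ, hρ, h⟩ := Metric.mem_nhds_iff.1 h1
      refine ⟨ρ, hρ, fun q hq hqp => not_lt.1 fun hlt => h (Metric.mem_ball.2 hlt) ⟨hq, hqp⟩⟩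
    obtain ⟨ω, h1, h2, h3, h4, h5, h6, h7⟩ := hS.exists_isolated hP hf hiso (fun x =>
      if S.BadL w x then -pot S.k₁ m x else -(S.κ₂ * pot S.k₂ m x / S.κ₁)) hτD
    refine ⟨_, (hm.add h1 h2 h3 h4 h5 h6 hw).mono h2D, .inl ⟨fun x hx hb => ?_, fun x hx hb => ?_⟩⟩
    · have h8 := h7 x ⟨hx, .inl hb⟩
      rw [if_pos hb, sub_neg_eq_add] at h8
      rw [pot_add (hm.conv x hx).1 (h3 x).1, add_comm]
      have := mul_le_mul_of_nonneg_left h8 hκ₁.le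
      nlinarith
    · have h8 := h7 x ⟨hx, .inr hb⟩
      rw [if_neg fun h => h.1 hb.1, sub_neg_eq_add] at h8
      rw [pot_add (hm.conv x hx).2 (h3 x).2]
      have h9 := h5 x (Ioo_subset_Icc_self hx)
      have h10 : S.κ₂ * (pot S.k₂ m x + pot S.k₂ ω x) =
          S.κ₁ * (pot S.k₁ ω x + S.κ₂ * pot S.k₂ m x / S.κ₁) - S.K ω x := by
        rw [K]; field_simp; ring
      calc S.κ₂ * |pot S.k₂ m x + pot S.k₂ ω x| ≤ |S.κ₂| * |pot S.k₂ m x + pot S.k₂ ω x| := by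
            gcongr; exact le_abs_self _
        _ = |S.κ₁ * (pot S.k₁ ω x + S.κ₂ * pot S.k₂ m x / S.κ₁) - S.K ω x| := by
            rw [← abs_mul, h10]
        _ ≤ S.κ₁ * (τ / D) + τ / D := by
            refine (abs_sub _ _).trans (add_le_add ?_ h9)
            rw [abs_mul, abs_of_pos hκ₁]; gcongr
        _ ≤ τ := by nlinarith
  · have : Infinite P := hinf.to_subtype
    obtain ⟨g, hg⟩ := exists_topology_isEmbedding_nat P
    set Q : Set ℝ := range fun n => (g n : ℝ)
    have hQP : Q ⊆ P := by rintro _ ⟨n, rfl⟩; exact (g n).2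
    choose f hf using fun q : Q => q.2
    have hfinj : Function.Injective f := fun p q h => by
      apply Subtype.ext; rw [← hf p, ← hf q, h]
    have hgf : ∀ n, f ⟨g n, n, rfl⟩ = n := fun n =>
      hg.injective (Subtype.ext (hf ⟨g n, n, rfl⟩))
    have hiso : ∀ p ∈ Q, ∃ ρ > 0, ∀ q ∈ Q, q ≠ p → ρ ≤ |q - p| := by
      rintro _ ⟨n, rfl⟩
      obtain ⟨U, hU, hUn⟩ := (IsEmbedding.subtypeVal.comp hg).isOpen_iff.1 (isOpen_discrete {n})
      have hnU : (g n : ℝ) ∈ U := by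
        have : n ∈ (Subtype.val ∘ g) ⁻¹' U := by rw [hUn]; rfl
        exact this
      obtain ⟨ρ, hρ, h⟩ := Metric.isOpen_iff.1 hU _ hnU
      refine ⟨ρ, hρ, ?_⟩
      rintro _ ⟨k, rfl⟩ hne
      refine not_lt.1 fun hlt => hne ?_
      have : k ∈ (Subtype.val ∘ g) ⁻¹' U := h (Metric.mem_ball.2 hlt)
      rw [hUn] at this
      rw [mem_singleton_iff.1 this]
    obtain ⟨ω, h1, h2, h3, h4, h5, h6, h7⟩ := hS.exists_isolated (hQP.trans hP) hfinj hiso (fun x =>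
      if hx : x ∈ Q then f ⟨x, hx⟩ - pot S.k₁ m x else 0) hτD
    refine ⟨_, (hm.add h1 h2 h3 h4 h5 h6 hw).mono h2D, .inr ?_⟩
    rintro ⟨B, hB⟩
    obtain ⟨n, hn⟩ := exists_nat_gt (B / S.κ₁ + τ / D)
    have hgn : (g n : ℝ) ∈ Q := ⟨n, rfl⟩
    have h8 := hB ⟨g n, (g n).2, rfl⟩
    have h9 := h7 (g n) hgn
    simp only [dif_pos hgn, hgf] at h8 h9
    rw [pot_add (hm.conv _ (hP (g n).2)).1 (h3 _).1] at h8
    have h10 := (abs_le.1 h9).1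
    have h11 := le_abs_self (pot S.k₁ m (g n) + pot S.k₁ ω (g n))
    have h12 : |pot S.k₁ m (g n) + pot S.k₁ ω (g n)| ≤ B / S.κ₁ := by
      rw [le_div_iff₀ hκ₁]; linarith
    linarith

end PotSys

/-- Densities with continuous two-sided Riemann–Liouville potential admit good approximations. -/
lemma exists_approx_powSys {a b α β κ₁ κ₂ : ℝ} (hab : a < b) (hα0 : 0 < α) (hα : α < 1)
    (hβ0 : 0 < β) (hβ : β < 1) (hκ₁ : 0 ≤ κ₁) (hκ₂ : 0 ≤ κ₂) {w F : ℝ → ℝ} (hw : IsDens a b w)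
    (hF : Continuous F) (hwF : ∀ x ∈ Icc a b, (powSys hab hα hβ κ₁ κ₂).K w x = F x)
    {τ : ℝ} (hτ : 0 < τ) :
    ∃ m, (powSys hab hα hβ κ₁ κ₂).Approx w F τ m ∧
      ((powSys hab hα hβ κ₁ κ₂).Controlled w τ m ∨ (powSys hab hα hβ κ₁ κ₂).Uncontrolled w m) := by
  by_cases h0 : κ₁ = 0 ∨ κ₂ = 0
  · obtain ⟨m, hm⟩ := PotSys.exists_approx (S := powSys hab hα hβ κ₁ κ₂) hw hF hwF hτ
    exact ⟨m, hm, .inl (hm.controlled_of_zero hwF hκ₁ hκ₂ h0)⟩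
  · rw [not_or] at h0
    have hκ₁' : 0 < κ₁ := lt_of_le_of_ne hκ₁ (Ne.symm h0.1)
    have hκ₂' : 0 < κ₂ := lt_of_le_of_ne hκ₂ (Ne.symm h0.2)
    by_cases hαβ : α = β
    · subst hαβ
      exact PotSys.exists_approx_of_hasSpikes (S := powSys hab hα hβ κ₁ κ₂) hw hF hwF hκ₁'
        (hasSpikes_powSys hα0 hκ₁' hκ₂') hτ
    · obtain ⟨m, h1, h2⟩ := PotSys.exists_approx_of_potBound (S := powSys hab hα hβ κ₁ κ₂) hw hF hwF
        hκ₁ hκ₂ (potBound_powSys hα0 hβ0 hκ₁' hκ₂' hαβ) (avgClose_powSys_left hα0)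
        (avgClose_powSys_right hβ0) hτ
      exact ⟨m, h1, .inl h2⟩

namespace PotSys

variable {S : PotSys}

/-- The endpoint potentials and the mass of a bounded density can be prescribed, with control of the
density. -/
def HasEndDual (S : PotSys) : Prop :=
  ∃ C, 0 ≤ C ∧ ∀ τ c₁ c₂ c₃, |c₁| ≤ τ → |c₂| ≤ τ → |c₃| ≤ τ →
    ∃ q, IsBddDens S.a S.b q ∧ pot S.k₂ q S.a = c₁ ∧ pot S.k₁ q S.b = c₂ ∧ ∫ t, q t = c₃ ∧
      ∫ t, |q t| ≤ C * τ ∧ ∀ x, |pot S.k₁ q x| ≤ C * τ ∧ |pot S.k₂ q x| ≤ C * τ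

/-- `w'` is an admissible modification of `w` in the direction `e`. -/
structure Variation (S : PotSys) (w F e : ℝ → ℝ) (η τ : ℝ) (w' : ℝ → ℝ) : Prop where
  dens : IsDens S.a S.b w'
  mass : ∫ t, w' t - w t = ∫ t, e t
  close : ∫ t, |w' t - w t - e t| ≤ τ
  cont : ContinuousOn (S.K w') (Icc S.a S.b)
  closeK : ∀ x ∈ Icc S.a S.b, |S.K w' x - F x - S.K e x| ≤ τ
  norm : sSup ((fun x => |S.K (fun t => w' t - w t) x|) '' Icc S.a S.b) ≤ η + τ

/-- The kernels are one-sided. -/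
structure OneSided (S : PotSys) : Prop where
  left : ∀ s ≤ 0, S.k₁ s = 0
  right : ∀ s, 0 ≤ s → S.k₂ s = 0

lemma OneSided.left_mul (h : S.OneSided) {u : ℝ → ℝ} (hu : IsDens S.a S.b u) (t : ℝ) :
    S.k₁ (S.a - t) * u t = 0 := by
  by_cases ht : t ∈ Icc S.a S.b
  · rw [h.left _ (by linarith [ht.1]), zero_mul]
  · rw [hu.supp t ht, mul_zero]

lemma OneSided.right_mul (h : S.OneSided) {u : ℝ → ℝ} (hu : IsDens S.a S.b u) (t : ℝ) :
    S.k₂ (S.b - t) * u t = 0 := by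
  by_cases ht : t ∈ Icc S.a S.b
  · rw [h.right _ (by linarith [ht.2]), zero_mul]
  · rw [hu.supp t ht, mul_zero]

lemma OneSided.pot_left (h : S.OneSided) {u : ℝ → ℝ} (hu : IsDens S.a S.b u) :
    pot S.k₁ u S.a = 0 := by simp [pot, h.left_mul hu]

lemma OneSided.pot_right (h : S.OneSided) {u : ℝ → ℝ} (hu : IsDens S.a S.b u) :
    pot S.k₂ u S.b = 0 := by simp [pot, h.right_mul hu]

lemma _root_.PotConv.of_sub {k u v : ℝ → ℝ} {x : ℝ} (h : PotConv k (fun t => u t - v t) x)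
    (hu : PotConv k u x) : PotConv k v x := by
  have := hu.sub h
  simpa only [sub_sub_cancel] using this

lemma _root_.pot_eq_of_sub_eq_zero {k u v : ℝ → ℝ} {x : ℝ} (h : PotConv k (fun t => u t - v t) x)
    (h0 : pot k (fun t => u t - v t) x = 0) : pot k u x = pot k v x := by
  by_cases hu : PotConv k u x
  · have := pot_sub hu (h.of_sub hu)
    linarith
  · have hv : ¬ PotConv k v x := fun hv => hu (by
      have := h.add hv
      simpa only [sub_add_cancel] using this)
    rw [pot_undef hu, pot_undef hv]

lemma exists_variation {w F e : ℝ → ℝ} (hS : S.OneSided) (hd : S.HasEndDual) (hκ₁ : 0 ≤ S.κ₁)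
    (hκ₂ : 0 ≤ S.κ₂) (hw : IsDens S.a S.b w) (hF : Continuous F)
    (hwF : ∀ x ∈ Icc S.a S.b, S.K w x = F x)
    (hap : ∀ τ > 0, ∃ m, S.Approx w F τ m ∧ (S.Controlled w τ m ∨ S.Uncontrolled w m))
    (he : IsBddDens S.a S.b e) (hea : pot S.k₂ e S.a = 0) (heb : pot S.k₁ e S.b = 0) {η : ℝ}
    (hη : ∀ x, S.κ₁ * |pot S.k₁ e x| + S.κ₂ * |pot S.k₂ e x| ≤ η) {τ : ℝ} (hτ : 0 < τ) :
    ∃ w', S.Variation w F e η τ w' := by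
  obtain ⟨C, hC0, hC⟩ := hd
  set D := 2 + C + (S.κ₁ + S.κ₂) * C
  have hκC : 0 ≤ (S.κ₁ + S.κ₂) * C := by positivity
  have hD0 : 0 < D := by simp only [D]; linarith
  set τ' := τ / D
  have hτ' : 0 < τ' := by positivity
  have hDτ : 2 * τ' + C * τ' + (S.κ₁ + S.κ₂) * (C * τ') = τ := by
    have : D * τ' = τ := mul_div_cancel₀ _ hD0.ne'
    rw [← this]; simp only [D]; ring
  have hCτ : 0 ≤ C * τ' := by positivity
  have hκCτ : 0 ≤ (S.κ₁ + S.κ₂) * (C * τ') := by positivity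
  obtain ⟨m, hm, hctl⟩ := hap τ' hτ'
  obtain ⟨r, hr1, hr2, hr3, hra, hrb⟩ := hm.rem
  have hma := hm.conv₂ S.a (.inl rfl)
  have hmb := hm.conv₁ S.b (.inr rfl)
  have hmw := hm.dens.sub hw
  obtain ⟨q, hq, hqa, hqb, hqm, hqi, hqp⟩ := hC τ' (-pot S.k₂ (fun t => m t - w t) S.a)
    (-pot S.k₁ (fun t => m t - w t) S.b) (-∫ t, m t - w t) (by rw [abs_neg]; exact hma.2)
    (by rw [abs_neg]; exact hmb.2)
    (by rw [abs_neg]; exact abs_integral_le_integral_abs.trans hm.close)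
  set g : ℝ → ℝ := fun t => e t + q t
  have hg : IsBddDens S.a S.b g := he.add hq
  have hgc₁ : ∀ x, PotConv S.k₁ g x := fun x => hg.potConv S.ker₁ x
  have hgc₂ : ∀ x, PotConv S.k₂ g x := fun x => hg.potConv S.ker₂ x
  have hg₁ : ∀ x, pot S.k₁ g x = pot S.k₁ e x + pot S.k₁ q x := fun x =>
    pot_add (he.potConv S.ker₁ x) (hq.potConv S.ker₁ x)
  have hg₂ : ∀ x, pot S.k₂ g x = pot S.k₂ e x + pot S.k₂ q x := fun x =>
    pot_add (he.potConv S.ker₂ x) (hq.potConv S.ker₂ x)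
  have hgle : ∀ x, S.κ₁ * |pot S.k₁ g x| + S.κ₂ * |pot S.k₂ g x| ≤
      η + (S.κ₁ + S.κ₂) * (C * τ') := fun x => by
    have h1 : |pot S.k₁ g x| ≤ |pot S.k₁ e x| + C * τ' := by
      rw [hg₁]; exact (abs_add_le _ _).trans (by linarith [(hqp x).1])
    have h2 : |pot S.k₂ g x| ≤ |pot S.k₂ e x| + C * τ' := by
      rw [hg₂]; exact (abs_add_le _ _).trans (by linarith [(hqp x).2])
    have h3 := mul_le_mul_of_nonneg_left h1 hκ₁
    have h4 := mul_le_mul_of_nonneg_left h2 hκ₂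
    linarith [hη x]
  set w' : ℝ → ℝ := fun t => m t + g t
  have hw' : IsDens S.a S.b w' := hm.dens.add hg.toIsDens
  have hV : (fun t => w' t - w t) = fun t => (m t - w t) + g t := by
    ext t; simp only [w']; ring
  have hVd : IsDens S.a S.b fun t => w' t - w t := hw'.sub hw
  have hVc₁ : ∀ x, x = S.a ∨ x = S.b → PotConv S.k₁ (fun t => w' t - w t) x := fun x hx => by
    rw [hV]; exact (hm.conv₁ x hx).1.add (hgc₁ x)
  have hVc₂ : ∀ x, x = S.a ∨ x = S.b → PotConv S.k₂ (fun t => w' t - w t) x := fun x hx => by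
    rw [hV]; exact (hm.conv₂ x hx).1.add (hgc₂ x)
  have hV₁ : ∀ x, x = S.a ∨ x = S.b → pot S.k₁ (fun t => w' t - w t) x = 0 := by
    rintro x (rfl | rfl)
    · exact hS.pot_left hVd
    · rw [hV, pot_add hmb.1 (hgc₁ _), hg₁, heb, hqb]; ring
  have hV₂ : ∀ x, x = S.a ∨ x = S.b → pot S.k₂ (fun t => w' t - w t) x = 0 := by
    rintro x (rfl | rfl)
    · rw [hV, pot_add hma.1 (hgc₂ _), hg₂, hea, hqa]; ring
    · exact hS.pot_right hVd
  have hKV : ∀ x, x = S.a ∨ x = S.b → S.K (fun t => w' t - w t) x = 0 := fun x hx => by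
    rw [K, hV₁ x hx, hV₂ x hx]; ring
  have hrend : ∀ x, x = S.a ∨ x = S.b → r x = S.K (fun t => m t - w t) x := by
    rintro x (rfl | rfl) <;> assumption
  have hKw' : ∀ x ∈ Icc S.a S.b, S.K w' x = F x + (r x + S.K g x) := fun x hx => by
    by_cases hx' : x ∈ Ioo S.a S.b
    · rw [K_add (hm.conv x hx').1 (hm.conv x hx').2 (hgc₁ x) (hgc₂ x), hr3 x hx']; ring
    · have hxe : x = S.a ∨ x = S.b := by
        by_contra h
        rw [not_or] at h
        exact hx' ⟨lt_of_le_of_ne hx.1 (Ne.symm h.1), lt_of_le_of_ne hx.2 h.2⟩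
      rw [K, pot_eq_of_sub_eq_zero (hVc₁ x hxe) (hV₁ x hxe),
        pot_eq_of_sub_eq_zero (hVc₂ x hxe) (hV₂ x hxe), ← K, hwF x hx, hrend x hxe,
        ← K_add (hm.conv₁ x hxe).1 (hm.conv₂ x hxe).1 (hgc₁ x) (hgc₂ x), ← hV, hKV x hxe, add_zero]
  have hKabs : ∀ x, |S.K g x| ≤ η + (S.κ₁ + S.κ₂) * (C * τ') := fun x => by
    refine le_trans ?_ (hgle x)
    rw [K]
    refine (abs_sub _ _).trans ?_
    rw [abs_mul, abs_mul, abs_of_nonneg hκ₁, abs_of_nonneg hκ₂]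
  have hKq : ∀ x, |S.K q x| ≤ (S.κ₁ + S.κ₂) * (C * τ') := fun x => by
    rw [K]
    refine (abs_sub _ _).trans ?_
    rw [abs_mul, abs_mul, abs_of_nonneg hκ₁, abs_of_nonneg hκ₂]
    have h3 := mul_le_mul_of_nonneg_left (hqp x).1 hκ₁
    have h4 := mul_le_mul_of_nonneg_left (hqp x).2 hκ₂
    linarith
  have hη0 : 0 ≤ η := le_trans (by positivity) (hη S.a)
  have hw'c₁ : ∀ x ∈ Ioo S.a S.b, PotConv S.k₁ w' x := fun x hx => (hm.conv x hx).1.add (hgc₁ x)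
  have hw'c₂ : ∀ x ∈ Ioo S.a S.b, PotConv S.k₂ w' x := fun x hx => (hm.conv x hx).2.add (hgc₂ x)
  have hbadL : ∀ x ∈ Ioo S.a S.b, S.BadL w x → S.K (fun t => w' t - w t) x =
      r x - S.κ₂ * pot S.k₂ g x - S.κ₁ * pot S.k₁ m x := fun x hx hb => by
    have h1 := hr3 x hx
    rw [← hwF x (Ioo_subset_Icc_self hx), K_of_badL hb, K] at h1
    rw [K, pot_undef fun h => hb.1 (h.of_sub (hw'c₁ x hx)), pot_sub (hw'c₂ x hx) hb.2,
      pot_add (hm.conv x hx).2 (hgc₂ x)]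
    linarith
  have hbadR : ∀ x ∈ Ioo S.a S.b, S.BadR w x → S.K (fun t => w' t - w t) x =
      r x + S.κ₁ * pot S.k₁ g x + S.κ₂ * pot S.k₂ m x := fun x hx hb => by
    have h1 := hr3 x hx
    rw [← hwF x (Ioo_subset_Icc_self hx), K_of_badR hb, K] at h1
    rw [K, pot_undef fun h => hb.2 (h.of_sub (hw'c₂ x hx)), pot_sub (hw'c₁ x hx) hb.1,
      pot_add (hm.conv x hx).1 (hgc₁ x)]
    linarith
  refine ⟨w', hw', ?_, ?_, ?_, fun x hx => ?_, ?_⟩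
  · rw [hV, integral_add hmw.int hg.int, show ∫ t, g t = (∫ t, e t) + ∫ t, q t from
      integral_add he.int hq.int, hqm]
    ring
  · calc ∫ t, |w' t - w t - e t| ≤ ∫ t, (|m t - w t| + |q t|) := by
          refine integral_mono (hVd.sub he.toIsDens).int.abs (hmw.int.abs.add hq.int.abs)
            fun t => ?_
          change |m t + (e t + q t) - w t - e t| ≤ |m t - w t| + |q t|
          rw [show m t + (e t + q t) - w t - e t = (m t - w t) + q t by ring]
          exact abs_add_le _ _
      _ = (∫ t, |m t - w t|) + ∫ t, |q t| := integral_add hmw.int.abs hq.int.abs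
      _ ≤ τ := by linarith [hm.close]
  · exact (hF.continuousOn.add (hr1.add (continuous_K hg).continuousOn)).congr hKw'
  · rw [hKw' x hx, K_add (he.potConv S.ker₁ x) (he.potConv S.ker₂ x) (hq.potConv S.ker₁ x)
      (hq.potConv S.ker₂ x), show F x + (r x + (S.K e x + S.K q x)) - F x - S.K e x =
        r x + S.K q x by ring]
    exact (abs_add_le _ _).trans (by linarith [hr2 x hx, hKq x])
  · rcases hctl with hc | hc
    · refine csSup_le ((nonempty_Icc.2 S.hab.le).image _) ?_
      rintro _ ⟨x, hx, rfl⟩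
      change |S.K (fun t => w' t - w t) x| ≤ η + τ
      by_cases hx' : x ∈ Ioo S.a S.b
      · have h1 := hr2 x hx
        have h2 := hgle x
        have h3 : 0 ≤ S.κ₁ * |pot S.k₁ g x| := by positivity
        have h4 : 0 ≤ S.κ₂ * |pot S.k₂ g x| := by positivity
        by_cases h₁ : PotConv S.k₁ w x <;> by_cases h₂ : PotConv S.k₂ w x
        · rw [K_sub (hw'c₁ x hx') (hw'c₂ x hx') h₁ h₂, hKw' x hx, hwF x hx, add_sub_cancel_left]
          exact (abs_add_le _ _).trans (by linarith [hKabs x])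
        · rw [hbadR x hx' ⟨h₁, h₂⟩]
          refine (abs_add_le _ _).trans ?_
          refine (add_le_add_left (abs_add_le _ _) _).trans ?_
          rw [abs_mul, abs_mul, abs_of_nonneg hκ₁, abs_of_nonneg hκ₂]
          linarith [hc.2 x hx' ⟨h₁, h₂⟩]
        · rw [hbadL x hx' ⟨h₁, h₂⟩]
          refine (abs_sub _ _).trans ?_
          refine (add_le_add_left (abs_sub _ _) _).trans ?_
          rw [abs_mul, abs_mul, abs_of_nonneg hκ₁, abs_of_nonneg hκ₂]
          linarith [hc.1 x hx' ⟨h₁, h₂⟩]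
        · rw [K, pot_undef fun h => h₁ (h.of_sub (hw'c₁ x hx')),
            pot_undef fun h => h₂ (h.of_sub (hw'c₂ x hx'))]
          simp only [mul_zero, sub_zero, abs_zero]
          linarith
      · rw [hKV x (by
          by_contra h
          rw [not_or] at h
          exact hx' ⟨lt_of_le_of_ne hx.1 (Ne.symm h.1), lt_of_le_of_ne hx.2 h.2⟩), abs_zero]
        linarith
    · rw [Real.sSup_of_not_bddAbove]
      · linarith
      · rintro ⟨B, hB⟩
        obtain ⟨M, hM⟩ := isCompact_Icc.exists_bound_of_continuousOn
          (hF.continuousOn (s := Icc S.a S.b))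
        refine hc ⟨B + τ' + M + (η + (S.κ₁ + S.κ₂) * (C * τ')), ?_⟩
        rintro _ ⟨x, ⟨hx, hb⟩, rfl⟩
        have hxI := Ioo_subset_Icc_self hx
        have hBx := hB ⟨x, hxI, rfl⟩
        have hMx := hM x hxI
        have h1 := hr2 x hxI
        have h2 := hgle x
        have h3 : |S.κ₁ * pot S.k₁ g x| + |S.κ₂ * pot S.k₂ g x| ≤
            η + (S.κ₁ + S.κ₂) * (C * τ') := by
          rwa [abs_mul, abs_mul, abs_of_nonneg hκ₁, abs_of_nonneg hκ₂]
        have h4 := abs_nonneg (S.κ₁ * pot S.k₁ g x)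
        have h5 := abs_nonneg (S.κ₂ * pot S.k₂ g x)
        rw [norm_eq_abs] at hMx
        have hM0 := (abs_nonneg _).trans hMx
        change |S.K (fun t => w' t - w t) x| ≤ B at hBx
        refine le_trans (b := |S.κ₁ * pot S.k₁ m x|) (by rw [abs_mul, abs_of_nonneg hκ₁]) ?_
        rcases hb with hb | hb
        · rw [show S.κ₁ * pot S.k₁ m x = r x - S.κ₂ * pot S.k₂ g x -
            S.K (fun t => w' t - w t) x by rw [hbadL x hx hb]; ring]
          refine (abs_sub _ _).trans ((add_le_add_left (abs_sub _ _) _).trans ?_)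
          linarith
        · have h6 : S.κ₁ * pot S.k₁ m x = S.K (fun t => w' t - w t) x + F x -
              S.κ₁ * pot S.k₁ g x := by
            have := hr3 x hx
            rw [K] at this
            rw [hbadR x hx hb]
            linarith
          rw [h6]
          refine (abs_sub _ _).trans ((add_le_add_left (abs_add_le _ _) _).trans ?_)
          linarith

end PotSys

lemma IsBddDens.integrable_mul {a b : ℝ} {u h : ℝ → ℝ} (hu : IsBddDens a b u)
    (hh : IntegrableOn h (Icc a b)) : Integrable fun t => h t * u t := by
  obtain ⟨M, -, hM⟩ := hu.bdd
  refine ((hh.integrable_indicator measurableSet_Icc).mul_bdd (c := M) hu.int.1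
    (.of_forall hM)).congr (.of_forall fun t => ?_)
  by_cases ht : t ∈ Icc a b
  · simp [indicator_of_mem ht]
  · simp [hu.supp t ht]

/-- The bounded densities on `[a, b]`. -/
def bddDensSubmodule (a b : ℝ) : Submodule ℝ (ℝ → ℝ) where
  carrier := {u | IsBddDens a b u}
  add_mem' hu hv := hu.add hv
  zero_mem' := isBddDens_zero a b
  smul_mem' c _ hu := hu.const_mul c

/-- The pairings of bounded densities with linearly independent continuous functions can be
prescribed. -/
lemma exists_isBddDens_pairing {a b : ℝ} {n : ℕ} {h : Fin n → ℝ → ℝ}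
    (hc : ∀ i, ContinuousOn (h i) (Ioo a b)) (hi : ∀ i, IntegrableOn (h i) (Icc a b))
    (hind : ∀ c : Fin n → ℝ, (∀ x ∈ Ioo a b, ∑ i, c i * h i x = 0) → c = 0) (v : Fin n → ℝ) :
    ∃ u, IsBddDens a b u ∧ ∀ i, ∫ t, h i t * u t = v i := by
  let Λ : bddDensSubmodule a b →ₗ[ℝ] (Fin n → ℝ) :=
    { toFun := fun u i => ∫ t, h i t * u.1 t
      map_add' := fun u v => by
        ext i
        simp only [Submodule.coe_add, Pi.add_apply, mul_add]
        exact integral_add (IsBddDens.integrable_mul u.2 (hi i))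
          (IsBddDens.integrable_mul v.2 (hi i))
      map_smul' := fun c u => by
        ext i
        simp only [Submodule.coe_smul, Pi.smul_apply, smul_eq_mul, RingHom.id_apply,
          ← integral_const_mul]
        congr 1; ext t; ring }
  by_cases htop : Λ.range = ⊤
  · obtain ⟨u, hu⟩ := LinearMap.range_eq_top.1 htop v
    exact ⟨u.1, u.2, fun i => congrFun hu i⟩
  obtain ⟨f, hf0, hf⟩ := Submodule.exists_le_ker_of_lt_top _ (lt_top_iff_ne_top.2 htop)
  set c : Fin n → ℝ := fun i => f (Pi.single i 1)
  have hfc : ∀ v, f v = ∑ i, v i * c i := fun v => by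
    rw [LinearMap.pi_apply_eq_sum_univ f v]
    refine Finset.sum_congr rfl fun i _ => ?_
    rw [smul_eq_mul]
    congr 2
    ext j
    simp [Pi.single_apply, eq_comm]
  refine absurd (hind c fun x hx => ?_) fun hc0 => hf0 (LinearMap.ext fun v => by
    rw [hfc]; simp [hc0])
  set H : ℝ → ℝ := fun x => ∑ i, c i * h i x
  have hHc : ContinuousOn H (Ioo a b) :=
    continuousOn_finsetSum _ fun i _ => continuousOn_const.mul (hc i)
  have hHu : ∀ u, IsBddDens a b u → ∫ t, H t * u t = 0 := fun u hu => by
    have h1 : f (Λ ⟨u, hu⟩) = 0 := hf ⟨_, rfl⟩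
    rw [hfc] at h1
    rw [← h1]
    simp only [H, Finset.sum_mul]
    rw [integral_finsetSum]
    · refine Finset.sum_congr rfl fun i _ => ?_
      change _ = (∫ t, h i t * u t) * c i
      rw [mul_comm, ← integral_const_mul]
      congr 1; ext t; ring
    · intro i _
      refine ((hu.integrable_mul (hi i)).const_mul (c i)).congr (.of_forall fun t => ?_)
      ring_nf
  obtain ⟨p, hp⟩ := exists_between hx.1
  obtain ⟨q, hq⟩ := exists_between hx.2
  have hsub : Icc p q ⊆ Ioo a b := fun t ht => ⟨hp.1.trans_le ht.1, ht.2.trans_lt hq.2⟩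
  have hHpq := hHc.mono hsub
  obtain ⟨M, hM⟩ := isCompact_Icc.exists_bound_of_continuousOn hHpq
  have hu : IsBddDens a b ((Icc p q).indicator H) := by
    refine ⟨⟨hHpq.integrableOn_Icc.integrable_indicator measurableSet_Icc, fun t ht =>
      indicator_of_notMem (fun h => ht (Ioo_subset_Icc_self (hsub h))) _⟩, |M|, abs_nonneg _,
      fun t => ?_⟩
    by_cases ht : t ∈ Icc p q
    · rw [indicator_of_mem ht]; exact (hM t ht).trans (le_abs_self M)
    · rw [indicator_of_notMem ht]; simp
  have h1 := hHu _ hu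
  have h2 : (fun t => H t * (Icc p q).indicator H t) = (Icc p q).indicator fun t => H t * H t := by
    ext t
    by_cases ht : t ∈ Icc p q <;> simp [ht]
  rw [h2, integral_indicator measurableSet_Icc, setIntegral_eq_zero_iff_of_nonneg_ae
    (.of_forall fun t => mul_self_nonneg _) (hHpq.mul hHpq).integrableOn_Icc] at h1
  have h3 := Measure.eqOn_Icc_of_ae_eq volume (ne_of_lt (hp.2.trans hq.1)) h1 (hHpq.mul hHpq)
    continuousOn_const
  simpa using h3 ⟨hp.2.le, hq.1.le⟩

lemma coeff_eq_zero_left {a b α β c₁ c₂ : ℝ} {G : ℝ → ℝ} (hab : a < b) (hβ : 0 < β)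
    (hG : Continuous G)
    (h : ∀ t ∈ Ioo a b, c₁ * (t - a) ^ (-β) + c₂ * (b - t) ^ (-α) + G t = 0) : c₁ = 0 := by
  have hcont : ContinuousAt (fun t => (t - a) ^ β * (c₂ * (b - t) ^ (-α) + G t)) a := by
    refine ContinuousAt.mul ?_ ((continuousAt_const.mul ?_).add hG.continuousAt)
    · exact ContinuousAt.rpow_const (by fun_prop) (Or.inr hβ.le)
    · exact ContinuousAt.rpow_const (by fun_prop) (Or.inl (by linarith))
  have h1 : Tendsto (fun t => (t - a) ^ β * (c₂ * (b - t) ^ (-α) + G t)) (𝓝[>] a) (𝓝 0) := by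
    have := hcont.tendsto
    simp only [sub_self, zero_rpow hβ.ne', zero_mul] at this
    exact this.mono_left nhdsWithin_le_nhds
  have h2 : Tendsto (fun t => (t - a) ^ β * (c₂ * (b - t) ^ (-α) + G t)) (𝓝[>] a) (𝓝 (-c₁)) := by
    refine tendsto_const_nhds.congr' ?_
    filter_upwards [Ioo_mem_nhdsGT hab] with t ht
    have h3 := h t ht
    have h4 : 0 < t - a := by linarith [ht.1]
    have h5 : (t - a) ^ β * (t - a) ^ (-β) = 1 := by
      rw [← rpow_add h4, add_neg_cancel, rpow_zero]
    linear_combination (-(t - a) ^ β) * h3 + c₁ * h5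
  have := tendsto_nhds_unique h1 h2
  linarith

lemma coeff_eq_zero {a b α β c₁ c₂ : ℝ} {G : ℝ → ℝ} (hab : a < b) (hα : 0 < α) (hβ : 0 < β)
    (hG : Continuous G)
    (h : ∀ t ∈ Ioo a b, c₁ * (t - a) ^ (-β) + c₂ * (b - t) ^ (-α) + G t = 0) :
    c₁ = 0 ∧ c₂ = 0 := by
  refine ⟨coeff_eq_zero_left hab hβ hG h,
    coeff_eq_zero_left (a := a) (b := b) (α := β) (β := α) (c₂ := c₁)
      (G := fun t => G (a + b - t)) hab hα (by fun_prop) fun t ht => ?_⟩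
  have := h (a + b - t) ⟨by linarith [ht.2], by linarith [ht.1]⟩
  rw [show a + b - t - a = b - t by ring, show b - (a + b - t) = t - a by ring] at this
  linarith

section powSys

variable {a b α β κ₁ κ₂ : ℝ} {hab : a < b} {hα : α < 1} {hβ : β < 1}

lemma oneSided_powSys : (powSys hab hα hβ κ₁ κ₂).OneSided :=
  ⟨fun _ hs => powKer_nonpos hs, fun _ hs => powKer_nonpos (by linarith)⟩

lemma powSys_k₂_left {t : ℝ} (ht : t ∈ Ioo a b) :
    (powSys hab hα hβ κ₁ κ₂).k₂ (a - t) = (t - a) ^ (-β) := by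
  simp only [powSys]
  rw [neg_sub, powKer_of_mem ⟨by linarith [ht.1], by linarith [ht.2]⟩]

lemma powSys_k₁_right {t : ℝ} (ht : t ∈ Ioo a b) :
    (powSys hab hα hβ κ₁ κ₂).k₁ (b - t) = (b - t) ^ (-α) := by
  simp only [powSys]
  rw [powKer_of_mem ⟨by linarith [ht.2], by linarith [ht.1]⟩]

/-- The functions representing the endpoint potentials. -/
def endFun (S : PotSys) : Fin 2 → ℝ → ℝ :=
  ![fun t => S.k₂ (S.a - t), fun t => S.k₁ (S.b - t)]

lemma integrableOn_endFun (S : PotSys) (i : Fin 2) (s : Set ℝ) : IntegrableOn (endFun S i) s := by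
  fin_cases i
  · exact (S.ker₂.int.comp_sub_left S.a).integrableOn
  · exact (S.ker₁.int.comp_sub_left S.b).integrableOn

lemma continuousOn_endFun (i : Fin 2) :
    ContinuousOn (endFun (powSys hab hα hβ κ₁ κ₂) i) (Ioo a b) := by
  fin_cases i
  · refine ContinuousOn.congr (f := fun t => (t - a) ^ (-β)) ?_ fun t ht => powSys_k₂_left ht
    exact ContinuousOn.rpow_const (by fun_prop) fun t ht => Or.inl (by linarith [ht.1])
  · refine ContinuousOn.congr (f := fun t => (b - t) ^ (-α)) ?_ fun t ht => powSys_k₁_right ht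
    exact ContinuousOn.rpow_const (by fun_prop) fun t ht => Or.inl (by linarith [ht.2])

lemma coeff_endFun_eq_zero (hα0 : 0 < α) (hβ0 : 0 < β) {c₁ c₂ : ℝ} {G : ℝ → ℝ} (hG : Continuous G)
    (h : ∀ t ∈ Ioo a b, c₁ * endFun (powSys hab hα hβ κ₁ κ₂) 0 t +
      c₂ * endFun (powSys hab hα hβ κ₁ κ₂) 1 t + G t = 0) : c₁ = 0 ∧ c₂ = 0 := by
  refine coeff_eq_zero hab hα0 hβ0 hG fun t ht => ?_
  rw [← h t ht, ← powSys_k₂_left (hab := hab) (hα := hα) (hβ := hβ) (κ₁ := κ₁) (κ₂ := κ₂) ht,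
    ← powSys_k₁_right (hab := hab) (hα := hα) (hβ := hβ) (κ₁ := κ₁) (κ₂ := κ₂) ht]
  rfl

lemma exists_isBddDens_end (hα0 : 0 < α) (hβ0 : 0 < β) (v₁ v₂ v₃ : ℝ) :
    ∃ u, IsBddDens a b u ∧ pot (powSys hab hα hβ κ₁ κ₂).k₂ u a = v₁ ∧
      pot (powSys hab hα hβ κ₁ κ₂).k₁ u b = v₂ ∧ ∫ t, u t = v₃ := by
  obtain ⟨u, hu, h⟩ := exists_isBddDens_pairing (a := a) (b := b)
    (h := ![endFun (powSys hab hα hβ κ₁ κ₂) 0, endFun (powSys hab hα hβ κ₁ κ₂) 1, fun _ => 1])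
    (by
      intro i
      fin_cases i
      exacts [continuousOn_endFun 0, continuousOn_endFun 1, continuousOn_const])
    (by
      intro i
      fin_cases i
      exacts [integrableOn_endFun _ 0 _, integrableOn_endFun _ 1 _,
        continuousOn_const.integrableOn_Icc])
    (by
      intro c hc
      simp only [Fin.sum_univ_three] at hc
      obtain ⟨h0, h1⟩ := coeff_endFun_eq_zero hα0 hβ0 (G := fun _ => c 2 * 1) (by fun_prop) hc
      obtain ⟨m, hm⟩ := exists_between hab
      have h2 := hc m hm
      simp [h0, h1] at h2
      ext i
      fin_cases i
      exacts [h0, h1, h2])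
    ![v₁, v₂, v₃]
  exact ⟨u, hu, h 0, h 1, by simpa using h 2⟩

lemma hasEndDual_powSys (hα0 : 0 < α) (hβ0 : 0 < β) : (powSys hab hα hβ κ₁ κ₂).HasEndDual := by
  set S := powSys hab hα hβ κ₁ κ₂ with hS
  obtain ⟨u₁, hu₁, a1, b1, c1⟩ := exists_isBddDens_end (hab := hab) (hα := hα) (hβ := hβ)
    (κ₁ := κ₁) (κ₂ := κ₂) hα0 hβ0 1 0 0
  obtain ⟨u₂, hu₂, a2, b2, c2⟩ := exists_isBddDens_end (hab := hab) (hα := hα) (hβ := hβ)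
    (κ₁ := κ₁) (κ₂ := κ₂) hα0 hβ0 0 1 0
  obtain ⟨u₃, hu₃, a3, b3, c3⟩ := exists_isBddDens_end (hab := hab) (hα := hα) (hβ := hβ)
    (κ₁ := κ₁) (κ₂ := κ₂) hα0 hβ0 0 0 1
  rw [← hS] at a1 b1 a2 b2 a3 b3
  obtain ⟨M₁, hM₁0, hM₁⟩ := hu₁.bdd
  obtain ⟨M₂, hM₂0, hM₂⟩ := hu₂.bdd
  obtain ⟨M₃, hM₃0, hM₃⟩ := hu₃.bdd
  have hI : 0 ≤ ∫ s, |S.k₁ s| := integral_nonneg fun s => abs_nonneg _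
  have hI' : 0 ≤ ∫ s, |S.k₂ s| := integral_nonneg fun s => abs_nonneg _
  set M := M₁ + M₂ + M₃ with hM
  have hM0 : 0 ≤ M := by positivity
  have hba : 0 ≤ b - a := by linarith
  refine ⟨M * ((b - a) + (∫ s, |S.k₁ s|) + ∫ s, |S.k₂ s|), by positivity,
    fun τ x y z hx hy hz => ?_⟩
  have hτ : 0 ≤ τ := (abs_nonneg _).trans hx
  set q : ℝ → ℝ := fun t => x * u₁ t + y * u₂ t + z * u₃ t with hq
  have hd : IsBddDens a b q := ((hu₁.const_mul x).add (hu₂.const_mul y)).add (hu₃.const_mul z)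
  have hpot : ∀ {k : ℝ → ℝ}, IsKer k S.R → ∀ s,
      pot k q s = x * pot k u₁ s + y * pot k u₂ s + z * pot k u₃ s := fun hk s => by
    rw [hq, pot_add (((hu₁.const_mul x).add (hu₂.const_mul y)).potConv hk s)
        ((hu₃.const_mul z).potConv hk s),
      pot_add ((hu₁.const_mul x).potConv hk s) ((hu₂.const_mul y).potConv hk s),
      pot_const_mul, pot_const_mul, pot_const_mul]
  have hqb : ∀ t, |q t| ≤ M * τ := fun t => by
    calc |q t| ≤ |x * u₁ t| + |y * u₂ t| + |z * u₃ t| := abs_add_three _ _ _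
      _ ≤ τ * M₁ + τ * M₂ + τ * M₃ := by
        simp only [abs_mul]
        gcongr
        exacts [hM₁ t, hM₂ t, hM₃ t]
      _ = M * τ := by rw [hM]; ring
  have hp1 := fun s => abs_pot_le_of_bdd S.ker₁.int hqb s
  have hp2 := fun s => abs_pot_le_of_bdd S.ker₂.int hqb s
  have hm : 0 ≤ M * τ := by positivity
  refine ⟨q, hd, ?_, ?_, ?_, ?_, fun s => ⟨?_, ?_⟩⟩
  · change pot S.k₂ q a = x
    rw [hpot S.ker₂, a1, a2, a3]; ring
  · change pot S.k₁ q b = y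
    rw [hpot S.ker₁, b1, b2, b3]; ring
  · rw [hq, integral_add (f := fun t => x * u₁ t + y * u₂ t)
      ((hu₁.const_mul x).add (hu₂.const_mul y)).int (hu₃.const_mul z).int,
      integral_add (hu₁.const_mul x).int (hu₂.const_mul y).int, integral_const_mul,
      integral_const_mul, integral_const_mul, c1, c2, c3]
    ring
  · have h1 : ∫ t, |q t| = ∫ t in Icc a b, |q t| :=
      (setIntegral_eq_integral_of_forall_compl_eq_zero fun t ht => by rw [hd.supp t ht, abs_zero]).symm
    have h2 : ∫ t in Icc a b, |q t| ≤ ∫ _ in Icc a b, M * τ :=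
      setIntegral_mono hd.int.abs.integrableOn continuousOn_const.integrableOn_Icc hqb
    rw [setIntegral_const, smul_eq_mul, Measure.real, Real.volume_Icc,
      ENNReal.toReal_ofReal hba] at h2
    rw [h1]
    nlinarith [mul_nonneg hm hI, mul_nonneg hm hI']
  · nlinarith [hp1 s, mul_nonneg hm hI, mul_nonneg hm hI', mul_nonneg hm hba]
  · nlinarith [hp2 s, mul_nonneg hm hI, mul_nonneg hm hI', mul_nonneg hm hba]

/-- A continuous function whose pairings with the admissible densities are nonnegative is
constant. -/
lemma exists_const_of_pairing_nonneg (hα0 : 0 < α) (hβ0 : 0 < β) {G : ℝ → ℝ} (hG : Continuous G)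
    (h : ∀ e, IsBddDens a b e → pot (powSys hab hα hβ κ₁ κ₂).k₂ e a = 0 →
      pot (powSys hab hα hβ κ₁ κ₂).k₁ e b = 0 → ∫ t, e t = 0 → 0 ≤ ∫ t, G t * e t) :
    ∃ c, ∀ t ∈ Ioo a b, G t = c := by
  by_contra! hne
  obtain ⟨u, hu, hv⟩ := exists_isBddDens_pairing (a := a) (b := b)
    (h := ![endFun (powSys hab hα hβ κ₁ κ₂) 0, endFun (powSys hab hα hβ κ₁ κ₂) 1, fun _ => 1, G])
    (by
      intro i
      fin_cases i
      exacts [continuousOn_endFun 0, continuousOn_endFun 1, continuousOn_const, hG.continuousOn])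
    (by
      intro i
      fin_cases i
      exacts [integrableOn_endFun _ 0 _, integrableOn_endFun _ 1 _,
        continuousOn_const.integrableOn_Icc, hG.continuousOn.integrableOn_Icc])
    (by
      intro c hc
      simp only [Fin.sum_univ_four] at hc
      obtain ⟨h0, h1⟩ := coeff_endFun_eq_zero (hab := hab) (hα := hα) (hβ := hβ)
        (κ₁ := κ₁) (κ₂ := κ₂) hα0 hβ0 (c₁ := c 0) (c₂ := c 1) (G := fun t => c 2 * 1 + c 3 * G t)
        (by fun_prop) fun t ht => by
          have := hc t ht
          simp only [Matrix.cons_val] at this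
          linarith
      have h3 : c 3 = 0 := by
        by_contra h3
        obtain ⟨t, ht, hne'⟩ := hne (-(c 2) / c 3)
        refine hne' ?_
        have := hc t ht
        simp only [Matrix.cons_val, h0, h1] at this
        field_simp
        linarith
      obtain ⟨m, hm⟩ := exists_between hab
      have h2 := hc m hm
      simp [h0, h1, h3] at h2
      ext i
      fin_cases i
      exacts [h0, h1, h2, h3])
    ![0, 0, 0, -1]
  have := h u hu (hv 0) (hv 1) (by simpa using hv 2)
  have h3 : ∫ t, G t * u t = -1 := hv 3
  linarith

end powSys

/-- The adjoint of a potential is the potential with the reflected kernel. -/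
lemma integral_mul_pot {a b R : ℝ} {k g e : ℝ → ℝ} (hk : IsKer k R) (hg : IsBddDens a b g)
    (he : IsBddDens a b e) :
    ∫ x, g x * pot k e x = ∫ t, pot (fun s => k (-s)) g t * e t := by
  obtain ⟨M, -, hM⟩ := he.bdd
  have hm : AEStronglyMeasurable (fun z : ℝ × ℝ => g z.1 * (k (z.1 - z.2) * e z.2))
      (volume.prod volume) := by
    refine AEStronglyMeasurable.mul ?_ (AEStronglyMeasurable.mul ?_ ?_)
    · exact hg.int.aestronglyMeasurable.comp_fst
    · exact (hk.meas.comp (measurable_fst.sub measurable_snd)).aestronglyMeasurable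
    · exact he.int.aestronglyMeasurable.comp_snd
  have hintg : Integrable (fun z : ℝ × ℝ => g z.1 * (k (z.1 - z.2) * e z.2))
      (volume.prod volume) := by
    rw [integrable_prod_iff hm]
    refine ⟨.of_forall fun s => Integrable.const_mul (he.potConv hk s) (g s), ?_⟩
    refine Integrable.mono' (hg.int.norm.mul_const (M * ∫ s, |k s|))
      hm.norm.integral_prod_right' (.of_forall fun s => ?_)
    simp only [norm_mul]
    rw [integral_const_mul, norm_mul, norm_norm]
    refine mul_le_mul_of_nonneg_left ?_ (norm_nonneg _)
    have h := abs_pot_le_of_bdd (k := fun s => |k s|) (w := fun t => |e t|) hk.int.norm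
      (M := M) (fun t => by rw [abs_abs]; exact hM t) s
    simpa [pot] using h
  calc ∫ x, g x * pot k e x = ∫ x, ∫ t, g x * (k (x - t) * e t) := by
        simp only [pot, integral_const_mul]
    _ = ∫ t, ∫ x, g x * (k (x - t) * e t) := integral_integral_swap hintg
    _ = ∫ t, pot (fun s => k (-s)) g t * e t := by
        refine integral_congr_ae (.of_forall fun t => ?_)
        simp only [pot, ← integral_mul_const, neg_sub]
        congr 1; ext x; ring

lemma pot_powKer_eq {a b p R x : ℝ} (hR : b - a < R) (hx : x ∈ Icc a b) (w : ℝ → ℝ) :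
    pot (powKer p R) ((Icc a b).indicator w) x = ∫ t in a..x, (x - t) ^ (-p) * w t := by
  rw [intervalIntegral.integral_of_le hx.1, ← integral_indicator measurableSet_Ioc]
  refine integral_congr_ae ?_
  filter_upwards [Measure.ae_ne volume a, Measure.ae_ne volume x] with t hta htx
  by_cases ht : t ∈ Ioc a x
  · rw [indicator_of_mem ht, indicator_of_mem (show t ∈ Icc a b from ⟨ht.1.le, ht.2.trans hx.2⟩),
      powKer_of_mem ⟨sub_pos.2 (lt_of_le_of_ne ht.2 htx), by linarith [ht.1, hx.2]⟩]
  · rw [indicator_of_notMem ht]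
    by_cases h1 : t ≤ x
    · rw [indicator_of_notMem, mul_zero]
      exact fun h => ht ⟨lt_of_le_of_ne h.1 (Ne.symm hta), h1⟩
    · rw [powKer_nonpos (by linarith), zero_mul]

lemma pot_powKer_neg_eq {a b p R x : ℝ} (hR : b - a < R) (hx : x ∈ Icc a b) (w : ℝ → ℝ) :
    pot (fun s => powKer p R (-s)) ((Icc a b).indicator w) x =
      ∫ t in x..b, (t - x) ^ (-p) * w t := by
  rw [intervalIntegral.integral_of_le hx.2, ← integral_indicator measurableSet_Ioc]
  refine integral_congr_ae ?_
  filter_upwards [Measure.ae_ne volume a, Measure.ae_ne volume x] with t hta htx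
  by_cases ht : t ∈ Ioc x b
  · rw [indicator_of_mem ht, indicator_of_mem (show t ∈ Icc a b from ⟨hx.1.trans ht.1.le, ht.2⟩), neg_sub,
      powKer_of_mem ⟨by linarith [ht.1], by linarith [ht.2, hx.1]⟩]
  · rw [indicator_of_notMem ht]
    by_cases h1 : x ≤ t
    · rw [indicator_of_notMem, mul_zero]
      exact fun h => ht ⟨lt_of_le_of_ne h1 (Ne.symm htx), h.2⟩
    · rw [powKer_nonpos (by linarith), zero_mul]

lemma leftRLI_eq_pot {a b p x : ℝ} (hx : x ∈ Icc a b) (g : ℝ → ℝ) :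
    leftRLI a (1 - p) g x =
      1 / Gamma (1 - p) * pot (powKer p (b - a + 1)) ((Icc a b).indicator g) x := by
  rw [leftRLI, pot_powKer_eq (by linarith) hx, show 1 - p - 1 = -p by ring]

lemma rightRLI_eq_pot {a b p x : ℝ} (hx : x ∈ Icc a b) (g : ℝ → ℝ) :
    rightRLI b (1 - p) g x =
      1 / Gamma (1 - p) *
        pot (fun s => powKer p (b - a + 1) (-s)) ((Icc a b).indicator g) x := by
  rw [rightRLI, pot_powKer_neg_eq (by linarith) hx, show 1 - p - 1 = -p by ring]

/-- Potentials of bounded monotone functions are differentiable almost everywhere. -/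
lemma ae_differentiableAt_pot {k u : ℝ → ℝ} {M : ℝ} (hk : Integrable k) (hk0 : ∀ s, 0 ≤ k s)
    (hu : Monotone u) (hM : ∀ t, |u t| ≤ M) : ∀ᵐ x, DifferentiableAt ℝ (pot k u) x := by
  have h : pot k u = fun x => ∫ s, k s * u (x - s) := by
    ext x
    rw [pot, ← integral_sub_left_eq_self _ _ x]
    simp
  rw [h]
  have hintg : ∀ x, Integrable fun s => k s * u (x - s) := fun x =>
    hk.mul_bdd (c := M) (hu.measurable.comp (measurable_const.sub measurable_id)).aestronglyMeasurable
      (.of_forall fun s => hM _)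
  refine Monotone.ae_differentiableAt fun x z hxz => integral_mono (hintg x) (hintg z) fun s => ?_
  exact mul_le_mul_of_nonneg_left (hu (by linarith)) (hk0 s)

lemma exists_monotone_of_nonneg {a C : ℝ} {φ : ℝ → ℝ} (hC : 0 ≤ C) (hφ : Integrable φ)
    (hφ0 : ∀ t, 0 ≤ φ t) :
    Monotone ((Ici a).indicator fun x => C + ∫ t in Iic x, φ t) ∧
      ∀ x, |(Ici a).indicator (fun x => C + ∫ t in Iic x, φ t) x| ≤ C + ∫ t, φ t := by
  have h0 : ∀ x, 0 ≤ ∫ t in Iic x, φ t := fun x => integral_nonneg hφ0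
  constructor
  · intro x z hxz
    by_cases hx : x ∈ Ici a
    · rw [indicator_of_mem hx, indicator_of_mem (show z ∈ Ici a from le_trans hx hxz)]
      have := setIntegral_mono_set (μ := volume) hφ.integrableOn (.of_forall hφ0)
        (Iic_subset_Iic.2 hxz).eventuallyLE
      linarith
    · rw [indicator_of_notMem hx]
      exact indicator_nonneg (fun t _ => add_nonneg hC (h0 t)) z
  · intro x
    rw [abs_of_nonneg (indicator_nonneg (fun t _ => add_nonneg hC (h0 t)) x)]
    refine (indicator_le_self' (fun t _ => add_nonneg hC (h0 t)) x).trans ?_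
    have := setIntegral_le_integral (s := Iic x) hφ (.of_forall hφ0)
    linarith

/-- An absolutely continuous function is a difference of bounded monotone functions vanishing to the
left of the interval. -/
lemma AbsolutelyContinuousOn.exists_monotone_sub {a b : ℝ} {g : ℝ → ℝ} (hab : a ≤ b)
    (hg : AbsolutelyContinuousOn g a b) :
    ∃ u v : ℝ → ℝ, ∃ M, Monotone u ∧ Monotone v ∧ (∀ t, |u t| ≤ M) ∧ (∀ t, |v t| ≤ M) ∧
      (∀ t < a, u t = 0 ∧ v t = 0) ∧ ∀ t ∈ Icc a b, g t = u t - v t := by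
  set d : ℝ → ℝ := (Ioc a b).indicator (deriv g) with hd
  have hdi : Integrable d :=
    ((intervalIntegrable_iff_integrableOn_Ioc_of_le hab).1 hg.1).integrable_indicator
      measurableSet_Ioc
  have hgd : ∀ t ∈ Icc a b, g t = g a + ∫ s in Iic t, d s := fun t ht => by
    rw [hg.2 t ht, intervalIntegral.integral_of_le ht.1, hd, setIntegral_indicator measurableSet_Ioc]
    congr 3
    ext s
    rw [mem_Ioc, mem_inter_iff, mem_Iic, mem_Ioc]
    exact ⟨fun h => ⟨h.2, h.1, h.2.trans ht.2⟩, fun h => ⟨h.2.1, h.1⟩⟩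
  obtain ⟨h1, h2⟩ := exists_monotone_of_nonneg (a := a) (abs_nonneg (g a)) hdi.abs
    fun t => abs_nonneg _
  obtain ⟨h3, h4⟩ := exists_monotone_of_nonneg (a := a) (sub_nonneg.2 (le_abs_self (g a)))
    (hdi.abs.sub hdi) fun t => sub_nonneg.2 (le_abs_self _)
  refine ⟨_, _, _, h1, h3, fun t => (h2 t).trans (le_max_left _ _),
    fun t => (h4 t).trans (le_max_right _ _), fun t ht => ?_, fun t ht => ?_⟩
  · have : t ∉ Ici a := not_le.2 ht
    exact ⟨indicator_of_notMem this _, indicator_of_notMem this _⟩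
  · have h5 : t ∈ Ici a := ht.1
    rw [indicator_of_mem h5, indicator_of_mem h5, hgd t ht]
    rw [integral_sub' hdi.abs.integrableOn hdi.integrableOn]
    ring

lemma pot_powKer_indicator {a b p R x : ℝ} {u : ℝ → ℝ} (hx : x ≤ b) (hu : ∀ t < a, u t = 0) :
    pot (powKer p R) u x = pot (powKer p R) ((Icc a b).indicator u) x := by
  refine integral_congr_ae (.of_forall fun t => ?_)
  by_cases ht : t ∈ Icc a b
  · simp only [indicator_of_mem ht]
  · simp only [indicator_of_notMem ht, mul_zero]
    rcases lt_or_ge t a with h | h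
    · rw [hu t h, mul_zero]
    · rw [powKer_nonpos, zero_mul]
      have : b < t := not_le.1 fun h' => ht ⟨h, h'⟩
      linarith

lemma AbsolutelyContinuousOn.ae_differentiableAt_leftRLI {a b p : ℝ} {g : ℝ → ℝ} (hab : a < b)
    (hp : p < 1) (hg : AbsolutelyContinuousOn g a b) :
    ∀ᵐ x, x ∈ Ioo a b → DifferentiableAt ℝ (leftRLI a (1 - p) g) x := by
  obtain ⟨u, v, M, hu, hv, hMu, hMv, h0, hguv⟩ := hg.exists_monotone_sub hab.le
  have hk := isKer_powKer hp (show 0 < b - a + 1 by linarith)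
  filter_upwards [ae_differentiableAt_pot hk.int (powKer_nonneg _ _) hu hMu,
    ae_differentiableAt_pot hk.int (powKer_nonneg _ _) hv hMv] with x h1 h2 hx
  refine ((h1.sub h2).const_mul (1 / Gamma (1 - p))).congr_of_eventuallyEq ?_
  filter_upwards [Ioo_mem_nhds hx.1 hx.2] with z hz
  have hc : ∀ w : ℝ → ℝ, Monotone w → (∀ t, |w t| ≤ M) → PotConv (powKer p (b - a + 1)) w z :=
    fun w hw hM => PotConv.of_bdd hk.meas hk.int hw.measurable.aestronglyMeasurable hM z
  rw [leftRLI_eq_pot (Ioo_subset_Icc_self hz), Pi.sub_apply, ← pot_sub (hc u hu hMu) (hc v hv hMv),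
    pot_powKer_indicator (a := a) (u := fun t => u t - v t) hz.2.le fun t ht => by rw [(h0 t ht).1, (h0 t ht).2, sub_zero]]
  congr 2
  exact indicator_congr hguv

lemma AbsolutelyContinuousOn.comp_neg {a b : ℝ} {g : ℝ → ℝ} (hab : a ≤ b)
    (hg : AbsolutelyContinuousOn g a b) : AbsolutelyContinuousOn (fun x => g (-x)) (-b) (-a) := by
  have hd : deriv (fun x => g (-x)) = fun x => -deriv g (-x) := by
    ext x; exact deriv_comp_neg g x
  constructor
  · rw [hd]
    exact ((IntervalIntegrable.iff_comp_neg (by simp)).1 hg.1.symm).neg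
  · intro x hx
    have hx' : -x ∈ Icc a b := ⟨by linarith [hx.2], by linarith [hx.1]⟩
    change g (-x) = g (- -b) + _
    rw [hd, intervalIntegral.integral_neg, intervalIntegral.integral_comp_neg, neg_neg,
      hg.2 _ hx', hg.2 _ (right_mem_Icc.2 hab)]
    have h1 : IntervalIntegrable (deriv g) volume a (-x) := hg.1.mono_set (by
      rw [uIcc_of_le hab, uIcc_of_le hx'.1]; exact Icc_subset_Icc_right hx'.2)
    have := intervalIntegral.integral_interval_sub_left hg.1 h1
    linarith

lemma rightRLI_eq_leftRLI (b p : ℝ) (g : ℝ → ℝ) (x : ℝ) :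
    rightRLI b p g x = leftRLI (-b) p (fun t => g (-t)) (-x) := by
  rw [rightRLI, leftRLI]
  congr 1
  have := intervalIntegral.integral_comp_neg (a := x) (b := b)
    (fun t => (-x - t) ^ (p - 1) * g (-t))
  rw [← this]
  refine intervalIntegral.integral_congr fun t _ => ?_
  simp only [neg_neg]
  congr 2
  ring

lemma AbsolutelyContinuousOn.ae_differentiableAt_rightRLI {a b p : ℝ} {g : ℝ → ℝ} (hab : a < b)
    (hp : p < 1) (hg : AbsolutelyContinuousOn g a b) :
    ∀ᵐ x, x ∈ Ioo a b → DifferentiableAt ℝ (rightRLI b (1 - p) g) x := by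
  have h := (hg.comp_neg hab.le).ae_differentiableAt_leftRLI (by linarith) hp
  have h1 := (Measure.measurePreserving_neg (volume : Measure ℝ)).quasiMeasurePreserving.ae h
  filter_upwards [h1] with x hx hx'
  have h2 := hx ⟨by linarith [hx'.2], by linarith [hx'.1]⟩
  have h3 : rightRLI b (1 - p) g = leftRLI (-b) (1 - p) (fun t => g (-t)) ∘ Neg.neg := by
    ext z; exact rightRLI_eq_leftRLI b (1 - p) g z
  rw [h3]
  exact h2.comp x differentiableAt_id.neg

lemma isBddDens_indicator {a b : ℝ} {p : ℝ → ℝ} (hp : ContinuousOn p (Icc a b)) :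
    IsBddDens a b ((Icc a b).indicator p) := by
  obtain ⟨M, hM⟩ := isCompact_Icc.exists_bound_of_continuousOn hp
  refine ⟨⟨hp.integrableOn_Icc.integrable_indicator measurableSet_Icc, fun t ht =>
    indicator_of_notMem ht _⟩, |M|, abs_nonneg _, fun t => ?_⟩
  by_cases ht : t ∈ Icc a b
  · rw [indicator_of_mem ht]; exact (hM t ht).trans (le_abs_self M)
  · rw [indicator_of_notMem ht]; simp

/-- The function representing the first variation with coefficients `p` and `q`. -/
def multiplier (a b α β γ : ℝ) (p q : ℝ → ℝ) (t : ℝ) : ℝ :=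
  pot (fun s => powKer 0 (b - a + 1) (-s)) ((Icc a b).indicator p) t +
    (γ / Gamma (1 - α) * pot (fun s => powKer α (b - a + 1) (-s)) ((Icc a b).indicator q) t -
      (1 - γ) / Gamma (1 - β) * pot (powKer β (b - a + 1)) ((Icc a b).indicator q) t)

lemma integral_add_sub_const_mul {f g h : ℝ → ℝ} (hf : Integrable f) (hg : Integrable g)
    (hh : Integrable h) (c d : ℝ) :
    ∫ t, (f t + (c * g t - d * h t)) = (∫ t, f t) + (c * (∫ t, g t) - d * ∫ t, h t) := by
  rw [integral_add (g := fun t => c * g t - d * h t) hf ((hg.const_mul c).sub (hh.const_mul d)),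
    integral_sub (hg.const_mul c) (hh.const_mul d), integral_const_mul, integral_const_mul]

section multiplier

variable {a b α β γ : ℝ} {p q : ℝ → ℝ}

lemma continuous_multiplier (hab : a < b) (hα : α < 1) (hβ : β < 1)
    (hp : ContinuousOn p (Icc a b)) (hq : ContinuousOn q (Icc a b)) :
    Continuous (multiplier a b α β γ p q) := by
  have hR : 0 < b - a + 1 := by linarith
  exact ((isBddDens_indicator hp).continuous_pot (isKer_powKer one_pos hR).reflect).add
    ((((isBddDens_indicator hq).continuous_pot (isKer_powKer hα hR).reflect).const_mul _).sub
      (((isBddDens_indicator hq).continuous_pot (isKer_powKer hβ hR)).const_mul _))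

lemma integral_multiplier (hab : a < b) (hα : α < 1) (hβ : β < 1)
    (hp : ContinuousOn p (Icc a b)) (hq : ContinuousOn q (Icc a b)) {e : ℝ → ℝ} (he : IsBddDens a b e) :
    ∫ t, multiplier a b α β γ p q t * e t =
      ∫ x in a..b, (p x * pot (powKer 0 (b - a + 1)) e x +
        q x * (powSys hab hα hβ (γ / Gamma (1 - α)) ((1 - γ) / Gamma (1 - β))).K e x) := by
  have hR : 0 < b - a + 1 := by linarith
  have hk0 := isKer_powKer (α := 0) one_pos hR
  have hkα := isKer_powKer hα hR
  have hkβ := isKer_powKer hβ hR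
  have hP := isBddDens_indicator hp
  have hQ := isBddDens_indicator hq
  have hi : ∀ {k g : ℝ → ℝ} {R : ℝ}, IsBddDens a b g → IsKer k R →
      Integrable fun t => pot k g t * e t := fun hg hk =>
    he.integrable_mul (hg.continuous_pot hk).continuousOn.integrableOn_Icc
  have hj : ∀ {k g : ℝ → ℝ} {R : ℝ}, IsBddDens a b g → IsKer k R →
      Integrable fun t => g t * pot k e t := fun hg hk => by
    simpa only [mul_comm] using
      hg.integrable_mul (he.continuous_pot hk).continuousOn.integrableOn_Icc
  have h1 : ∫ t, multiplier a b α β γ p q t * e t =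
      (∫ t, pot (fun s => powKer 0 (b - a + 1) (-s)) ((Icc a b).indicator p) t * e t) +
      (γ / Gamma (1 - α) *
        (∫ t, pot (fun s => powKer α (b - a + 1) (-s)) ((Icc a b).indicator q) t * e t) -
      (1 - γ) / Gamma (1 - β) *
        ∫ t, pot (powKer β (b - a + 1)) ((Icc a b).indicator q) t * e t) := by
    rw [← integral_add_sub_const_mul (hi hP hk0.reflect) (hi hQ hkα.reflect) (hi hQ hkβ)]
    congr 1; ext t
    rw [multiplier]
    ring
  have h2 : pot (powKer β (b - a + 1)) ((Icc a b).indicator q) =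
      pot (fun s => (fun s => powKer β (b - a + 1) (-s)) (-s)) ((Icc a b).indicator q) := by
    simp only [neg_neg]
  rw [h1, h2, ← integral_mul_pot hk0 hP he, ← integral_mul_pot hkα hQ he,
    ← integral_mul_pot hkβ.reflect hQ he,
    ← integral_add_sub_const_mul (hj hP hk0) (hj hQ hkα) (hj hQ hkβ.reflect),
    intervalIntegral.integral_of_le hab.le, ← integral_Icc_eq_integral_Ioc,
    ← integral_indicator measurableSet_Icc]
  congr 1; ext t
  by_cases ht : t ∈ Icc a b
  · simp only [indicator_of_mem ht, PotSys.K, powSys]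
    ring
  · simp only [indicator_of_notMem ht]
    ring

lemma multiplier_eq {t : ℝ} (ht : t ∈ Icc a b) :
    multiplier a b α β γ p q t = (∫ s in t..b, p s) +
      (γ * rightRLI b (1 - α) q t - (1 - γ) * leftRLI a (1 - β) q t) := by
  rw [multiplier, pot_powKer_neg_eq (by linarith) ht, rightRLI_eq_pot ht, leftRLI_eq_pot ht]
  simp only [neg_zero, rpow_zero, one_mul]
  ring

/-- A constant multiplier yields the Euler–Lagrange equation. -/
lemma eulerLagrange_of_multiplier_const (hab : a < b) (hα : α < 1) (hβ : β < 1)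
    (hp : ContinuousOn p (Icc a b)) (hqa : AbsolutelyContinuousOn q a b)
    (hc : ContinuousOn (combRL a b α β γ q) (Icc a b)) {c : ℝ}
    (h : ∀ t ∈ Ioo a b, multiplier a b α β γ p q t = c) :
    ∀ x ∈ Icc a b, p x + combRL a b α β γ q x = 0 := by
  have h0 : (fun x => p x + combRL a b α β γ q x) =ᵐ[volume.restrict (Icc a b)] fun _ => 0 := by
    rw [EventuallyEq, ae_restrict_iff' measurableSet_Icc]
    filter_upwards [Measure.ae_ne volume a, Measure.ae_ne volume b,
      hqa.ae_differentiableAt_leftRLI hab hβ, hqa.ae_differentiableAt_rightRLI hab hα]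
      with x hxa hxb h1 h2 hx
    have hx' : x ∈ Ioo a b := ⟨lt_of_le_of_ne hx.1 hxa.symm, lt_of_le_of_ne hx.2 hxb⟩
    have hd1 := (h1 hx').hasDerivAt
    have hd2 := (h2 hx').hasDerivAt
    have hd3 : HasDerivAt (fun t => ∫ s in t..b, p s) (-p x) x := by
      refine intervalIntegral.integral_hasDerivAt_left ?_ ?_ ?_
      · refine (hp.mono ?_).intervalIntegrable
        rw [uIcc_of_le hx.2]
        exact Icc_subset_Icc_left hx.1
      · exact (hp.mono Ioo_subset_Icc_self).stronglyMeasurableAtFilter isOpen_Ioo x hx'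
      · exact hp.continuousAt (Icc_mem_nhds hx'.1 hx'.2)
    have hd4 := hd3.add ((hd2.const_mul γ).sub (hd1.const_mul (1 - γ)))
    have hd5 : HasDerivAt (fun _ : ℝ => c) (-p x + (γ * deriv (rightRLI b (1 - α) q) x -
        (1 - γ) * deriv (leftRLI a (1 - β) q) x)) x := by
      refine hd4.congr_of_eventuallyEq ?_
      filter_upwards [Ioo_mem_nhds hx'.1 hx'.2] with t ht
      rw [← h t ht, multiplier_eq (Ioo_subset_Icc_self ht)]
      rfl
    have := hd5.unique (hasDerivAt_const x c)
    rw [combRL, rlLeftD, rlRightD]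
    linarith
  intro x hx
  exact Measure.eqOn_Icc_of_ae_eq volume hab.ne h0 (hp.add hc) continuousOn_const hx

end multiplier

/-- The kernel system of the combined Caputo derivative. -/
abbrev caputoSys {a b α β : ℝ} (γ : ℝ) (hab : a < b) (hα : α < 1) (hβ : β < 1) : PotSys :=
  powSys hab hα hβ (γ / Gamma (1 - α)) ((1 - γ) / Gamma (1 - β))

lemma combCaputo_eq_K {a b α β γ x : ℝ} (hab : a < b) (hα : α < 1) (hβ : β < 1)
    (hx : x ∈ Icc a b) (f : ℝ → ℝ) :
    combCaputo a b α β γ f x =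
      (caputoSys γ hab hα hβ).K ((Icc a b).indicator (deriv f)) x := by
  simp only [combCaputo, caputoLeft, caputoRight, PotSys.K, powSys]
  rw [pot_powKer_eq (by linarith) hx, pot_powKer_neg_eq (by linarith) hx]
  ring

lemma PotSys.K_congr_ae (S : PotSys) {u v : ℝ → ℝ} (h : u =ᵐ[volume] v) (x : ℝ) :
    S.K u x = S.K v x := by
  rw [PotSys.K, PotSys.K, pot_congr_ae h, pot_congr_ae h]

lemma AbsolutelyContinuousOn.isDens {a b : ℝ} {f : ℝ → ℝ} (hab : a ≤ b)
    (hf : AbsolutelyContinuousOn f a b) : IsDens a b ((Icc a b).indicator (deriv f)) :=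
  ⟨((intervalIntegrable_iff_integrableOn_Icc_of_le hab).1 hf.1).integrable_indicator
    measurableSet_Icc, fun _ ht => indicator_of_notMem ht _⟩

lemma AbsolutelyContinuousOn.eq_integral_indicator {a b x : ℝ} {f : ℝ → ℝ}
    (hf : AbsolutelyContinuousOn f a b) (hx : x ∈ Icc a b) :
    f x = f a + ∫ t in a..x, (Icc a b).indicator (deriv f) t := by
  rw [hf.2 x hx]
  congr 1
  refine intervalIntegral.integral_congr fun t ht => ?_
  rw [uIcc_of_le hx.1] at ht
  exact (indicator_of_mem (show t ∈ Icc a b from ⟨ht.1, ht.2.trans hx.2⟩) _).symm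

lemma AbsolutelyContinuousOn.continuousOn {a b : ℝ} {f : ℝ → ℝ} (hab : a ≤ b)
    (hf : AbsolutelyContinuousOn f a b) : ContinuousOn f (Icc a b) :=
  ContinuousOn.congr (((intervalIntegral.continuous_primitive
    (fun _ _ => (hf.isDens hab).int.intervalIntegrable) a).const_add (f a)).continuousOn)
    fun _ hx => hf.eq_integral_indicator hx

/-- Primitives of integrable functions are almost everywhere differentiable. -/
lemma ae_hasDerivAt_primitive {w : ℝ → ℝ} (hw : Integrable w) (a c : ℝ) :
    ∀ᵐ x, HasDerivAt (fun x => c + ∫ t in a..x, w t) (w x) x := by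
  filter_upwards [LocallyIntegrable.ae_hasDerivAt_integral hw.locallyIntegrable] with x hx
  exact (hx a).const_add c

lemma AbsolutelyContinuousOn.ae_hasDerivAt {a b : ℝ} {f : ℝ → ℝ} (hab : a ≤ b)
    (hf : AbsolutelyContinuousOn f a b) : ∀ᵐ x, x ∈ Ioo a b → HasDerivAt f (deriv f x) x := by
  filter_upwards [ae_hasDerivAt_primitive (hf.isDens hab).int a (f a)] with x h hx
  rw [indicator_of_mem (Ioo_subset_Icc_self hx)] at h
  refine h.congr_of_eventuallyEq ?_
  filter_upwards [Ioo_mem_nhds hx.1 hx.2] with t ht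
  exact hf.eq_integral_indicator (Ioo_subset_Icc_self ht)

lemma indicator_ae_eq_of_Ioo {a b : ℝ} {u v : ℝ → ℝ} (h : ∀ᵐ x, x ∈ Ioo a b → u x = v x)
    (hv : ∀ x ∉ Icc a b, v x = 0) : (Icc a b).indicator u =ᵐ[volume] v := by
  filter_upwards [h, Measure.ae_ne volume a, Measure.ae_ne volume b] with x hx hxa hxb
  by_cases hm : x ∈ Icc a b
  · rw [indicator_of_mem hm]
    exact hx ⟨lt_of_le_of_ne hm.1 hxa.symm, lt_of_le_of_ne hm.2 hxb⟩
  · rw [indicator_of_notMem hm, hv x hm]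

lemma absolutelyContinuousOn_primitive {w : ℝ → ℝ} (hw : Integrable w) (a b c : ℝ) :
    AbsolutelyContinuousOn (fun x => c + ∫ t in a..x, w t) a b := by
  have h : deriv (fun x => c + ∫ t in a..x, w t) =ᵐ[volume] w := by
    filter_upwards [ae_hasDerivAt_primitive hw a c] with x hx using hx.deriv
  refine ⟨(hw.congr h.symm).intervalIntegrable, fun x _ => ?_⟩
  simp only [intervalIntegral.integral_same, add_zero]
  congr 1
  exact (intervalIntegral.integral_congr_ae (h.mono fun t ht _ => ht)).symm

lemma integral_eq_of_supp {a b : ℝ} {u : ℝ → ℝ} (hab : a ≤ b) (hu : ∀ t ∉ Icc a b, u t = 0) :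
    ∫ t in a..b, u t = ∫ t, u t := by
  rw [intervalIntegral.integral_of_le hab, ← integral_Icc_eq_integral_Ioc,
    setIntegral_eq_integral_of_forall_compl_eq_zero hu]

lemma abs_intervalIntegral_le {a x : ℝ} {u : ℝ → ℝ} (hx : a ≤ x) (hu : Integrable u) :
    |∫ t in a..x, u t| ≤ ∫ t, |u t| := by
  refine (intervalIntegral.abs_integral_le_integral_abs hx).trans ?_
  rw [intervalIntegral.integral_of_le hx]
  exact setIntegral_le_integral hu.abs (.of_forall fun t => abs_nonneg _)

lemma pot_powKer_zero {a b x : ℝ} {e : ℝ → ℝ} (he : IsDens a b e) (hx : x ∈ Icc a b) :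
    pot (powKer 0 (b - a + 1)) e x = ∫ t in a..x, e t := by
  have h : (Icc a b).indicator e = e := indicator_eq_self.2 fun t ht => by
    by_contra h; exact ht (he.supp t h)
  have := pot_powKer_eq (p := 0) (R := b - a + 1) (by linarith) hx e
  simpa [h] using this

/-- Admissible trajectories close to `y + η`, where `η` is the primitive of `e`. -/
lemma exists_competitor {a b α β γ : ℝ} {N : ℕ} (hab : a < b) (hα : α ∈ Ioo (0 : ℝ) 1)
    (hβ : β ∈ Ioo (0 : ℝ) 1) (hγ : γ ∈ Icc (0 : ℝ) 1) {y : ℝ → Fin N → ℝ}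
    (hy : memD a b α β γ y) (i : Fin N) {e : ℝ → ℝ} (he : IsBddDens a b e)
    (hea : pot (caputoSys γ hab hα.2 hβ.2).k₂ e a = 0)
    (heb : pot (caputoSys γ hab hα.2 hβ.2).k₁ e b = 0) {η τ : ℝ}
    (hη : ∀ x, γ / Gamma (1 - α) * |pot (caputoSys γ hab hα.2 hβ.2).k₁ e x| +
      (1 - γ) / Gamma (1 - β) * |pot (caputoSys γ hab hα.2 hβ.2).k₂ e x| ≤ η) (hτ : 0 < τ) :
    ∃ z : ℝ → Fin N → ℝ, memD a b α β γ z ∧ z a = y a ∧ (∀ j ≠ i, z b j = y b j) ∧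
      z b i = y b i + ∫ t, e t ∧
      norm1inf a b α β γ (z - y) ≤ (∫ t, |e t|) + η + 2 * τ ∧
      ∀ x ∈ Icc a b,
        ‖z x - (y x + Pi.single i (pot (powKer 0 (b - a + 1)) e x))‖ ≤ τ ∧
        ‖combCaputoVec a b α β γ z x - (combCaputoVec a b α β γ y x +
          Pi.single i ((caputoSys γ hab hα.2 hβ.2).K e x))‖ ≤ τ := by
  set S := caputoSys γ hab hα.2 hβ.2 with hS
  have hκ₁ : 0 ≤ γ / Gamma (1 - α) :=
    div_nonneg hγ.1 (Gamma_pos_of_pos (by linarith [hα.2])).le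
  have hκ₂ : 0 ≤ (1 - γ) / Gamma (1 - β) :=
    div_nonneg (by linarith [hγ.2]) (Gamma_pos_of_pos (by linarith [hβ.2])).le
  set w := (Icc a b).indicator (deriv fun t => y t i) with hw
  have hyi := hy.1 i
  have hwd : IsDens a b w := hyi.isDens hab.le
  set F : ℝ → ℝ := IccExtend hab.le ((Icc a b).domRestrict (combCaputo a b α β γ fun t => y t i))
    with hF
  have hFc : Continuous F := (hy.2 i).domRestrict.Icc_extend'
  have hFx : ∀ x ∈ Icc a b, F x = combCaputo a b α β γ (fun t => y t i) x := fun x hx => by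
    rw [hF, IccExtend_of_mem _ _ hx]; rfl
  have hwF : ∀ x ∈ Icc a b, S.K w x = F x := fun x hx => by
    rw [hFx x hx, combCaputo_eq_K hab hα.2 hβ.2 hx]
  obtain ⟨w', hv⟩ := PotSys.exists_variation (S := S) oneSided_powSys
    (hasEndDual_powSys hα.1 hβ.1) hκ₁ hκ₂ hwd hFc hwF
    (fun τ hτ => exists_approx_powSys hab hα.1 hα.2 hβ.1 hβ.2 hκ₁ hκ₂ hwd hFc hwF hτ)
    he hea heb hη hτ
  have hw'd : IsDens a b w' := hv.dens
  have hdiff := hw'd.sub hwd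
  have hdiff' := hdiff.sub he.toIsDens
  set f : ℝ → ℝ := fun x => y a i + ∫ t in a..x, w' t with hf
  have hfac : AbsolutelyContinuousOn f a b := absolutelyContinuousOn_primitive hw'd.int _ _ _
  have hfy : ∀ x ∈ Icc a b, f x - y x i = ∫ t in a..x, (w' t - w t) := fun x hx => by
    rw [intervalIntegral.integral_sub hw'd.int.intervalIntegrable hwd.int.intervalIntegrable,
      hf, hyi.eq_integral_indicator hx]
    ring
  have hfD : ∀ x, S.K ((Icc a b).indicator (deriv f)) x = S.K w' x := S.K_congr_ae
    (indicator_ae_eq_of_Ioo ((ae_hasDerivAt_primitive hw'd.int a (y a i)).mono fun x hx _ => hx.deriv)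
      hw'd.supp)
  have hdD : ∀ x, S.K ((Icc a b).indicator (deriv fun t => f t - y t i)) x =
      S.K (fun t => w' t - w t) x := by
    refine S.K_congr_ae (indicator_ae_eq_of_Ioo ?_ hdiff.supp)
    filter_upwards [ae_hasDerivAt_primitive hw'd.int a (y a i), hyi.ae_hasDerivAt hab.le]
      with x h1 h2 hx
    rw [hw, indicator_of_mem (Ioo_subset_Icc_self hx)]
    exact (h1.sub (h2 hx)).deriv
  set z : ℝ → Fin N → ℝ := fun t => y t + Pi.single i (f t - y t i) with hz
  have hzi : (fun t => z t i) = f := by ext t; simp [hz]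
  have hzj : ∀ j ≠ i, (fun t => z t j) = fun t => y t j := fun j hj => by
    ext t; simp [hz, Pi.single_eq_of_ne hj]
  have hfa : f a = y a i := by simp [hf]
  have hfDx : ∀ x ∈ Icc a b, combCaputo a b α β γ f x = S.K w' x := fun x hx => by
    rw [combCaputo_eq_K hab hα.2 hβ.2 hx, hfD]
  refine ⟨z, ⟨fun j => ?_, fun j => ?_⟩, ?_, fun j hj => congrFun (hzj j hj) b, ?_, ?_,
    fun x hx => ⟨?_, ?_⟩⟩
  · by_cases hj : j = i
    · rw [hj, hzi]; exact hfac
    · rw [hzj j hj]; exact hy.1 j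
  · by_cases hj : j = i
    · rw [hj, hzi]; exact ContinuousOn.congr hv.cont hfDx
    · rw [hzj j hj]; exact hy.2 j
  · simp [hz, hfa]
  · have h1 := hfy b (right_mem_Icc.2 hab.le)
    rw [integral_eq_of_supp hab.le hdiff.supp, hv.mass] at h1
    rw [show z b i = f b from congrFun hzi b]
    linarith
  · have hzy : z - y = fun t => Pi.single i (f t - y t i) := by
      ext1 t; simp [hz]
    have hvec : ∀ x ∈ Icc a b, combCaputoVec a b α β γ (z - y) x =
        Pi.single i (S.K (fun t => w' t - w t) x) := fun x hx => by
      rw [hzy]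
      ext j
      rw [combCaputoVec]
      by_cases hj : j = i
      · subst hj
        simp only [Pi.single_eq_same]
        rw [combCaputo_eq_K hab hα.2 hβ.2 hx, hdD]
      · simp only [Pi.single_eq_of_ne hj]
        simp [combCaputo, caputoLeft, caputoRight]
    have hI : ∫ t, |w' t - w t| ≤ (∫ t, |e t|) + τ := by
      have h1 : ∫ t, |w' t - w t| ≤ ∫ t, (|e t| + |w' t - w t - e t|) :=
        integral_mono hdiff.int.abs (he.int.abs.add hdiff'.int.abs) fun t => by
          have := abs_add_le (e t) (w' t - w t - e t)
          rwa [add_sub_cancel] at this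
      rw [integral_add he.int.abs hdiff'.int.abs] at h1
      linarith [hv.close]
    have h1 : sSup ((fun x => ‖(z - y) x‖) '' Icc a b) ≤ (∫ t, |e t|) + τ := by
      refine csSup_le ((nonempty_Icc.2 hab.le).image _) ?_
      rintro _ ⟨x, hx, rfl⟩
      simp only [hzy, Pi.norm_single, hfy x hx, Real.norm_eq_abs]
      exact (abs_intervalIntegral_le hx.1 hdiff.int).trans hI
    have h2 : (fun x => ‖combCaputoVec a b α β γ (z - y) x‖) '' Icc a b =
        (fun x => |S.K (fun t => w' t - w t) x|) '' Icc a b :=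
      image_congr fun x hx => by rw [hvec x hx, Pi.norm_single, Real.norm_eq_abs]
    have h3 := hv.norm
    change sSup (_ '' Icc a b) ≤ _ at h3
    rw [norm1inf, h2]
    linarith
  · have h1 : z x - (y x + Pi.single i (pot (powKer 0 (b - a + 1)) e x)) =
        Pi.single i (∫ t in a..x, (w' t - w t - e t)) := by
      rw [intervalIntegral.integral_sub hdiff.int.intervalIntegrable he.int.intervalIntegrable,
        ← hfy x hx, pot_powKer_zero he.toIsDens hx, Pi.single_sub]
      simp only [hz]
      abel
    rw [h1, Pi.norm_single, Real.norm_eq_abs]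
    exact (abs_intervalIntegral_le hx.1 hdiff'.int).trans hv.close
  · have h1 : combCaputoVec a b α β γ z x -
        (combCaputoVec a b α β γ y x + Pi.single i (S.K e x)) =
        Pi.single i (S.K w' x - F x - S.K e x) := by
      ext j
      by_cases hj : j = i
      · subst hj
        simp only [combCaputoVec, Pi.sub_apply, Pi.add_apply, Pi.single_eq_same]
        rw [hzi, hfDx x hx, hFx x hx]
        ring
      · simp only [combCaputoVec, Pi.sub_apply, Pi.add_apply, Pi.single_eq_of_ne hj]
        rw [hzj j hj]
        ring
    rw [h1, Pi.norm_single, Real.norm_eq_abs]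
    exact hv.closeK x hx

section Lagrangian

variable {N : ℕ} {a b : ℝ}

lemma continuousOn_vec {y : ℝ → Fin N → ℝ} {s : Set ℝ} (h : ∀ i, ContinuousOn (fun t => y t i) s) :
    ContinuousOn y s := continuousOn_pi.2 h

lemma tendsto_integral_of_uniform {Λ : ℝ × (Fin N → ℝ) × (Fin N → ℝ) → ℝ} (hΛ : Continuous Λ)
    (hab : a ≤ b) {A B : ℝ → Fin N → ℝ} {z v : ℕ → ℝ → Fin N → ℝ}
    (hA : ContinuousOn A (Icc a b)) (hB : ContinuousOn B (Icc a b))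
    (hz : ∀ n, ContinuousOn (z n) (Icc a b)) (hv : ∀ n, ContinuousOn (v n) (Icc a b))
    (hzA : ∀ n : ℕ, ∀ x ∈ Icc a b, ‖z n x - A x‖ ≤ 1 / ((n : ℝ) + 1))
    (hvB : ∀ n : ℕ, ∀ x ∈ Icc a b, ‖v n x - B x‖ ≤ 1 / ((n : ℝ) + 1)) :
    Tendsto (fun n => ∫ x in a..b, Λ (x, z n x, v n x)) atTop
      (𝓝 (∫ x in a..b, Λ (x, A x, B x))) := by
  obtain ⟨CA, hCA⟩ := isCompact_Icc.exists_bound_of_continuousOn hA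
  obtain ⟨CB, hCB⟩ := isCompact_Icc.exists_bound_of_continuousOn hB
  obtain ⟨M, hM⟩ := ((isCompact_Icc (a := a) (b := b)).prod
    ((isCompact_closedBall (0 : Fin N → ℝ) (CA + 1)).prod
      (isCompact_closedBall (0 : Fin N → ℝ) (CB + 1)))).exists_bound_of_continuousOn hΛ.continuousOn
  have hle : ∀ n : ℕ, 1 / ((n : ℝ) + 1) ≤ 1 := fun n => by
    rw [div_le_one (by positivity)]
    linarith [(Nat.cast_nonneg n : (0 : ℝ) ≤ n)]
  have hlim : ∀ {u : ℕ → Fin N → ℝ} {c : Fin N → ℝ}, (∀ n : ℕ, ‖u n - c‖ ≤ 1 / ((n : ℝ) + 1)) →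
      Tendsto u atTop (𝓝 c) := fun h => by
    rw [tendsto_iff_norm_sub_tendsto_zero]
    exact squeeze_zero (fun n => norm_nonneg _) h tendsto_one_div_add_atTop_nhds_zero_nat
  have hsub : uIoc a b ⊆ Icc a b := by rw [uIoc_of_le hab]; exact Ioc_subset_Icc_self
  refine intervalIntegral.tendsto_integral_filter_of_dominated_convergence (fun _ => M) ?_ ?_ ?_ ?_
  · refine .of_forall fun n => ?_
    refine ContinuousOn.aestronglyMeasurable ?_ measurableSet_uIoc
    exact (hΛ.comp_continuousOn (continuousOn_id.prodMk ((hz n).prodMk (hv n)))).mono hsub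
  · refine .of_forall fun n => .of_forall fun x hx => ?_
    have hx' := hsub hx
    refine hM _ ⟨hx', ?_, ?_⟩
    · rw [mem_closedBall_zero_iff]
      have := norm_le_norm_add_norm_sub' (z n x) (A x)
      linarith [hCA x hx', hzA n x hx', hle n]
    · rw [mem_closedBall_zero_iff]
      have := norm_le_norm_add_norm_sub' (v n x) (B x)
      linarith [hCB x hx', hvB n x hx', hle n]
  · exact intervalIntegrable_const
  · refine .of_forall fun x hx => ?_
    have hx' := hsub hx
    exact (hΛ.tendsto _).comp (tendsto_const_nhds.prodMk_nhds
      ((hlim fun n => hzA n x hx').prodMk_nhds (hlim fun n => hvB n x hx')))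

variable {L : ℝ → (Fin N → ℝ) → (Fin N → ℝ) → ℝ}

lemma pdY_eq_fderiv (hL : ContDiff ℝ 1 fun p : ℝ × (Fin N → ℝ) × (Fin N → ℝ) => L p.1 p.2.1 p.2.2)
    (i : Fin N) (x : ℝ) (u v : Fin N → ℝ) :
    pdY L i x u v = fderiv ℝ (fun p : ℝ × (Fin N → ℝ) × (Fin N → ℝ) => L p.1 p.2.1 p.2.2)
      (x, u, v) (0, Pi.single i 1, 0) := by
  have h1 : HasDerivAt (fun s => (x, Function.update u i s, v)) (0, Pi.single i 1, 0) (u i) :=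
    (hasDerivAt_const _ _).prodMk ((hasDerivAt_update u i (u i)).prodMk (hasDerivAt_const _ _))
  have h2 := ((hL.differentiable one_ne_zero) (x, u, v)).hasFDerivAt
  have h3 := HasFDerivAt.comp_hasDerivAt (u i) (f := fun s => (x, Function.update u i s, v))
    (by simpa using h2) h1
  simpa [pdY, Function.comp_def] using h3.deriv

lemma pdV_eq_fderiv (hL : ContDiff ℝ 1 fun p : ℝ × (Fin N → ℝ) × (Fin N → ℝ) => L p.1 p.2.1 p.2.2)
    (i : Fin N) (x : ℝ) (u v : Fin N → ℝ) :
    pdV L i x u v = fderiv ℝ (fun p : ℝ × (Fin N → ℝ) × (Fin N → ℝ) => L p.1 p.2.1 p.2.2)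
      (x, u, v) (0, 0, Pi.single i 1) := by
  have h1 : HasDerivAt (fun s => (x, u, Function.update v i s)) (0, 0, Pi.single i 1) (v i) :=
    (hasDerivAt_const _ _).prodMk ((hasDerivAt_const _ _).prodMk (hasDerivAt_update v i (v i)))
  have h2 := ((hL.differentiable one_ne_zero) (x, u, v)).hasFDerivAt
  have h3 := HasFDerivAt.comp_hasDerivAt (v i) (f := fun s => (x, u, Function.update v i s))
    (by simpa using h2) h1
  simpa [pdV, Function.comp_def] using h3.deriv

lemma continuousOn_pdY
    (hL : ContDiff ℝ 1 fun p : ℝ × (Fin N → ℝ) × (Fin N → ℝ) => L p.1 p.2.1 p.2.2)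
    {A B : ℝ → Fin N → ℝ} {s : Set ℝ} (hA : ContinuousOn A s) (hB : ContinuousOn B s) (i : Fin N) :
    ContinuousOn (fun x => pdY L i x (A x) (B x)) s := by
  simp only [pdY_eq_fderiv hL]
  exact ((hL.continuous_fderiv one_ne_zero).comp_continuousOn
    (continuousOn_id.prodMk (hA.prodMk hB))).clm_apply continuousOn_const

/-- The derivative of the functional along a one-component variation. -/
lemma hasDerivAt_integral_lagrangian
    (hL : ContDiff ℝ 1 fun p : ℝ × (Fin N → ℝ) × (Fin N → ℝ) => L p.1 p.2.1 p.2.2) (hab : a ≤ b)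
    {A B : ℝ → Fin N → ℝ} {P Q : ℝ → ℝ} (hA : ContinuousOn A (Icc a b))
    (hB : ContinuousOn B (Icc a b)) (hP : Continuous P) (hQ : Continuous Q) (i : Fin N) :
    HasDerivAt (fun ε => ∫ x in a..b,
        L x (A x + Pi.single i (ε * P x)) (B x + Pi.single i (ε * Q x)))
      (∫ x in a..b, (pdY L i x (A x) (B x) * P x + pdV L i x (A x) (B x) * Q x)) 0 := by
  set Λ : ℝ × (Fin N → ℝ) × (Fin N → ℝ) → ℝ := fun p => L p.1 p.2.1 p.2.2 with hΛ
  set c : ℝ → ℝ → ℝ × (Fin N → ℝ) × (Fin N → ℝ) := fun ε x =>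
    (x, A x + ε • Pi.single i (P x), B x + ε • Pi.single i (Q x)) with hc
  set d : ℝ → ℝ × (Fin N → ℝ) × (Fin N → ℝ) := fun x =>
    (0, Pi.single i (P x), Pi.single i (Q x)) with hd
  have hsingle : ∀ {R : ℝ → ℝ}, Continuous R →
      Continuous fun x => (Pi.single i (R x) : Fin N → ℝ) := fun hR =>
    (continuous_single i).comp hR
  have hcc : ContinuousOn (fun z : ℝ × ℝ => c z.1 z.2) (univ ×ˢ Icc a b) := by
    have h2 : MapsTo (Prod.snd : ℝ × ℝ → ℝ) (univ ×ˢ Icc a b) (Icc a b) := fun z hz => hz.2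
    refine continuousOn_snd.prodMk (ContinuousOn.prodMk ?_ ?_)
    · exact (hA.comp continuousOn_snd h2).add
        (continuousOn_fst.smul ((hsingle hP).comp continuous_snd).continuousOn)
    · exact (hB.comp continuousOn_snd h2).add
        (continuousOn_fst.smul ((hsingle hQ).comp continuous_snd).continuousOn)
  have hdc : Continuous d := continuous_const.prodMk ((hsingle hP).prodMk (hsingle hQ))
  have hF' : ContinuousOn (fun z : ℝ × ℝ => fderiv ℝ Λ (c z.1 z.2) (d z.2)) (univ ×ˢ Icc a b) :=
    ((hL.continuous_fderiv one_ne_zero).comp_continuousOn hcc).clm_apply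
      (hdc.comp continuous_snd).continuousOn
  obtain ⟨M, hM⟩ := ((isCompact_Icc (a := (-1 : ℝ)) (b := 1)).prod
    (isCompact_Icc (a := a) (b := b))).exists_bound_of_continuousOn
      (hF'.mono (prod_mono_left (subset_univ _)))
  have hsub : uIoc a b ⊆ Icc a b := by rw [uIoc_of_le hab]; exact Ioc_subset_Icc_self
  have hcx : ∀ ε, ContinuousOn (c ε) (Icc a b) := fun ε =>
    hcc.comp (f := fun x => (ε, x)) (by fun_prop) fun x hx => ⟨mem_univ _, hx⟩
  have hΛx : ∀ ε, ContinuousOn (fun x => Λ (c ε x)) (Icc a b) := fun ε =>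
    hL.continuous.comp_continuousOn (hcx ε)
  have hF0 : ContinuousOn (fun x => fderiv ℝ Λ (c 0 x) (d x)) (Icc a b) :=
    hF'.comp (f := fun x => ((0 : ℝ), x)) (by fun_prop) fun x hx => ⟨mem_univ _, hx⟩
  have key := intervalIntegral.hasDerivAt_integral_of_dominated_loc_of_deriv_le (μ := volume)
    (F := fun ε x => Λ (c ε x)) (F' := fun ε x => fderiv ℝ Λ (c ε x) (d x)) (x₀ := 0)
    (s := Metric.ball 0 1) (a := a) (b := b) (bound := fun _ => M)
    (Metric.ball_mem_nhds 0 one_pos)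
    (.of_forall fun ε => ((hΛx ε).mono hsub).aestronglyMeasurable measurableSet_uIoc)
    (ContinuousOn.intervalIntegrable (by rw [uIcc_of_le hab]; exact hΛx 0))
    ((hF0.mono hsub).aestronglyMeasurable measurableSet_uIoc)
    (.of_forall fun x hx ε hε => hM (ε, x) ⟨by
      rw [Metric.mem_ball, dist_zero_right, Real.norm_eq_abs, abs_lt] at hε
      exact ⟨hε.1.le, hε.2.le⟩, hsub hx⟩)
    intervalIntegrable_const
    (.of_forall fun x _ ε _ => by
      have h1 : HasDerivAt (fun ε => c ε x) (d x) ε := by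
        refine (hasDerivAt_const _ _).prodMk (HasDerivAt.prodMk ?_ ?_)
        · simpa using ((hasDerivAt_id ε).smul_const (Pi.single i (P x) : Fin N → ℝ)).const_add (A x)
        · simpa using ((hasDerivAt_id ε).smul_const (Pi.single i (Q x) : Fin N → ℝ)).const_add (B x)
      exact ((hL.differentiable one_ne_zero) (c ε x)).hasFDerivAt.comp_hasDerivAt ε h1)
  have h0 : ∀ x, fderiv ℝ Λ (c 0 x) (d x) =
      pdY L i x (A x) (B x) * P x + pdV L i x (A x) (B x) * Q x := fun x => by
    have hdx : d x = P x • ((0, Pi.single i 1, 0) : ℝ × (Fin N → ℝ) × (Fin N → ℝ)) +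
        Q x • ((0, 0, Pi.single i 1) : ℝ × (Fin N → ℝ) × (Fin N → ℝ)) := by
      simp [hd, ← Pi.single_smul]
    have hc0 : c 0 x = (x, A x, B x) := by simp [hc]
    rw [pdY_eq_fderiv hL, pdV_eq_fderiv hL, hc0, hdx, map_add, map_smul, map_smul, smul_eq_mul,
      smul_eq_mul, mul_comm (P x), mul_comm (Q x)]
  have h1 := key.2
  simp only [h0] at h1
  simpa only [hΛ, hc, ← Pi.single_smul, smul_eq_mul] using h1

end Lagrangian

lemma nonneg_of_hasDerivAt_of_le {φ : ℝ → ℝ} {d : ℝ} (hφ : HasDerivAt φ d 0)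
    (h : ∀ᶠ ε in 𝓝[>] (0 : ℝ), φ 0 ≤ φ ε) : 0 ≤ d := by
  have h1 := hφ.hasDerivWithinAt (s := Ioi 0)
  rw [hasDerivWithinAt_iff_tendsto_slope' (by simp)] at h1
  refine ge_of_tendsto h1 ?_
  filter_upwards [h, self_mem_nhdsWithin] with ε hε hε0
  rw [slope_def_field]
  exact div_nonneg (sub_nonneg.2 hε) (by linarith [mem_Ioi.1 hε0])

/-- The first variation of a local minimizer is nonnegative in every admissible direction `e`. -/
lemma firstVariation_nonneg {a b α β γ : ℝ} {N : ℕ} (hab : a < b) (hα : α ∈ Ioo (0 : ℝ) 1)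
    (hβ : β ∈ Ioo (0 : ℝ) 1) (hγ : γ ∈ Icc (0 : ℝ) 1)
    {L : ℝ → (Fin N → ℝ) → (Fin N → ℝ) → ℝ}
    (hL : ContDiff ℝ 1 (fun p : ℝ × (Fin N → ℝ) × (Fin N → ℝ) => L p.1 p.2.1 p.2.2))
    {y : ℝ → Fin N → ℝ} (hy : memD a b α β γ y) (i : Fin N) {C : Set ℝ} {δ : ℝ} (hδ : 0 < δ)
    (hmin : ∀ z : ℝ → Fin N → ℝ, memD a b α β γ z → z a = y a →
      (∀ j : Fin N, j ≠ i → z b j = y b j) → z b i ∈ C → norm1inf a b α β γ (z - y) < δ →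
      (∫ x in a..b, L x (y x) (combCaputoVec a b α β γ y x)) ≤
        ∫ x in a..b, L x (z x) (combCaputoVec a b α β γ z x))
    {e : ℝ → ℝ} (he : IsBddDens a b e) (hea : pot (caputoSys γ hab hα.2 hβ.2).k₂ e a = 0)
    (heb : pot (caputoSys γ hab hα.2 hβ.2).k₁ e b = 0)
    (hC : ∀ᶠ ε in 𝓝[>] (0 : ℝ), y b i + ε * ∫ t, e t ∈ C)
    (hq : ContinuousOn (fun x => pdV L i x (y x) (combCaputoVec a b α β γ y x)) (Icc a b)) :
    0 ≤ ∫ t, multiplier a b α β γ (fun x => pdY L i x (y x) (combCaputoVec a b α β γ y x))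
      (fun x => pdV L i x (y x) (combCaputoVec a b α β γ y x)) t * e t := by
  have hcont : ∀ {z : ℝ → Fin N → ℝ}, memD a b α β γ z → ContinuousOn z (Icc a b) ∧
      ContinuousOn (combCaputoVec a b α β γ z) (Icc a b) := fun hz =>
    ⟨continuousOn_vec fun j => (hz.1 j).continuousOn hab.le, continuousOn_vec hz.2⟩
  obtain ⟨hyc, hyD⟩ := hcont hy
  have hP : Continuous (pot (powKer 0 (b - a + 1)) e) :=
    he.continuous_pot (isKer_powKer one_pos (by linarith))
  set S := caputoSys γ hab hα.2 hβ.2 with hS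
  have hQ : Continuous (S.K e) := PotSys.continuous_K (S := S) he
  rw [integral_multiplier hab hα.2 hβ.2 (continuousOn_pdY hL hyc hyD i) hq he]
  refine nonneg_of_hasDerivAt_of_le
    (hasDerivAt_integral_lagrangian hL hab.le hyc hyD hP hQ i) ?_
  obtain ⟨M, -, hM⟩ := he.bdd
  have hκ₁ : 0 ≤ γ / Gamma (1 - α) :=
    div_nonneg hγ.1 (Gamma_pos_of_pos (sub_pos.2 hα.2)).le
  have hκ₂ : 0 ≤ (1 - γ) / Gamma (1 - β) :=
    div_nonneg (sub_nonneg.2 hγ.2) (Gamma_pos_of_pos (sub_pos.2 hβ.2)).le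
  set η := γ / Gamma (1 - α) * (M * ∫ s, |S.k₁ s|) +
    (1 - γ) / Gamma (1 - β) * (M * ∫ s, |S.k₂ s|) with hη
  have hbound : ∀ x, γ / Gamma (1 - α) * |pot S.k₁ e x| +
      (1 - γ) / Gamma (1 - β) * |pot S.k₂ e x| ≤ η := fun x =>
    add_le_add (mul_le_mul_of_nonneg_left (abs_pot_le_of_bdd S.ker₁.int hM x) hκ₁)
      (mul_le_mul_of_nonneg_left (abs_pot_le_of_bdd S.ker₂.int hM x) hκ₂)
  have hsmall : ∀ᶠ ε in 𝓝[>] (0 : ℝ), ε * ((∫ t, |e t|) + η) < δ := by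
    have : Tendsto (fun ε : ℝ => ε * ((∫ t, |e t|) + η)) (𝓝 0) (𝓝 0) := by
      simpa using (tendsto_id (x := 𝓝 (0 : ℝ))).mul_const ((∫ t, |e t|) + η)
    exact (this.mono_left nhdsWithin_le_nhds).eventually_lt_const hδ
  filter_upwards [hC, hsmall, self_mem_nhdsWithin] with ε hεC hεδ hε0
  have hε0 : 0 < ε := hε0
  set τ : ℕ → ℝ := fun n => min (1 / ((n : ℝ) + 1)) ((δ - ε * ((∫ t, |e t|) + η)) / 3) with hτ
  have hτ0 : ∀ n, 0 < τ n := fun n => lt_min (by positivity) (by linarith)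
  have hzn : ∀ n, ∃ z : ℝ → Fin N → ℝ, _ := fun n =>
    exists_competitor hab hα hβ hγ hy i (he.const_mul ε)
      (by rw [pot_const_mul, hea, mul_zero]) (by rw [pot_const_mul, heb, mul_zero])
      (η := ε * η) (τ := τ n)
      (fun x => by
        rw [pot_const_mul, pot_const_mul, abs_mul, abs_mul, abs_of_pos hε0]
        have := mul_le_mul_of_nonneg_left (hbound x) hε0.le
        linarith) (hτ0 n)
  choose z hzD hza hzj hzi hznorm hzx using hzn
  have hlim := tendsto_integral_of_uniform (Λ := fun p => L p.1 p.2.1 p.2.2) hL.continuous hab.le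
    (A := fun x => y x + Pi.single i (ε * pot (powKer 0 (b - a + 1)) e x))
    (B := fun x => combCaputoVec a b α β γ y x + Pi.single i (ε * S.K e x))
    (z := z) (v := fun n => combCaputoVec a b α β γ (z n))
    (hyc.add ((continuous_single i).comp (hP.const_mul ε)).continuousOn)
    (hyD.add ((continuous_single i).comp (hQ.const_mul ε)).continuousOn)
    (fun n => (hcont (hzD n)).1) (fun n => (hcont (hzD n)).2)
    (fun n x hx => by
      have := (hzx n x hx).1.trans (min_le_left _ _)
      rwa [pot_const_mul] at this)
    (fun n x hx => by
      have := (hzx n x hx).2.trans (min_le_left _ _)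
      rwa [PotSys.K_const_mul] at this)
  simp only [zero_mul, Pi.single_zero, add_zero]
  refine ge_of_tendsto' hlim fun n => hmin (z n) (hzD n) (hza n) (hzj n) ?_ ?_
  · rw [hzi n, integral_const_mul]
    exact hεC
  · refine (hznorm n).trans_lt ?_
    have h1 : τ n ≤ (δ - ε * ((∫ t, |e t|) + η)) / 3 := min_le_right _ _
    simp only [abs_mul, abs_of_pos hε0, integral_const_mul]
    linarith

/-- Transversality for a terminal inequality constraint `y_l(b) ≤ y_lᵇ`: a local minimizer
satisfies the Euler–Lagrange equations together with the complementarity conditions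
`T ≤ 0`, `y_l(b) ≤ y_lᵇ`, `(y_l(b) - y_lᵇ) T = 0`, where
`T = [γ (ₓI_b^{1-α} ∂L/∂v_l) - (1-γ) (ₐIₓ^{1-β} ∂L/∂v_l)]|_{x=b}`. -/
theorem fractional_transversality_inequality_endpoint
    (a b α β γ : ℝ) (N : ℕ) (hab : a < b)
    (hα : α ∈ Ioo (0 : ℝ) 1) (hβ : β ∈ Ioo (0 : ℝ) 1) (hγ : γ ∈ Icc (0 : ℝ) 1)
    (L : ℝ → (Fin N → ℝ) → (Fin N → ℝ) → ℝ)
    (hL : ContDiff ℝ 1 (fun p : ℝ × (Fin N → ℝ) × (Fin N → ℝ) => L p.1 p.2.1 p.2.2))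
    (l : Fin N) (ya : Fin N → ℝ) (yb : Fin N → ℝ) (ylb : ℝ)
    (y : ℝ → Fin N → ℝ) (hy : memD a b α β γ y)
    (hya : y a = ya) (hyb : ∀ i : Fin N, i ≠ l → y b i = yb i) (hylb : y b l ≤ ylb)
    (hmin : ∃ δ > (0 : ℝ), ∀ z : ℝ → Fin N → ℝ, memD a b α β γ z → z a = ya →
      (∀ i : Fin N, i ≠ l → z b i = yb i) → z b l ≤ ylb →
      norm1inf a b α β γ (z - y) < δ →
      (∫ x in a..b, L x (y x) (combCaputoVec a b α β γ y x)) ≤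
        ∫ x in a..b, L x (z x) (combCaputoVec a b α β γ z x))
    (hreg : ∀ i : Fin N,
      AbsolutelyContinuousOn
        (fun x => pdV L i x (y x) (combCaputoVec a b α β γ y x)) a b ∧
      ContinuousOn
        (fun x => combRL a b α β γ
          (fun t => pdV L i t (y t) (combCaputoVec a b α β γ y t)) x) (Icc a b)) :
    (∀ i : Fin N, ∀ x ∈ Icc a b,
      pdY L i x (y x) (combCaputoVec a b α β γ y x) +
        combRL a b α β γ
          (fun t => pdV L i t (y t) (combCaputoVec a b α β γ y t)) x = 0) ∧
    (γ * rightRLI b (1 - α)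
        (fun t => pdV L l t (y t) (combCaputoVec a b α β γ y t)) b -
      (1 - γ) * leftRLI a (1 - β)
        (fun t => pdV L l t (y t) (combCaputoVec a b α β γ y t)) b ≤ 0) ∧
    y b l ≤ ylb ∧
    (y b l - ylb) *
      (γ * rightRLI b (1 - α)
          (fun t => pdV L l t (y t) (combCaputoVec a b α β γ y t)) b -
        (1 - γ) * leftRLI a (1 - β)
          (fun t => pdV L l t (y t) (combCaputoVec a b α β γ y t)) b) = 0 := by
  obtain ⟨δ, hδ, hmin⟩ := hmin
  have hyc : ContinuousOn y (Icc a b) :=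
    continuousOn_vec fun j => (hy.1 j).continuousOn hab.le
  have hyD : ContinuousOn (combCaputoVec a b α β γ y) (Icc a b) := continuousOn_vec hy.2
  have hp := fun i => continuousOn_pdY hL hyc hyD i
  have hq := fun i => (hreg i).1.continuousOn hab.le
  have hmult := fun i => continuous_multiplier (γ := γ) hab hα.2 hβ.2 (hp i) (hq i)
  have hconst : ∀ i, ∃ c, ∀ t ∈ Ioo a b, multiplier a b α β γ
      (fun x => pdY L i x (y x) (combCaputoVec a b α β γ y x))
      (fun x => pdV L i x (y x) (combCaputoVec a b α β γ y x)) t = c := fun i =>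
    exists_const_of_pairing_nonneg (hab := hab) (hα := hα.2) (hβ := hβ.2)
      (κ₁ := γ / Gamma (1 - α)) (κ₂ := (1 - γ) / Gamma (1 - β)) hα.1 hβ.1 (hmult i)
      fun e he hea heb he0 =>
        firstVariation_nonneg hab hα hβ hγ hL hy i (C := {y b i}) hδ
          (fun z hz hza hzj hzi hzn => by
            have hzb : z b = y b := funext fun j => by
              by_cases hj : j = i
              · rw [hj]; exact hzi
              · exact hzj j hj
            exact hmin z hz (hza.trans hya) (fun j hj => by rw [hzb]; exact hyb j hj)
              (by rw [hzb]; exact hylb) hzn)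
          he hea heb (by simp [he0]) (hq i)
  obtain ⟨c, hc⟩ := hconst l
  have hcIcc := EqOn.closure (s := Ioo a b) hc (hmult l) continuous_const
  rw [closure_Ioo hab.ne] at hcIcc
  have hcT := hcIcc (right_mem_Icc.2 hab.le)
  rw [multiplier_eq (right_mem_Icc.2 hab.le), intervalIntegral.integral_same, zero_add] at hcT
  rw [hcT]
  have hend : ∀ v : ℝ, (∀ᶠ ε in 𝓝[>] (0 : ℝ), y b l + ε * v ≤ ylb) → 0 ≤ c * v := fun v hv => by
    obtain ⟨e, he, hea, heb, hev⟩ := exists_isBddDens_end (hab := hab) (hα := hα.2) (hβ := hβ.2)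
      (κ₁ := γ / Gamma (1 - α)) (κ₂ := (1 - γ) / Gamma (1 - β)) hα.1 hβ.1 0 0 v
    have h := firstVariation_nonneg hab hα hβ hγ hL hy l (C := Iic ylb) hδ
      (fun z hz hza hzj hzl hzn => hmin z hz (hza.trans hya)
        (fun j hj => (hzj j hj).trans (hyb j hj)) hzl hzn)
      he hea heb (by rw [hev]; exact hv) (hq l)
    rwa [integral_congr_ae (g := fun t => c * e t) (.of_forall fun t => ?_), integral_const_mul,
      hev] at h
    by_cases ht : t ∈ Icc a b
    · exact congrArg (· * e t) (hcIcc ht)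
    · simp [he.supp t ht]
  have hc0 : c ≤ 0 := by
    have := hend (-1) (by
      filter_upwards [self_mem_nhdsWithin] with ε hε
      linarith [mem_Ioi.1 hε])
    linarith
  refine ⟨fun i => ?_, hc0, hylb, ?_⟩
  · obtain ⟨d, hd⟩ := hconst i
    exact eulerLagrange_of_multiplier_const hab hα.2 hβ.2 (hp i) (hreg i).1 (hreg i).2 hd
  · rcases hylb.eq_or_lt with h | h
    · rw [h, sub_self, zero_mul]
    · have := hend 1 (by
        filter_upwards [Ioo_mem_nhdsGT (sub_pos.2 h)] with ε hε
        linarith [hε.2])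
      rw [le_antisymm hc0 (by linarith), mul_zero]
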